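/- arXiv:1202.0747 — 2 statements merged into one kernel-verified Lean document; each statement's English description precedes it below -/
import Mathlib

section
/- In a non-reroutable (m,n)-graph with distinct sources: every AA-sequence has length at most mn, and every φ-path merges at most mn times (and likewise every ψ-path merges at most mn times). In a non-reroutable (m,m)-graph with identical sources, every ψ-AA-sequence has length at most m², and every φ-path and every ψ-path merges at most m² times. -/
/-- A finite directed multigraph. -/
structure MultiDigraph where
  V : Type
  E : Type
  fintV : Fintype V
  fintE : Fintype E
  src : E → V
  dst : E → V

namespace MultiDigraph

/-- `p` is a (nonempty) directed path from `u` to `v`, given as its list of edges. -/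
def IsPathFrom (G : MultiDigraph) (u v : G.V) (p : List G.E) : Prop :=
  p ≠ [] ∧ List.Chain' (fun e f => G.dst e = G.src f) p ∧
    (∀ e ∈ p.head?, G.src e = u) ∧ ∀ e ∈ p.getLast?, G.dst e = v

/-- `G` is acyclic: there is no (nonempty) directed path from a vertex to itself. -/
def Acyclic (G : MultiDigraph) : Prop :=
  ∀ (v : G.V) (p : List G.E), ¬ G.IsPathFrom v v p

/-- `α` is a family of `c` pairwise edge-disjoint directed paths from `u` to `v`. -/
def MengerSystem (G : MultiDigraph) (u v : G.V) (c : ℕ) (α : Fin c → List G.E) : Prop :=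
  (∀ i, G.IsPathFrom u v (α i)) ∧ ∀ i j, i ≠ j → ∀ e, e ∈ α i → e ∉ α j

/-- The min-cut between `u` and `v` equals `c`: by Menger's theorem, this means the
maximum number of pairwise edge-disjoint directed paths from `u` to `v` is exactly `c`. -/
def MinCut (G : MultiDigraph) (u v : G.V) (c : ℕ) : Prop :=
  (∃ α : Fin c → List G.E, G.MengerSystem u v c α) ∧
    ¬∃ α : Fin (c + 1) → List G.E, G.MengerSystem u v (c + 1) α

/-- The Menger path system `α` from `u` to `v` is the unique one (as a set of paths):
the group `α` is not reroutable. -/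
def NonReroutable (G : MultiDigraph) (u v : G.V) (c : ℕ) (α : Fin c → List G.E) : Prop :=
  ∀ β : Fin c → List G.E, G.MengerSystem u v c β → Set.range β = Set.range α

end MultiDigraph

open MultiDigraph

/-- The block `s` occurs on the path `p` (as a contiguous subpath) strictly before the
block `t`. -/
def OrderedOn {E : Type} (p s t : List E) : Prop :=
  ∃ u v w, p = u ++ s ++ v ++ t ++ w

/-- `s` is a merging (a maximal merged subpath) of the paths `p` and `q`: a nonempty
common contiguous subpath, whose first edge is immediately preceded on `p` and on `q` by
two distinct edges, and which cannot be extended forward as a common subpath. -/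
def MergedSub {E : Type} (p q s : List E) : Prop :=
  s ≠ [] ∧ s <:+: p ∧ s <:+: q ∧
    (∃ f g, f ≠ g ∧ (f :: s) <:+: p ∧ (g :: s) <:+: q) ∧
    ∀ e, ¬((s ++ [e]) <:+: p ∧ (s ++ [e]) <:+: q)

/-- `s` is the starting subpath of the paths `p` and `q`: a nonempty maximal common
prefix. -/
def StartSub {E : Type} (p q s : List E) : Prop :=
  s ≠ [] ∧ s <+: p ∧ s <+: q ∧ ∀ e, ¬((s ++ [e]) <+: p ∧ (s ++ [e]) <+: q)

/-- `G` together with `φ` and `ψ` is a non-reroutable `(m, n)`-graph: `G` is acyclic, the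
sinks are distinct, the min-cut from `S₁` to `R₁` is `m` and from `S₂` to `R₂` is `n`,
`φ` and `ψ` are Menger path systems for the two pairs covering all edges of `G`, and both
systems are unique (non-reroutable). -/
def MNGraph (G : MultiDigraph) (S1 S2 R1 R2 : G.V) (m n : ℕ)
    (φ : Fin m → List G.E) (ψ : Fin n → List G.E) : Prop :=
  G.Acyclic ∧ R1 ≠ R2 ∧ G.MinCut S1 R1 m ∧ G.MinCut S2 R2 n ∧
    G.MengerSystem S1 R1 m φ ∧ G.MengerSystem S2 R2 n ψ ∧
    (∀ e : G.E, (∃ i, e ∈ φ i) ∨ ∃ j, e ∈ ψ j) ∧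
    G.NonReroutable S1 R1 m φ ∧ G.NonReroutable S2 R2 n ψ

/-- A visit of the alternating (AA) procedure: a triple `(a, b, s)` recording the merged
(or starting) subpath `s` together with its associated path pair `(φ_a, ψ_b)`. -/
abbrev Visit (G : MultiDigraph) (m n : ℕ) := Fin m × Fin n × List G.E

section AA

variable {G : MultiDigraph} {m n : ℕ}

/-- The visit `v` is a merged subpath of the pair `(φ_{v.1}, ψ_{v.2.1})`. -/
def MS (φ : Fin m → List G.E) (ψ : Fin n → List G.E) (v : Visit G m n) : Prop :=
  MergedSub (φ v.1) (ψ v.2.1) v.2.2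

/-- Identical-sources variant: the visit `v` is a merged subpath, or the starting subpath
shared by `φ_a` and `ψ_a` (common source, paired starting subpaths). -/
def MSI (φ ψ : Fin m → List G.E) (v : Visit G m m) : Prop :=
  MS φ ψ v ∨ (v.1 = v.2.1 ∧ StartSub (φ v.1) (ψ v.1) v.2.2)

/-- One step of the AA procedure going forward along the φ-path associated with `v`:
`w` is the first visit on `φ_{v.1}` strictly after `v`. -/
def StepAlong (φ : Fin m → List G.E) (P : Visit G m n → Prop) (v w : Visit G m n) : Prop :=
  w.1 = v.1 ∧ P w ∧ OrderedOn (φ v.1) v.2.2 w.2.2 ∧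
    ∀ u, P u → u.1 = v.1 →
      ¬(OrderedOn (φ v.1) v.2.2 u.2.2 ∧ OrderedOn (φ v.1) u.2.2 w.2.2)

/-- One step of the AA procedure going backward against the ψ-path associated with `v`:
`w` is the nearest visit on `ψ_{v.2.1}` strictly before `v`. -/
def StepAgainst (ψ : Fin n → List G.E) (P : Visit G m n → Prop) (v w : Visit G m n) : Prop :=
  w.2.1 = v.2.1 ∧ P w ∧ OrderedOn (ψ v.2.1) w.2.2 v.2.2 ∧
    ∀ u, P u → u.2.1 = v.2.1 →
      ¬(OrderedOn (ψ v.2.1) w.2.2 u.2.2 ∧ OrderedOn (ψ v.2.1) u.2.2 v.2.2)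

/-- There is no visit after `v` on its φ-path (the forward walk reaches `R₁`). -/
def NoNextAlong (φ : Fin m → List G.E) (P : Visit G m n → Prop) (v : Visit G m n) : Prop :=
  ∀ u, P u → u.1 = v.1 → ¬ OrderedOn (φ v.1) v.2.2 u.2.2

/-- There is no visit before `v` on its ψ-path (the backward walk reaches `S₂`). -/
def NoNextAgainst (ψ : Fin n → List G.E) (P : Visit G m n → Prop) (v : Visit G m n) : Prop :=
  ∀ u, P u → u.2.1 = v.2.1 → ¬ OrderedOn (ψ v.2.1) u.2.2 v.2.2

/-- `AAChain φ ψ P dir v L` : starting from the visit `v`, the alternating procedure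
(next step backward against a ψ-path if `dir = true`, forward along a φ-path if
`dir = false`) visits exactly the list `L` of further visits and then terminates. -/
inductive AAChain (φ : Fin m → List G.E) (ψ : Fin n → List G.E) (P : Visit G m n → Prop) :
    Bool → Visit G m n → List (Visit G m n) → Prop
  | stopAgainst (v : Visit G m n) : NoNextAgainst ψ P v → AAChain φ ψ P true v []
  | stopAlong (v : Visit G m n) : NoNextAlong φ P v → AAChain φ ψ P false v []
  | consAgainst (v w : Visit G m n) (rest : List (Visit G m n)) :
      StepAgainst ψ P v w → AAChain φ ψ P false w rest → AAChain φ ψ P true v (w :: rest)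
  | consAlong (v w : Visit G m n) (rest : List (Visit G m n)) :
      StepAlong φ P v w → AAChain φ ψ P true w rest → AAChain φ ψ P false v (w :: rest)

/-- `L` is the `φ_i`-AA-sequence: either `φ_i` carries no visit and `L` is empty, or `L`
starts with the first visit on `φ_i` (go along `φ_i` from `S₁` to the first merged
subpath) and then alternates: against the associated ψ-path, along the associated φ-path,
and so on, until termination.  Its length is the number of merged subpaths visited. -/
def IsPhiAA (φ : Fin m → List G.E) (ψ : Fin n → List G.E) (P : Visit G m n → Prop)
    (i : Fin m) (L : List (Visit G m n)) : Prop :=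
  (L = [] ∧ ∀ u, P u → u.1 ≠ i) ∨
    ∃ v rest, L = v :: rest ∧ v.1 = i ∧ P v ∧
      (∀ u, P u → u.1 = i → ¬ OrderedOn (φ i) u.2.2 v.2.2) ∧
      AAChain φ ψ P true v rest

/-- `L` is the `ψ_j`-AA-sequence: either `ψ_j` carries no visit and `L` is empty, or `L`
starts with the last visit on `ψ_j` (go against `ψ_j` from `R₂` to the first merged
subpath encountered) and then alternates: along the associated φ-path, against the
associated ψ-path, and so on, until termination. -/
def IsPsiAA (φ : Fin m → List G.E) (ψ : Fin n → List G.E) (P : Visit G m n → Prop)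
    (j : Fin n) (L : List (Visit G m n)) : Prop :=
  (L = [] ∧ ∀ u, P u → u.2.1 ≠ j) ∨
    ∃ v rest, L = v :: rest ∧ v.2.1 = j ∧ P v ∧
      (∀ u, P u → u.2.1 = j → ¬ OrderedOn (ψ j) v.2.2 u.2.2) ∧
      AAChain φ ψ P false v rest

end AA

theorem trail_phi (m n a t N : ℕ) (ha : a ≤ n) (ht : t ≤ m + n)
    (h : N + (a - m) * (t - m) ≤ a * t) : N ≤ 2 * (m * n) := by
  by_cases h1 : a ≤ m
  · have h2 : N ≤ a * t := by omega
    have h3 : a * t ≤ a * (m + n) := Nat.mul_le_mul_left _ ht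
    have h4 : a * m ≤ n * m := Nat.mul_le_mul_right _ ha
    have h5 : a * n ≤ m * n := Nat.mul_le_mul_right _ h1
    nlinarith
  · by_cases h6 : t ≤ m
    · have h2 : N ≤ a * t := by omega
      have h3 : a * t ≤ n * m := Nat.mul_le_mul ha h6
      nlinarith
    · obtain ⟨x, rfl⟩ := Nat.exists_eq_add_of_le (not_le.mp h1).le
      obtain ⟨y, rfl⟩ := Nat.exists_eq_add_of_le (not_le.mp h6).le
      simp only [Nat.add_sub_cancel_left] at h
      have hy : y ≤ n := by omega
      have h7 : m * (m + x) ≤ m * n := Nat.mul_le_mul_left _ ha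
      have h8 : m * y ≤ m * n := Nat.mul_le_mul_left _ hy
      nlinarith

theorem phi_step (m a t N k : ℕ) (h : N + (a - m) * (t - m) ≤ a * t) (h1 : k ≤ m) (h2 : k ≤ t) :
    (N + k) + (a + 1 - m) * (t - m) ≤ (a + 1) * t := by
  by_cases h3 : a < m
  · have : a + 1 - m = 0 := by omega
    rw [this]; nlinarith
  · have e : a + 1 - m = (a - m) + 1 := by omega
    rw [e]
    have : k + (t - m) ≤ t := by omega
    nlinarith

open Classical in
theorem trail_count {B T : Type} [Fintype B] [Fintype T] (m n K : ℕ)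
    (hB : Fintype.card B ≤ n) (hT : Fintype.card T ≤ m + n)
    (b : ℕ → B) (g : ℕ → T)
    (inj : ∀ j < K, ∀ j' < K, ∀ d ≤ 1, ∀ d' ≤ 1, b j = b j' → g (j + d) = g (j' + d') →
      j = j' ∧ d = d')
    (h1 : ∀ j < K, (Finset.univ.filter fun c : B =>
      (∃ x ≤ j, b x = c) ∧ ∃ y, j ≤ y ∧ y < K ∧ b y = c).card ≤ m)
    (h2 : ∀ j ≤ K, (Finset.univ.filter fun c : T =>
      (∃ x ≤ j, g x = c) ∧ ∃ y, j ≤ y ∧ y ≤ K ∧ g y = c).card ≤ m) :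
    K ≤ m * n := by
  let Ed : Finset (B × T) := Finset.univ.filter fun q => ∃ j < K, ∃ d ≤ 1, b j = q.1 ∧ g (j+d) = q.2
  have hEd : 2 * K ≤ Ed.card := by
    have : (Finset.range K ×ˢ Finset.range 2).card ≤ Ed.card := by
      apply Finset.card_le_card_of_injOn (fun q => (b q.1, g (q.1 + q.2)))
      · intro q hq
        simp only [Finset.coe_product, Finset.coe_range, Set.mem_prod, Set.mem_Iio] at hq
        simp only [Ed, Finset.coe_filter, Finset.mem_univ, true_and, Set.mem_ofPred_eq]
        exact ⟨q.1, hq.1, q.2, by omega, rfl, rfl⟩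
      · rintro ⟨x, y⟩ hq ⟨x', y'⟩ hq' he
        simp only [Finset.coe_product, Finset.coe_range, Set.mem_prod, Set.mem_Iio] at hq hq'
        simp only [Prod.mk.injEq] at he ⊢
        exact inj x hq.1 x' hq'.1 y (by omega) y' (by omega) he.1 he.2
    simpa [Finset.card_product, mul_comm] using this
  let Bs : ℕ → Finset B := fun j => (Finset.range j).image b
  let Gs : ℕ → Finset T := fun j => (Finset.range (j+1)).image g
  let Nn : Finset B → Finset T → Finset (B × T) := fun X Y => Ed.filter fun q => q.1 ∈ X ∧ q.2 ∈ Y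
  have key : ∀ j ≤ K, (Nn (Bs j) (Gs j)).card + ((Bs j).card - m) * ((Gs j).card - m)
      ≤ (Bs j).card * (Gs j).card := by
    intro j
    induction j with
    | zero => intro _; simp [Nn, Bs]
    | succ j ih =>
      intro hj
      have ih := ih (by omega)
      -- add letter
      have s1 : (Nn (Bs (j+1)) (Gs j)).card + ((Bs (j+1)).card - m) * ((Gs j).card - m)
          ≤ (Bs (j+1)).card * (Gs j).card := by
        have e : Bs (j+1) = insert (b j) (Bs j) := by
          simp [Bs, Finset.range_add_one, Finset.image_insert]
        by_cases hb : b j ∈ Bs j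
        · rw [e, Finset.insert_eq_of_mem hb]; exact ih
        · rw [e, Finset.card_insert_of_notMem hb]
          let Nw : Finset T := (Gs j).filter fun p => (b j, p) ∈ Ed
          have hN : (Nn (insert (b j) (Bs j)) (Gs j)).card ≤ (Nn (Bs j) (Gs j)).card + Nw.card := by
            have : Nn (insert (b j) (Bs j)) (Gs j) ⊆ Nn (Bs j) (Gs j) ∪ Nw.image (fun p => (b j, p)) := by
              rintro ⟨c, p⟩ hq
              simp only [Nn, Finset.mem_filter, Finset.mem_insert] at hq
              simp only [Nn, Nw, Finset.mem_union, Finset.mem_filter, Finset.mem_image, Prod.mk.injEq]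
              rcases hq with ⟨hq, rfl | hc, hp⟩
              · right; exact ⟨p, ⟨hp, hq⟩, rfl, rfl⟩
              · left; exact ⟨hq, hc, hp⟩
            calc _ ≤ _ := Finset.card_le_card this
              _ ≤ _ := Finset.card_union_le _ _
              _ ≤ _ := by gcongr; exact Finset.card_image_le
          have hw1 : Nw.card ≤ (Gs j).card := Finset.card_filter_le _ _
          have hw2 : Nw.card ≤ m := by
            refine le_trans (Finset.card_le_card ?_) (h2 j (by omega))
            intro p hp
            simp only [Nw, Gs, Ed, Finset.mem_filter, Finset.mem_image, Finset.mem_range, Finset.mem_univ, true_and] at hp ⊢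
            obtain ⟨⟨x, hx, hxp⟩, y, hy, d, hd, hby, hgy⟩ := hp
            refine ⟨⟨x, by omega, hxp⟩, y + d, ?_, by omega, hgy⟩
            by_contra hlt
            apply hb
            simp only [Bs, Finset.mem_image, Finset.mem_range]
            exact ⟨y, by omega, hby⟩
          have := phi_step m _ _ _ _ ih hw2 hw1
          omega
      have e : Gs (j+1) = insert (g (j+1)) (Gs j) := by
        simp only [Gs]; rw [Finset.range_add_one, Finset.image_insert]
      by_cases hb : g (j+1) ∈ Gs j
      · rw [e, Finset.insert_eq_of_mem hb]; exact s1
      · rw [e, Finset.card_insert_of_notMem hb]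
        let Nw : Finset B := (Bs (j+1)).filter fun p => (p, g (j+1)) ∈ Ed
        have hN : (Nn (Bs (j+1)) (insert (g (j+1)) (Gs j))).card ≤ (Nn (Bs (j+1)) (Gs j)).card + Nw.card := by
          have : Nn (Bs (j+1)) (insert (g (j+1)) (Gs j)) ⊆ Nn (Bs (j+1)) (Gs j) ∪ Nw.image (fun p => (p, g (j+1))) := by
            rintro ⟨c, p⟩ hq
            simp only [Nn, Finset.mem_filter, Finset.mem_insert] at hq
            simp only [Nn, Nw, Finset.mem_union, Finset.mem_filter, Finset.mem_image, Prod.mk.injEq]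
            rcases hq with ⟨hq, hc, rfl | hp⟩
            · right; exact ⟨c, ⟨hc, hq⟩, rfl, rfl⟩
            · left; exact ⟨hq, hc, hp⟩
          calc _ ≤ _ := Finset.card_le_card this
            _ ≤ _ := Finset.card_union_le _ _
            _ ≤ _ := by gcongr; exact Finset.card_image_le
        have hw1 : Nw.card ≤ (Bs (j+1)).card := Finset.card_filter_le _ _
        have hw2 : Nw.card ≤ m := by
          refine le_trans (Finset.card_le_card ?_) (h1 j (by omega))
          intro p hp
          simp only [Nw, Bs, Ed, Finset.mem_filter, Finset.mem_image, Finset.mem_range, Finset.mem_univ, true_and] at hp ⊢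
          obtain ⟨⟨x, hx, hxp⟩, y, hy, d, hd, hby, hgy⟩ := hp
          refine ⟨⟨x, by omega, hxp⟩, y, ?_, by omega, hby⟩
          by_contra hlt
          apply hb
          simp only [Gs, Finset.mem_image, Finset.mem_range]
          exact ⟨y + d, by omega, hgy⟩
        have := phi_step m (Gs j).card (Bs (j+1)).card _ _ (by rw [mul_comm ((Gs j).card - m), mul_comm (Gs j).card]; exact s1) hw2 hw1
        rw [mul_comm ((Gs j).card + 1 - m), mul_comm ((Gs j).card + 1)] at this
        omega
  have fin := key K le_rfl
  have hall : Nn (Bs K) (Gs K) = Ed := by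
    apply Finset.filter_true_of_mem
    rintro ⟨c, p⟩ hq
    simp only [Ed, Finset.mem_filter, Finset.mem_univ, true_and] at hq
    obtain ⟨j, hj, d, hd, hb, hg⟩ := hq
    simp only [Bs, Gs, Finset.mem_image, Finset.mem_range]
    exact ⟨⟨j, hj, hb⟩, j + d, by omega, hg⟩
  rw [hall] at fin
  have := trail_phi m n _ _ _ ((Finset.card_le_univ (Bs K)).trans hB) ((Finset.card_le_univ (Gs K)).trans hT) fin
  omega
section AbstractPS

open Relation

theorem tg_m {X : Type} {r p : X → X → Prop} (h : ∀ a b, r a b → p a b) {x y : X}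
    (t : TransGen r x y) : TransGen p x y := by
  induction t with
  | single h1 => exact .single (h _ _ h1)
  | tail _ h1 ih => exact ih.tail (h _ _ h1)

theorem rtg_m {X : Type} {r p : X → X → Prop} (h : ∀ a b, r a b → p a b) {x y : X}
    (t : ReflTransGen r x y) : ReflTransGen p x y := by
  induction t with
  | refl => exact .refl
  | tail _ h1 ih => exact ih.tail (h _ _ h1)

/-- orientation relation: edges of the system forward, other edges backward -/
def Hrel {V E : Type} (src dst : E → V) {c : ℕ} (on : E → Fin c → Prop) (x y : V) : Prop :=
  ∃ e, ((∃ k, on e k) ∧ src e = x ∧ dst e = y) ∨ ((¬ ∃ k, on e k) ∧ dst e = x ∧ src e = y)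

/-- forward step in the graph -/
def Gst {V E : Type} (src dst : E → V) (x y : V) : Prop := ∃ e, src e = x ∧ dst e = y

/-- abstract unique path system -/
structure PS {V E : Type} (src dst : E → V) (c : ℕ) where
  on : E → Fin c → Prop
  pos : E → ℕ
  S : V
  uniq : ∀ e k k', on e k → on e k' → k = k'
  inj : ∀ e e' k, on e k → on e' k → pos e = pos e' → e = e'
  dn : ∀ e k i, on e k → i ≤ pos e → ∃ e', on e' k ∧ pos e' = i
  link : ∀ e e' k, on e k → on e' k → pos e' = pos e + 1 → dst e = src e'
  first : ∀ e k, on e k → pos e = 0 → src e = S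
  inU : ∀ e1 e2 e3 k1 k, on e1 k1 → on e2 k → on e3 k → pos e3 = pos e2 + 1 →
    dst e1 = dst e2 → e1 = e2
  acyc : ∀ x, ¬ TransGen (Hrel src dst on) x x

namespace PS

variable {V E : Type} {src dst : E → V} {m n : ℕ}

/-- immediate predecessor on a path -/
def pre (P : PS src dst m) (f e : E) : Prop := ∃ k, P.on f k ∧ P.on e k ∧ P.pos e = P.pos f + 1

/-- step along path `a` -/
def F (P : PS src dst m) (a : Fin m) (x y : V) : Prop := ∃ e, P.on e a ∧ src e = x ∧ dst e = y

def Head (P : PS src dst m) (Q : PS src dst n) (e : E) : Prop :=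
  ∃ f g, P.pre f e ∧ Q.pre g e ∧ f ≠ g

def ns (P : PS src dst m) (Q : PS src dst n) (e e' : E) : Prop := P.pre e e' ∧ Q.pre e e'

def A (P : PS src dst m) (Q : PS src dst n) (x y : V) : Prop :=
  ∃ e, ((∃ k, P.on e k) ∧ (¬ ∃ k, Q.on e k) ∧ src e = x ∧ dst e = y) ∨
    ((¬ ∃ k, P.on e k) ∧ (∃ k, Q.on e k) ∧ dst e = x ∧ src e = y)

theorem Head.symm {P : PS src dst m} {Q : PS src dst n} {e : E} (h : Head P Q e) : Head Q P e := by
  obtain ⟨f, g, h1, h2, h3⟩ := h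
  exact ⟨g, f, h2, h1, h3.symm⟩

theorem ns.symm {P : PS src dst m} {Q : PS src dst n} {e e' : E} (h : ns P Q e e') : ns Q P e e' :=
  ⟨h.2, h.1⟩

theorem A.symm {P : PS src dst m} {Q : PS src dst n} {x y : V} (h : A P Q x y) : A Q P y x := by
  obtain ⟨e, ⟨h1, h2, h3, h4⟩ | ⟨h1, h2, h3, h4⟩⟩ := h
  · exact ⟨e, Or.inr ⟨h2, h1, h4, h3⟩⟩
  · exact ⟨e, Or.inl ⟨h2, h1, h4, h3⟩⟩

theorem A.H {P : PS src dst m} {Q : PS src dst n} {x y : V} (h : A P Q x y) :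
    Hrel src dst P.on x y := by
  obtain ⟨e, ⟨h1, h2, h3, h4⟩ | ⟨h1, h2, h3, h4⟩⟩ := h
  · exact ⟨e, Or.inl ⟨h1, h3, h4⟩⟩
  · exact ⟨e, Or.inr ⟨h1, h3, h4⟩⟩

theorem A_tg_symm {P : PS src dst m} {Q : PS src dst n} {x y : V} (h : TransGen (A P Q) x y) :
    TransGen (A Q P) y x := by
  have : TransGen (Function.swap (A Q P)) x y := tg_m (fun _ _ h => A.symm h) h
  exact transGen_swap.1 this

theorem A_tg_H {P : PS src dst m} {Q : PS src dst n} {x y : V} (h : TransGen (A P Q) x y) :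
    TransGen (Hrel src dst P.on) x y := tg_m (fun _ _ h => A.H h) h

theorem F.H {P : PS src dst m} {a : Fin m} {x y : V} (h : P.F a x y) :
    Hrel src dst P.on x y := by
  obtain ⟨e, h1, h2, h3⟩ := h
  exact ⟨e, Or.inl ⟨⟨a, h1⟩, h2, h3⟩⟩

theorem F.G {P : PS src dst m} {a : Fin m} {x y : V} (h : P.F a x y) :
    Gst src dst x y := by
  obtain ⟨e, h1, h2, h3⟩ := h
  exact ⟨e, h2, h3⟩

theorem ns_swap_rtg {P : PS src dst m} {Q : PS src dst n} {x y : E}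
    (h : ReflTransGen (ns P Q) x y) : ReflTransGen (ns Q P) x y :=
  rtg_m (fun _ _ h => ns.symm h) h

/-- walk between two edges of a path -/
theorem walk (P : PS src dst m) (a : Fin m) (R : V → V → Prop) (e : E) (he : P.on e a) :
    ∀ (d : ℕ) (e' : E), P.on e' a → P.pos e' = P.pos e + 1 + d →
    (∀ x, P.on x a → P.pos e < P.pos x → P.pos x < P.pos e' → R (src x) (dst x)) →
    ReflTransGen R (dst e) (src e') := by
  intro d
  induction d with
  | zero =>
    intro e' he' hp _
    rw [P.link e e' a he he' (by omega)]
  | succ d ih =>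
    intro e' he' hp hR
    obtain ⟨x, hx, hxp⟩ := P.dn e' a (P.pos e + 1 + d) he' (by omega)
    have h1 := ih x hx hxp (fun y hy h1 h2 => hR y hy h1 (by omega))
    have h2 := hR x hx (by omega) (by omega)
    rw [← P.link x e' a hx he' (by omega)]
    exact h1.tail h2

theorem walk' (P : PS src dst m) {a : Fin m} {e e' : E} (he : P.on e a) (he' : P.on e' a)
    (h : P.pos e < P.pos e') : ReflTransGen (P.F a) (dst e) (src e') :=
  P.walk a (P.F a) e he (P.pos e' - P.pos e - 1) e' he' (by omega)
    (fun x hx _ _ => ⟨x, hx, rfl, rfl⟩)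

theorem walk_sd (P : PS src dst m) {a : Fin m} {e e' : E} (he : P.on e a) (he' : P.on e' a)
    (h : P.pos e ≤ P.pos e') : TransGen (P.F a) (src e) (dst e') := by
  rcases h.lt_or_eq with h | h
  · exact (TransGen.single ⟨e, he, rfl, rfl⟩).trans_left (P.walk' he he' h) |>.tail ⟨e', he', rfl, rfl⟩
  · obtain rfl := P.inj e e' a he he' h
    exact TransGen.single ⟨e, he, rfl, rfl⟩

theorem walk_ss (P : PS src dst m) {a : Fin m} {e e' : E} (he : P.on e a) (he' : P.on e' a)
    (h : P.pos e < P.pos e') : TransGen (P.F a) (src e) (src e') :=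
  (TransGen.single ⟨e, he, rfl, rfl⟩).trans_left (P.walk' he he' h)

theorem walk_dd (P : PS src dst m) {a : Fin m} {e e' : E} (he : P.on e a) (he' : P.on e' a)
    (h : P.pos e < P.pos e') : TransGen (P.F a) (dst e) (dst e') :=
  TransGen.tail' (P.walk' he he' h) ⟨e', he', rfl, rfl⟩

theorem walk_S (P : PS src dst m) {a : Fin m} {e : E} (he : P.on e a) :
    ReflTransGen (P.F a) P.S (src e) := by
  obtain ⟨x, hx, hx0⟩ := P.dn e a 0 he (Nat.zero_le _)
  rw [← P.first x a hx hx0]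
  rcases Nat.eq_zero_or_pos (P.pos e) with h | h
  · obtain rfl := P.inj e x a he hx (by omega)
    rfl
  · exact (P.walk_ss hx he (by omega)).to_reflTransGen

theorem F_G_tg {P : PS src dst m} {a : Fin m} {x y : V} (h : TransGen (P.F a) x y) :
    TransGen (Gst src dst) x y := tg_m (fun _ _ h => F.G h) h

theorem F_G_rtg {P : PS src dst m} {a : Fin m} {x y : V} (h : ReflTransGen (P.F a) x y) :
    ReflTransGen (Gst src dst) x y := rtg_m (fun _ _ h => F.G h) h

theorem F_H_tg {P : PS src dst m} {a : Fin m} {x y : V} (h : TransGen (P.F a) x y) :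
    TransGen (Hrel src dst P.on) x y := tg_m (fun _ _ h => F.H h) h

theorem F_H_rtg {P : PS src dst m} {a : Fin m} {x y : V} (h : ReflTransGen (P.F a) x y) :
    ReflTransGen (Hrel src dst P.on) x y := rtg_m (fun _ _ h => F.H h) h

theorem pre_uniq (P : PS src dst m) {f f' e : E} (h : P.pre f e) (h' : P.pre f' e) : f = f' := by
  obtain ⟨k, h1, h2, h3⟩ := h
  obtain ⟨k', h1', h2', h3'⟩ := h'
  obtain rfl := P.uniq _ _ _ h2 h2'
  exact P.inj _ _ k h1 h1' (by omega)

theorem post_uniq (P : PS src dst m) {f e e' : E} (h : P.pre f e) (h' : P.pre f e') : e = e' := by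
  obtain ⟨k, h1, h2, h3⟩ := h
  obtain ⟨k', h1', h2', h3'⟩ := h'
  obtain rfl := P.uniq _ _ _ h1 h1'
  exact P.inj _ _ k h2 h2' (by omega)

theorem pre_on (P : PS src dst m) {f e : E} {a : Fin m} (h : P.pre f e) (he : P.on e a) :
    P.on f a ∧ P.pos e = P.pos f + 1 := by
  obtain ⟨k, h1, h2, h3⟩ := h
  obtain rfl := P.uniq _ _ _ he h2
  exact ⟨h1, h3⟩

theorem on_pre (P : PS src dst m) {f e : E} {a : Fin m} (h : P.pre f e) (he : P.on f a) :
    P.on e a ∧ P.pos e = P.pos f + 1 := by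
  obtain ⟨k, h1, h2, h3⟩ := h
  obtain rfl := P.uniq _ _ _ he h1
  exact ⟨h2, h3⟩

theorem exists_pre (P : PS src dst m) {e : E} {a : Fin m} (he : P.on e a) (h : 0 < P.pos e) :
    ∃ f, P.pre f e := by
  obtain ⟨x, hx, hx0⟩ := P.dn e a (P.pos e - 1) he (by omega)
  exact ⟨x, a, hx, he, by omega⟩

theorem pre_link (P : PS src dst m) {f e : E} (h : P.pre f e) : dst f = src e := by
  obtain ⟨k, h1, h2, h3⟩ := h
  exact P.link _ _ k h1 h2 h3

/-- predecessor of a head is not on the other system -/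
theorem Head.pre_not {P : PS src dst m} {Q : PS src dst n} {e f : E} (h : Head P Q e)
    (hf : P.pre f e) : ¬ ∃ k, Q.on f k := by
  rintro ⟨k, hk⟩
  obtain ⟨f', g, h1, h2, h3⟩ := h
  obtain rfl := P.pre_uniq hf h1
  have e1 := P.pre_link hf
  have e2 := Q.pre_link h2
  obtain ⟨k', i1, i2, i3⟩ := h2
  exact h3 (Q.inU f g e k k' hk i1 i2 i3 (e1.trans e2.symm))

def Term (P : PS src dst m) (Q : PS src dst n) (l : E) : Prop := ∀ e, ¬ ns P Q l e

/-- a maximal shared block -/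
structure Blk (P : PS src dst m) (Q : PS src dst n) (a : Fin m) (b : Fin n) (u l : E) : Prop where
  onP : P.on u a
  onQ : Q.on u b
  run : ReflTransGen (ns P Q) u l
  term : Term P Q l
  start : Head P Q u ∨ (P.pos u = 0 ∧ Q.pos u = 0)

theorem Blk.symm {P : PS src dst m} {Q : PS src dst n} {a : Fin m} {b : Fin n} {u l : E}
    (h : Blk P Q a b u l) : Blk Q P b a u l :=
  ⟨h.onQ, h.onP, ns_swap_rtg h.run, fun e he => h.term e he.symm,
    h.start.imp Head.symm And.symm⟩

theorem run_on {P : PS src dst m} {Q : PS src dst n} {a : Fin m} {u l : E}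
    (hu : P.on u a) (h : ReflTransGen (ns P Q) u l) : P.on l a ∧ P.pos u ≤ P.pos l := by
  induction h with
  | refl => exact ⟨hu, le_rfl⟩
  | tail _ h2 ih =>
    have := P.on_pre h2.1 ih.1
    exact ⟨this.1, by omega⟩

theorem Blk.lP {P : PS src dst m} {Q : PS src dst n} {a : Fin m} {b : Fin n} {u l : E}
    (h : Blk P Q a b u l) : P.on l a := (run_on h.onP h.run).1

theorem Blk.lQ {P : PS src dst m} {Q : PS src dst n} {a : Fin m} {b : Fin n} {u l : E}
    (h : Blk P Q a b u l) : Q.on l b := h.symm.lP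

theorem Blk.le {P : PS src dst m} {Q : PS src dst n} {a : Fin m} {b : Fin n} {u l : E}
    (h : Blk P Q a b u l) : P.pos u ≤ P.pos l := (run_on h.onP h.run).2

theorem run_lt {P : PS src dst m} {Q : PS src dst n} {a : Fin m} {u l x : E}
    (hu : P.on u a) (h : ReflTransGen (ns P Q) u l) (hx : P.on x a) (hH : Head P Q x)
    (hlt : P.pos u < P.pos x) : P.pos l < P.pos x := by
  induction h with
  | refl => exact hlt
  | @tail y z h1 h2 ih =>
    have hy := (run_on hu h1).1
    have := P.on_pre h2.1 hy
    by_contra hc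
    obtain rfl := P.inj _ _ _ this.1 hx (by omega)
    obtain ⟨f, g, i1, i2, i3⟩ := hH
    exact i3 ((P.pre_uniq i1 h2.1).trans (Q.pre_uniq h2.2 i2))

theorem Term.uniq {P : PS src dst m} {Q : PS src dst n} {u l l' : E}
    (h : ReflTransGen (ns P Q) u l) (h' : ReflTransGen (ns P Q) u l')
    (t : Term P Q l) (t' : Term P Q l') : l = l' := by
  have U : Relator.RightUnique (ns P Q) := fun _ _ _ h h' => P.post_uniq h.1 h'.1
  rcases ReflTransGen.total_of_right_unique U h h' with h | h
  · rcases h.cases_head with h | ⟨c, h, _⟩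
    · exact h
    · exact (t _ h).elim
  · rcases h.cases_head with h | ⟨c, h, _⟩
    · exact h.symm
    · exact (t' _ h).elim

theorem gap {P : PS src dst m} {Q : PS src dst n} (hG : ∀ x, ¬ TransGen (Gst src dst) x x)
    {a : Fin m} {b : Fin n} {l e : E} (hl : P.on l a) (hlQ : Q.on l b) (ht : Term P Q l)
    (he : P.on e a)
    (hH : Head P Q e) (hlt : P.pos l < P.pos e)
    (hno : ∀ x, P.on x a → Head P Q x → P.pos l < P.pos x → P.pos x < P.pos e → False) :
    TransGen (A P Q) (dst l) (src e) := by
  have key : ∀ d x, P.on x a → P.pos x = P.pos l + 1 + d → P.pos x < P.pos e →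
      ¬ ∃ k, Q.on x k := by
    intro d
    induction d with
    | zero =>
      rintro x hx hd hlt ⟨k, hk⟩
      rcases Nat.eq_zero_or_pos (Q.pos x) with h0 | h0
      · have h1 := Q.walk_S hlQ
        rw [← Q.first x k hk h0] at h1
        exact hG _ ((F_G_tg (P.walk_ss hl hx (by omega))).trans_left (F_G_rtg h1))
      · obtain ⟨g, hg⟩ := Q.exists_pre hk h0
        have hp : P.pre l x := ⟨a, hl, hx, by omega⟩
        by_cases hgl : l = g
        · subst hgl
          exact ht x ⟨hp, hg⟩
        · exact hno x hx ⟨l, g, hp, hg, hgl⟩ (by omega) (by omega)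
    | succ d ih =>
      rintro x hx hd hlt ⟨k, hk⟩
      rcases Nat.eq_zero_or_pos (Q.pos x) with h0 | h0
      · have h1 := Q.walk_S hlQ
        rw [← Q.first x k hk h0] at h1
        exact hG _ ((F_G_tg (P.walk_ss hl hx (by omega))).trans_left (F_G_rtg h1))
      · obtain ⟨g, hg⟩ := Q.exists_pre hk h0
        obtain ⟨f, hp⟩ := P.exists_pre hx (by omega)
        by_cases hgl : f = g
        · subst hgl
          obtain ⟨o1, o2⟩ := P.pre_on hp hx
          exact ih f o1 (by omega) (by omega) ⟨k, (Q.pre_on hg hk).1⟩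
        · exact hno x hx ⟨f, g, hp, hg, hgl⟩ (by omega) (by omega)
  have hA : ∀ x, P.on x a → P.pos l < P.pos x → P.pos x < P.pos e → A P Q (src x) (dst x) := by
    intro x hx h1 h2
    exact ⟨x, Or.inl ⟨⟨a, hx⟩, key (P.pos x - P.pos l - 1) x hx (by omega) h2, rfl, rfl⟩⟩
  obtain ⟨f, hf⟩ := P.exists_pre he (by omega)
  obtain ⟨f1, f2⟩ := P.pre_on hf he
  have hfn := hH.pre_not hf
  have hfl : P.pos l < P.pos f := by
    by_contra hc
    obtain rfl := P.inj _ _ _ f1 hl (by omega)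
    exact hfn ⟨b, hlQ⟩
  have := P.walk a (A P Q) l hl (P.pos f - P.pos l - 1) f f1 (by omega)
    (fun x hx h1 h2 => hA x hx h1 (by omega))
  rw [← P.pre_link hf]
  exact TransGen.tail' this (hA f f1 hfl (by omega))

theorem Blk.sd {P : PS src dst m} {Q : PS src dst n} {a : Fin m} {b : Fin n} {u l : E}
    (h : Blk P Q a b u l) : TransGen (P.F a) (src u) (dst l) := P.walk_sd h.onP h.lP h.le

theorem Blk.posQ {P : PS src dst m} {Q : PS src dst n} (hG : ∀ x, ¬ TransGen (Gst src dst) x x)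
    {a : Fin m} {b : Fin n} {u u' : E}
    (h : P.on u a) (h' : P.on u' a) (hq : Q.on u b) (hq' : Q.on u' b)
    (hlt : P.pos u < P.pos u') : Q.pos u < Q.pos u' := by
  by_contra hc
  rcases (not_lt.1 hc).lt_or_eq with h1 | h1
  · exact hG _ ((F_G_tg (P.walk_ss h h' hlt)).trans (F_G_tg (Q.walk_ss hq' hq h1)))
  · obtain rfl := Q.inj _ _ _ hq' hq h1
    omega

/-- earlier block reaches later block on the same path -/
theorem Blk.reach {P : PS src dst m} {Q : PS src dst n} {a : Fin m} {b b' : Fin n} {u l u' l' : E}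
    (h : Blk P Q a b u l) (h' : Blk P Q a b' u' l') (hlt : P.pos u < P.pos u')
    {x y : V} (hx : x = src u ∨ x = dst l) (hy : y = src u' ∨ y = dst l') :
    ReflTransGen (P.F a) x y := by
  have hH : Head P Q u' := by
    rcases h'.start with h | h
    · exact h
    · omega
  have h2 := run_lt h.onP h.run h'.onP hH hlt
  have h3 := P.walk' h.lP h'.onP h2
  have h4 : ReflTransGen (P.F a) x (dst l) := by
    rcases hx with rfl | rfl
    · exact h.sd.to_reflTransGen
    · rfl
  have h5 : ReflTransGen (P.F a) (src u') y := by
    rcases hy with rfl | rfl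
    · rfl
    · exact h'.sd.to_reflTransGen
  exact (h4.trans h3).trans h5

theorem pairDistinct {P : PS src dst m} {Q : PS src dst n}
    (hG : ∀ x, ¬ TransGen (Gst src dst) x x) {a : Fin m} {b : Fin n} {u l u' l' : E}
    (h : Blk P Q a b u l) (h' : Blk P Q a b u' l')
    {x y : V} (hx : x = src u ∨ x = dst l) (hy : y = src u' ∨ y = dst l')
    (hA : TransGen (A P Q) x y) : False := by
  have hP := A_tg_H hA
  have hQ := A_tg_H (A_tg_symm hA)
  rcases lt_trichotomy (P.pos u) (P.pos u') with hlt | heq | hlt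
  · have := Blk.posQ hG h.onP h'.onP h.onQ h'.onQ hlt
    exact Q.acyc _ (hQ.trans_left (F_H_rtg (h.symm.reach h'.symm this hx hy)))
  · obtain rfl := P.inj _ _ _ h.onP h'.onP heq
    obtain rfl := Term.uniq h.run h'.run h.term h'.term
    rcases hx with rfl | rfl <;> rcases hy with rfl | rfl
    · exact P.acyc _ hP
    · exact Q.acyc _ (hQ.trans (F_H_tg h.symm.sd))
    · exact P.acyc _ (hP.trans (F_H_tg h.sd))
    · exact P.acyc _ hP
  · exact P.acyc _ (hP.trans_left (F_H_rtg (h'.reach h hlt hy hx)))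

theorem exists_term [Finite E] (P : PS src dst m) (Q : PS src dst n) (e : E) :
    ∃ l, ReflTransGen (ns P Q) e l ∧ Term P Q l := by
  obtain ⟨N, hN⟩ := (Set.finite_range P.pos).bddAbove
  have hN' : ∀ e, P.pos e ≤ N := fun e => hN ⟨e, rfl⟩
  have : ∀ d e, N ≤ P.pos e + d → ∃ l, ReflTransGen (ns P Q) e l ∧ Term P Q l := by
    intro d
    induction d with
    | zero =>
      intro e he
      refine ⟨e, .refl, fun e' h => ?_⟩
      obtain ⟨k, _, _, h3⟩ := h.1
      have := hN' e'
      omega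
    | succ d ih =>
      intro e he
      by_cases ht : Term P Q e
      · exact ⟨e, .refl, ht⟩
      · simp only [Term, not_forall, not_not] at ht
        obtain ⟨e', h⟩ := ht
        obtain ⟨k, _, _, h3⟩ := h.1
        obtain ⟨l, i1, i2⟩ := ih e' (by omega)
        exact ⟨l, ReflTransGen.head h i1, i2⟩
  exact this N e (by omega)

/-- consecutive heads on a path of `P` -/
def nxt (P : PS src dst m) (Q : PS src dst n) (a : Fin m) (u e : E) : Prop :=
  P.on u a ∧ P.on e a ∧ Head P Q u ∧ Head P Q e ∧ P.pos u < P.pos e ∧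
    ∀ x, P.on x a → Head P Q x → P.pos u < P.pos x → P.pos x < P.pos e → False

/-- transitions between states -/
def pr (P : PS src dst m) (Q : PS src dst n) (x y : E × Bool) : Prop :=
  (x.2 = true ∧ y.2 = false ∧ ∃ a, nxt P Q a x.1 y.1) ∨
  (x.2 = false ∧ y.2 = true ∧ ∃ b, nxt Q P b y.1 x.1)

theorem nxt_left {P : PS src dst m} {Q : PS src dst n} {a a' : Fin m} {u u' e : E}
    (h : nxt P Q a u e) (h' : nxt P Q a' u' e) : u = u' := by
  obtain ⟨h1, h2, h3, h4, h5, h6⟩ := h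
  obtain ⟨h1', h2', h3', h4', h5', h6'⟩ := h'
  obtain rfl := P.uniq _ _ _ h2 h2'
  rcases lt_trichotomy (P.pos u) (P.pos u') with h | h | h
  · exact (h6 _ h1' h3' h h5').elim
  · exact P.inj _ _ _ h1 h1' h
  · exact (h6' _ h1 h3 h h5).elim

theorem nxt_right {P : PS src dst m} {Q : PS src dst n} {a a' : Fin m} {u e e' : E}
    (h : nxt P Q a u e) (h' : nxt P Q a' u e') : e = e' := by
  obtain ⟨h1, h2, h3, h4, h5, h6⟩ := h
  obtain ⟨h1', h2', h3', h4', h5', h6'⟩ := h'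
  obtain rfl := P.uniq _ _ _ h1 h1'
  rcases lt_trichotomy (P.pos e) (P.pos e') with h | h | h
  · exact (h6' _ h2 h4 h5 h).elim
  · exact P.inj _ _ _ h2 h2' h
  · exact (h6 _ h2' h4' h5' h).elim

theorem exists_prev [Finite E] {P : PS src dst m} {Q : PS src dst n} {a : Fin m} {u e : E}
    (hu : P.on u a) (he : P.on e a) (Hu : Head P Q u) (He : Head P Q e)
    (h : P.pos u < P.pos e) : ∃ u', nxt P Q a u' e := by
  obtain ⟨x, hx, hm⟩ := Set.exists_max_image
    {x | P.on x a ∧ Head P Q x ∧ P.pos x < P.pos e} P.pos (Set.toFinite _) ⟨u, hu, Hu, h⟩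
  exact ⟨x, hx.1, he, hx.2.1, He, hx.2.2, fun y h1 h2 h3 h4 => by
    have := hm y ⟨h1, h2, h4⟩
    omega⟩

theorem exists_next [Finite E] {P : PS src dst m} {Q : PS src dst n} {a : Fin m} {u e : E}
    (hu : P.on u a) (he : P.on e a) (Hu : Head P Q u) (He : Head P Q e)
    (h : P.pos u < P.pos e) : ∃ e', nxt P Q a u e' := by
  obtain ⟨x, hx, hm⟩ := Set.exists_min_image
    {x | P.on x a ∧ Head P Q x ∧ P.pos u < P.pos x} P.pos (Set.toFinite _) ⟨e, he, He, h⟩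
  exact ⟨x, hu, hx.1, Hu, hx.2.1, hx.2.2, fun y h1 h2 h3 h4 => by
    have := hm y ⟨h1, h2, h3⟩
    omega⟩

theorem pr_left {P : PS src dst m} {Q : PS src dst n} {x x' y : E × Bool}
    (h : pr P Q x y) (h' : pr P Q x' y) : x = x' := by
  rcases h with ⟨h1, h2, a, h3⟩ | ⟨h1, h2, a, h3⟩ <;>
    rcases h' with ⟨h1', h2', a', h3'⟩ | ⟨h1', h2', a', h3'⟩
  · exact Prod.ext (nxt_left h3 h3') (h1.trans h1'.symm)
  · simp_all
  · simp_all
  · exact Prod.ext (nxt_right h3 h3') (h1.trans h1'.symm)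

theorem pr_right {P : PS src dst m} {Q : PS src dst n} {x y y' : E × Bool}
    (h : pr P Q x y) (h' : pr P Q x y') : y = y' := by
  rcases h with ⟨h1, h2, a, h3⟩ | ⟨h1, h2, a, h3⟩ <;>
    rcases h' with ⟨h1', h2', a', h3'⟩ | ⟨h1', h2', a', h3'⟩
  · exact Prod.ext (nxt_right h3 h3') (h2.trans h2'.symm)
  · simp_all
  · simp_all
  · exact Prod.ext (nxt_left h3 h3') (h2.trans h2'.symm)

theorem pr_head {P : PS src dst m} {Q : PS src dst n} {x y : E × Bool}
    (h : pr P Q x y) : Head P Q x.1 ∧ Head P Q y.1 := by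
  rcases h with ⟨h1, h2, a, h3⟩ | ⟨h1, h2, a, h3⟩
  · exact ⟨h3.2.2.1, h3.2.2.2.1⟩
  · exact ⟨h3.2.2.2.1.symm, h3.2.2.1.symm⟩

/-- location of a state -/
def vtx (src dst : E → V) (lst : E → E) (x : E × Bool) : V :=
  if x.2 then dst (lst x.1) else src x.1

def IsLst (P : PS src dst m) (Q : PS src dst n) (lst : E → E) : Prop :=
  ∀ e, ReflTransGen (ns P Q) e (lst e) ∧ Term P Q (lst e)

theorem IsLst.symm {P : PS src dst m} {Q : PS src dst n} {lst : E → E} (h : IsLst P Q lst) :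
    IsLst Q P lst := fun e => ⟨ns_swap_rtg (h e).1, fun x hx => (h e).2 x hx.symm⟩

theorem IsLst.blk {P : PS src dst m} {Q : PS src dst n} {lst : E → E} (h : IsLst P Q lst)
    {a : Fin m} {b : Fin n} {e : E} (ha : P.on e a) (hb : Q.on e b) (hH : Head P Q e) :
    Blk P Q a b e (lst e) := ⟨ha, hb, (h e).1, (h e).2, Or.inl hH⟩

theorem Head.onQ {P : PS src dst m} {Q : PS src dst n} {e : E} (h : Head P Q e) :
    ∃ b, Q.on e b := by
  obtain ⟨f, g, _, ⟨k, _, h, _⟩, _⟩ := h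
  exact ⟨k, h⟩

theorem Head.onP {P : PS src dst m} {Q : PS src dst n} {e : E} (h : Head P Q e) :
    ∃ b, P.on e b := h.symm.onQ

theorem nxt_A {P : PS src dst m} {Q : PS src dst n} (hG : ∀ x, ¬ TransGen (Gst src dst) x x)
    {lst : E → E} (hl : IsLst P Q lst) {a : Fin m} {u e : E} (h : nxt P Q a u e) :
    TransGen (A P Q) (dst (lst u)) (src e) := by
  obtain ⟨h1, h2, h3, h4, h5, h6⟩ := h
  obtain ⟨b, hb⟩ := h3.onQ
  have B := hl.blk h1 hb h3
  exact gap hG B.lP B.lQ B.term h2 h4 (run_lt h1 B.run h2 h4 h5)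
    (fun x hx1 hx2 hx3 hx4 => h6 x hx1 hx2 (lt_of_le_of_lt B.le hx3) hx4)

theorem pr_A {P : PS src dst m} {Q : PS src dst n} (hG : ∀ x, ¬ TransGen (Gst src dst) x x)
    {lst : E → E} (hl : IsLst P Q lst) {x y : E × Bool} (h : pr P Q x y) :
    TransGen (A P Q) (vtx src dst lst x) (vtx src dst lst y) := by
  rcases h with ⟨h1, h2, a, h3⟩ | ⟨h1, h2, a, h3⟩
  · simpa [vtx, h1, h2] using nxt_A hG hl h3
  · simpa [vtx, h1, h2] using A_tg_symm (nxt_A hG hl.symm h3)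

theorem pr_A_tg {P : PS src dst m} {Q : PS src dst n} (hG : ∀ x, ¬ TransGen (Gst src dst) x x)
    {lst : E → E} (hl : IsLst P Q lst) {x y : E × Bool} (h : TransGen (pr P Q) x y) :
    TransGen (A P Q) (vtx src dst lst x) (vtx src dst lst y) := by
  induction h with
  | single h => exact pr_A hG hl h
  | tail _ h ih => exact ih.trans (pr_A hG hl h)

theorem exists_root [Finite E] {P : PS src dst m} {Q : PS src dst n}
    (hG : ∀ x, ¬ TransGen (Gst src dst) x x)
    {lst : E → E} (hl : IsLst P Q lst) (x : E × Bool) :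
    ∃ r, ReflTransGen (pr P Q) r x ∧ ∀ y, ¬ pr P Q y r := by
  have : IsTrans (E × Bool) (TransGen (pr P Q)) := ⟨fun _ _ _ h1 h2 => h1.trans h2⟩
  have : Std.Irrefl (TransGen (pr P Q)) :=
    ⟨fun y h => P.acyc _ (A_tg_H (pr_A_tg hG hl h))⟩
  have wf : WellFounded (TransGen (pr P Q)) := Finite.wellFounded_of_trans_of_irrefl _
  induction x using wf.induction with
  | _ x ih =>
    by_cases h : ∃ y, pr P Q y x
    · obtain ⟨y, hy⟩ := h
      obtain ⟨r, h1, h2⟩ := ih y (.single hy)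
      exact ⟨r, h1.tail hy, h2⟩
    · exact ⟨x, .refl, fun y hy => h ⟨y, hy⟩⟩

theorem root_uniq {P : PS src dst m} {Q : PS src dst n} {x r r' : E × Bool}
    (h : ReflTransGen (pr P Q) r x) (h' : ReflTransGen (pr P Q) r' x)
    (hr : ∀ y, ¬ pr P Q y r) (hr' : ∀ y, ¬ pr P Q y r') : r = r' := by
  induction h with
  | refl =>
    rcases h'.cases_tail with h | ⟨c, _, h⟩
    · exact h
    · exact (hr _ h).elim
  | tail h1 h2 ih =>
    rcases h'.cases_tail with h | ⟨c, h3, h⟩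
    · subst h
      exact (hr' _ h2).elim
    · obtain rfl := pr_left h h2
      exact ih h3

theorem exists_lab [Finite E] {P : PS src dst m} {Q : PS src dst n}
    (hG : ∀ x, ¬ TransGen (Gst src dst) x x)
    {lst : E → E} (hl : IsLst P Q lst) (a0 : Fin m) (b0 : Fin n) :
    ∃ lab : E × Bool → Fin m ⊕ Fin n, (∀ x y, pr P Q x y → lab x = lab y) ∧
      ∀ x y, Head P Q x.1 → Head P Q y.1 → lab x = lab y →
        ReflTransGen (pr P Q) x y ∨ ReflTransGen (pr P Q) y x := by
  classical
  choose root hroot1 hroot2 using exists_root (P := P) (Q := Q) hG hl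
  have hp : ∀ e, ∃ a, Head P Q e → P.on e a := fun e => by
    by_cases h : Head P Q e
    · obtain ⟨a, ha⟩ := h.onP
      exact ⟨a, fun _ => ha⟩
    · exact ⟨a0, fun h' => (h h').elim⟩
  have hq : ∀ e, ∃ a, Head P Q e → Q.on e a := fun e => by
    by_cases h : Head P Q e
    · obtain ⟨a, ha⟩ := h.onQ
      exact ⟨a, fun _ => ha⟩
    · exact ⟨b0, fun h' => (h h').elim⟩
  choose ip hip using hp
  choose iq hiq using hq
  have hrh : ∀ x : E × Bool, Head P Q x.1 → Head P Q (root x).1 := by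
    intro x hx
    rcases (hroot1 x).cases_head with h | ⟨c, h, _⟩
    · rw [h]; exact hx
    · exact (pr_head h).1
  refine ⟨fun x => if (root x).2 then Sum.inr (iq (root x).1) else Sum.inl (ip (root x).1), ?_, ?_⟩
  · intro x y h
    have : root x = root y :=
      root_uniq ((hroot1 x).tail h) (hroot1 y) (hroot2 x) (hroot2 y)
    simp [this]
  · intro x y hx hy hxy
    beta_reduce at hxy
    have key : root x = root y := by
      have hx' := hrh x hx
      have hy' := hrh y hy
      have rx := hroot2 x
      have ry := hroot2 y
      revert hxy hx' hy' rx ry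
      generalize root x = r
      generalize root y = r'
      obtain ⟨e, d⟩ := r
      obtain ⟨e', d'⟩ := r'
      intro hxy hx' hy' rx ry
      cases d <;> cases d' <;> simp at hxy
      · have h1 := hip e hx'
        have h2 := hip e' hy'
        rw [hxy] at h1
        rcases lt_trichotomy (P.pos e) (P.pos e') with h | h | h
        · obtain ⟨u, hu⟩ := exists_prev h1 h2 hx' hy' h
          exact (ry (u, true) (Or.inl ⟨rfl, rfl, _, hu⟩)).elim
        · rw [P.inj _ _ _ h1 h2 h]
        · obtain ⟨u, hu⟩ := exists_prev h2 h1 hy' hx' h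
          exact (rx (u, true) (Or.inl ⟨rfl, rfl, _, hu⟩)).elim
      · have h1 := hiq e hx'
        have h2 := hiq e' hy'
        rw [hxy] at h1
        rcases lt_trichotomy (Q.pos e) (Q.pos e') with h | h | h
        · obtain ⟨u, hu⟩ := exists_next h1 h2 hx'.symm hy'.symm h
          exact (rx (u, false) (Or.inr ⟨rfl, rfl, _, hu⟩)).elim
        · rw [Q.inj _ _ _ h1 h2 h]
        · obtain ⟨u, hu⟩ := exists_next h2 h1 hy'.symm hx'.symm h
          exact (ry (u, false) (Or.inr ⟨rfl, rfl, _, hu⟩)).elim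
    have h1 := hroot1 x
    have h2 := hroot1 y
    rw [key] at h1
    exact ReflTransGen.total_of_right_unique (fun _ _ _ h h' => pr_right h h') h1 h2

theorem crossing {X : Type} {r : X → X → Prop} {T : X → Prop} {x y : X}
    (h : ReflTransGen r x y) (hx : T x) (hy : ¬ T y) : ∃ u v, r u v ∧ T u ∧ ¬ T v := by
  induction h with
  | refl => exact (hy hx).elim
  | @tail b c h1 h2 ih =>
    by_cases hb : T b
    · exact ⟨b, c, h2, hb, hy⟩
    · exact ih hb

theorem card_le_of_rel {B : Type} (F : Finset B) (R : B → Fin m → Prop)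
    (h1 : ∀ c ∈ F, ∃ a, R c a) (h2 : ∀ c c' a, R c a → R c' a → c = c') : F.card ≤ m := by
  choose f hf using h1
  have := Finset.card_le_card_of_injOn (s := F.attach) (t := (Finset.univ : Finset (Fin m)))
    (fun c => f c.1 c.2) (by simp) (fun c _ c' _ h => by
      have h' : f c.1 c.2 = f c'.1 c'.2 := h
      exact Subtype.ext (h2 _ _ _ (hf c.1 c.2) (h' ▸ hf c'.1 c'.2)))
  simpa using this

theorem sorted_enum {X : Type} (s : Finset X) (hs : s.Nonempty) (f : X → ℕ)
    (hf : Set.InjOn f s) : ∃ e : ℕ → X, (∀ j < s.card, e j ∈ s) ∧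
      (∀ j j', j < j' → j' < s.card → f (e j) < f (e j')) ∧
      ∀ x ∈ s, ∃ j < s.card, e j = x := by
  classical
  have hc : (s.image f).card = s.card := Finset.card_image_of_injOn hf
  have hm := fun j : Fin s.card => Finset.orderEmbOfFin_mem (s.image f) hc j
  simp only [Finset.mem_image] at hm
  choose e he1 he2 using hm
  have hpos : 0 < s.card := hs.card_pos
  refine ⟨fun j => if h : j < s.card then e ⟨j, h⟩ else e ⟨0, hpos⟩, ?_, ?_, ?_⟩
  · intro j hj
    simp [hj, he1]
  · intro j j' h h'
    have hj : j < s.card := by omega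
    simp [hj, h', he2, h]
  · intro x hx
    have : f x ∈ Set.range ((s.image f).orderEmbOfFin hc) := by
      rw [Finset.range_orderEmbOfFin]
      simpa using ⟨x, hx, rfl⟩
    obtain ⟨j, hj⟩ := this
    refine ⟨j, j.2, ?_⟩
    simp only [j.2, dif_pos]
    exact hf (he1 _) hx (by rw [he2, hj])

theorem count_heads [Finite E] {P : PS src dst m} {Q : PS src dst n}
    (hG : ∀ x, ¬ TransGen (Gst src dst) x x) (i : Fin m) :
    Set.ncard {e | P.on e i ∧ Head P Q e} ≤ m * n := by
  classical
  have hfin : Set.Finite {e | P.on e i ∧ Head P Q e} := Set.toFinite _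
  obtain ⟨s, hs⟩ : ∃ s : Finset E, (s : Set E) = {e | P.on e i ∧ Head P Q e} :=
    ⟨hfin.toFinset, by simp⟩
  rw [← hs, Set.ncard_coe_finset]
  have hmem : ∀ e, e ∈ s ↔ P.on e i ∧ Head P Q e := fun e => by
    rw [← Finset.mem_coe, hs]; rfl
  rcases s.eq_empty_or_nonempty with rfl | hne
  · simp
  obtain ⟨e, he1, he2, he3⟩ := sorted_enum s hne P.pos (fun x hx y hy h =>
    P.inj x y i ((hmem x).1 hx).1 ((hmem y).1 hy).1 h)
  have hK : 0 < s.card := hne.card_pos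
  generalize s.card = K at *
  have hon : ∀ j < K, P.on (e j) i := fun j hj => ((hmem _).1 (he1 j hj)).1
  have hH : ∀ j < K, Head P Q (e j) := fun j hj => ((hmem _).1 (he1 j hj)).2
  have hb : ∀ j, ∃ b, j < K → Q.on (e j) b := fun j => by
    by_cases h : j < K
    · obtain ⟨b, hb⟩ := (hH j h).onQ
      exact ⟨b, fun _ => hb⟩
    · obtain ⟨b, hb⟩ := (hH 0 hK).onQ
      exact ⟨b, fun h' => (h h').elim⟩
  choose b hb using hb
  choose lst hlst using exists_term P Q
  have hl : IsLst P Q lst := hlst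
  obtain ⟨lab, lab1, lab2⟩ := exists_lab (P := P) (Q := Q) hG hl i (b 0)
  have blk : ∀ j < K, Blk P Q i (b j) (e j) (lst (e j)) := fun j hj =>
    hl.blk (hon j hj) (hb j hj) (hH j hj)
  have hinj : ∀ j j', j < K → j' < K → e j = e j' → j = j' := by
    intro j j' h h' hh
    rcases lt_trichotomy j j' with h1 | h1 | h1
    · have := he2 j j' h1 h'
      rw [hh] at this
      omega
    · exact h1
    · have := he2 j' j h1 h
      rw [hh] at this
      omega
  have hnxt : ∀ j, j + 1 < K → nxt P Q i (e j) (e (j + 1)) := by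
    intro j hj
    refine ⟨hon _ (by omega), hon _ hj, hH _ (by omega), hH _ hj, he2 _ _ (by omega) hj, ?_⟩
    intro x hx hxH h1 h2
    obtain ⟨k, hk, rfl⟩ := he3 x ((hmem x).2 ⟨hx, hxH⟩)
    rcases Nat.lt_or_ge j k with h | h
    · rcases Nat.lt_or_ge (j + 1) k with h4 | h4
      · have := he2 _ _ h4 hk
        omega
      · have : k = j + 1 := by omega
        subst this
        omega
    · rcases h.lt_or_eq with h3 | h3
      · have := he2 _ _ h3 (by omega)
        omega
      · subst h3
        omega
  let g : ℕ → Fin m ⊕ Fin n := fun j => if j = 0 then lab (e 0, false) else lab (e (j - 1), true)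
  have g0 : ∀ j < K, g j = lab (e j, false) := by
    intro j hj
    rcases j with _ | j
    · simp [g]
    · simp only [g, Nat.succ_ne_zero, if_false, Nat.add_sub_cancel]
      exact lab1 _ _ (Or.inl ⟨rfl, rfl, i, hnxt j hj⟩)
  have g1 : ∀ j, g (j + 1) = lab (e j, true) := by
    intro j
    simp [g]
  have v0 : ∀ x, vtx src dst lst (x, false) = src x := fun x => by simp [vtx]
  have v1 : ∀ x, vtx src dst lst (x, true) = dst (lst x) := fun x => by simp [vtx]
  apply trail_count m n K (by simp) (by simp) b g
  · intro j hj j' hj' d hd d' hd' hbb hgg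
    have st : ∀ j < K, ∀ d ≤ 1, g (j + d) = lab (e j, decide (d = 1)) := by
      intro j hj d hd
      rcases Nat.le_one_iff_eq_zero_or_eq_one.1 hd with rfl | rfl
      · simpa using g0 j hj
      · simpa using g1 j
    have vv : ∀ j, ∀ d ≤ 1, vtx src dst lst (e j, decide (d = 1)) = src (e j) ∨
        vtx src dst lst (e j, decide (d = 1)) = dst (lst (e j)) := by
      intro j d hd
      rcases Nat.le_one_iff_eq_zero_or_eq_one.1 hd with rfl | rfl
      · left; simp [vtx]
      · right; simp [vtx]
    rw [st j hj d hd, st j' hj' d' hd'] at hgg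
    have B := blk j hj
    have B' := blk j' hj'
    rw [← hbb] at B'
    have fin : (e j, decide (d = 1)) = (e j', decide (d' = 1)) → j = j' ∧ d = d' := by
      intro h
      simp only [Prod.mk.injEq, decide_eq_decide] at h
      exact ⟨hinj _ _ hj hj' h.1, by omega⟩
    rcases lab2 _ _ (hH j hj) (hH j' hj') hgg with h | h
    · rcases reflTransGen_iff_eq_or_transGen.1 h with h | h
      · exact fin h.symm
      · exact (pairDistinct hG B B' (vv j d hd) (vv j' d' hd') (pr_A_tg hG hl h)).elim
    · rcases reflTransGen_iff_eq_or_transGen.1 h with h | h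
      · exact fin h
      · exact (pairDistinct hG B' B (vv j' d' hd') (vv j d hd) (pr_A_tg hG hl h)).elim
  · intro j hj
    apply card_le_of_rel _ (fun c a => ∃ x, P.on x a ∧ Q.on x c ∧
      ReflTransGen (Hrel src dst P.on) (src x) (src (e j)) ∧
      ¬ ReflTransGen (Hrel src dst P.on) (dst x) (src (e j)))
    · intro c hc
      simp only [Finset.mem_filter] at hc
      obtain ⟨_, ⟨x, hx, hxc⟩, y, hy, hyK, hyc⟩ := hc
      have hxQ : Q.on (e x) c := hxc ▸ hb x (by omega)
      have hyQ : Q.on (e y) c := hyc ▸ hb y (by omega)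
      have hle : Q.pos (e x) ≤ Q.pos (e y) := by
        rcases (hx.trans hy).lt_or_eq with h | h
        · exact (Blk.posQ hG (hon x (by omega)) (hon y hyK) hxQ hyQ (he2 _ _ h hyK)).le
        · rw [h]
      have w := Q.walk_sd hxQ hyQ hle
      obtain ⟨u, v, ⟨z, hz, rfl, rfl⟩, h1, h2⟩ := crossing
        (T := fun v => ReflTransGen (Hrel src dst P.on) v (src (e j))) w.to_reflTransGen
        (by
          rcases hx.lt_or_eq with h | h
          · exact F_H_rtg (P.walk_ss (hon x (by omega)) (hon j hj) (he2 _ _ h hj)).to_reflTransGen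
          · rw [h])
        (by
          intro h
          have : P.pos (e j) ≤ P.pos (e y) := by
            rcases hy.lt_or_eq with h | h
            · exact (he2 _ _ h hyK).le
            · rw [h]
          exact P.acyc _ ((F_H_tg (P.walk_sd (hon j hj) (hon y hyK) this)).trans_left h))
      by_cases hzP : ∃ a, P.on z a
      · obtain ⟨a, ha⟩ := hzP
        exact ⟨a, z, ha, hz, h1, h2⟩
      · exact (h2 (ReflTransGen.head ⟨z, Or.inr ⟨hzP, rfl, rfl⟩⟩ h1)).elim
    · rintro c c' a ⟨x, hx1, hx2, hx3, hx4⟩ ⟨y, hy1, hy2, hy3, hy4⟩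
      rcases lt_trichotomy (P.pos x) (P.pos y) with h | h | h
      · exact (hx4 ((F_H_rtg (P.walk' hx1 hy1 h)).trans hy3)).elim
      · obtain rfl := P.inj _ _ _ hx1 hy1 h
        exact Q.uniq _ _ _ hx2 hy2
      · exact (hy4 ((F_H_rtg (P.walk' hy1 hx1 h)).trans hx3)).elim
  · intro j hj
    have one : ∀ (F : Finset (Fin m ⊕ Fin n)) t, (∀ c ∈ F, c = t) → F.card ≤ m := by
      intro F t h
      have : F ⊆ {t} := fun c hc => by simpa using h c hc
      have := Finset.card_le_card this
      have := i.pos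
      simp at *
      omega
    rcases Nat.eq_zero_or_pos j with rfl | hj0
    · apply one _ (g 0)
      intro c hc
      simp only [Finset.mem_filter] at hc
      obtain ⟨_, ⟨x, hx, hxc⟩, _⟩ := hc
      obtain rfl : x = 0 := by omega
      exact hxc.symm
    rcases hj.lt_or_eq with hjK | rfl
    swap
    · apply one _ (g j)
      intro c hc
      simp only [Finset.mem_filter] at hc
      obtain ⟨_, _, ⟨x, hx, hx', hxc⟩⟩ := hc
      obtain rfl : x = j := by omega
      exact hxc.symm
    obtain ⟨k, rfl⟩ : ∃ k, j = k + 1 := ⟨j - 1, by omega⟩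
    have hk : k < K := by omega
    apply card_le_of_rel _ (fun c a => ∃ u w, nxt P Q a u w ∧ lab (u, true) = c ∧
      ReflTransGen (Gst src dst) (dst (lst u)) (dst (lst (e k))) ∧
      ¬ ReflTransGen (Gst src dst) (src w) (dst (lst (e k))))
    · intro c hc
      simp only [Finset.mem_filter] at hc
      obtain ⟨_, ⟨x, hx, hxc⟩, y, hy, hyK, hyc⟩ := hc
      obtain ⟨sx, hsx1, hsx2, hsx3⟩ : ∃ sx : E × Bool, lab sx = c ∧ Head P Q sx.1 ∧
          ReflTransGen (P.F i) (vtx src dst lst sx) (dst (lst (e k))) := by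
        rcases x with _ | x
        · refine ⟨(e 0, false), by rw [← hxc, g0 0 hK], hH 0 hK, ?_⟩
          rw [v0]
          rcases Nat.eq_zero_or_pos k with rfl | h
          · exact (blk 0 hK).sd.to_reflTransGen
          · exact (blk 0 hK).reach (blk k hk) (he2 _ _ h hk) (Or.inl rfl) (Or.inr rfl)
        · refine ⟨(e x, true), by rw [← hxc, g1], hH x (by omega), ?_⟩
          rw [v1]
          rcases Nat.lt_or_ge x k with h | h
          · exact (blk x (by omega)).reach (blk k hk) (he2 _ _ h hk) (Or.inr rfl) (Or.inr rfl)
          · obtain rfl : x = k := by omega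
            rfl
      have step : TransGen (P.F i) (dst (lst (e k))) (src (e (k + 1))) := by
        have hlt := run_lt (hon k hk) (blk k hk).run (hon (k + 1) hjK) (hH _ hjK)
          (he2 k (k + 1) (by omega) hjK)
        rcases reflTransGen_iff_eq_or_transGen.1 (P.walk' (blk k hk).lP (hon (k + 1) hjK) hlt)
          with h | h
        · have h' := nxt_A hG hl (hnxt k hjK)
          rw [h] at h'
          exact (P.acyc _ (A_tg_H h')).elim
        · exact h
      obtain ⟨sy, hsy1, hsy2, hsy3⟩ : ∃ sy : E × Bool, lab sy = c ∧ Head P Q sy.1 ∧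
          ReflTransGen (P.F i) (src (e (k + 1))) (vtx src dst lst sy) := by
        rcases hyK.lt_or_eq with hyK | rfl
        · refine ⟨(e y, false), by rw [← hyc, g0 y hyK], hH y hyK, ?_⟩
          rw [v0]
          rcases hy.lt_or_eq with h | rfl
          · exact (blk _ hjK).reach (blk y hyK) (he2 _ _ h hyK) (Or.inl rfl) (Or.inl rfl)
          · rfl
        · obtain ⟨z, rfl⟩ : ∃ z, y = z + 1 := ⟨y - 1, by omega⟩
          refine ⟨(e z, true), by rw [← hyc, g1], hH z (by omega), ?_⟩
          rw [v1]
          have hz : z < z + 1 := by omega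
          rcases Nat.lt_or_ge (k + 1) z with h | h
          · exact (blk _ hjK).reach (blk z hz) (he2 _ _ h hz) (Or.inl rfl) (Or.inr rfl)
          · obtain rfl : k + 1 = z := by omega
            exact (blk _ hz).sd.to_reflTransGen
      have hfw := step.trans_left hsy3
      have hr : ReflTransGen (pr P Q) sx sy := by
        rcases lab2 sx sy hsx2 hsy2 (hsx1.trans hsy1.symm) with h | h
        · exact h
        · rcases reflTransGen_iff_eq_or_transGen.1 h with h | h
          · rw [h]
          · have h1 := A_tg_H (pr_A_tg hG hl h)
            exact (P.acyc _ ((h1.trans_left (F_H_rtg hsx3)).trans (F_H_tg hfw))).elim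
      have hr2 : ∃ u v : E × Bool, (pr P Q u v ∧ lab u = c) ∧
          ReflTransGen (Gst src dst) (vtx src dst lst u) (dst (lst (e k))) ∧
          ¬ ReflTransGen (Gst src dst) (vtx src dst lst v) (dst (lst (e k))) := by
        have hr3 : ReflTransGen (fun u v => pr P Q u v ∧ lab u = c) sx sy ∧ lab sy = c := by
          clear hsy1 hsy2 hsy3 hfw
          induction hr with
          | refl => exact ⟨.refl, hsx1⟩
          | tail h1 h2 ih => exact ⟨ih.1.tail ⟨h2, ih.2⟩, by rw [← lab1 _ _ h2, ih.2]⟩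
        exact crossing (T := fun v => ReflTransGen (Gst src dst) (vtx src dst lst v)
          (dst (lst (e k)))) hr3.1 (F_G_rtg hsx3) (fun h => hG _ ((F_G_tg hfw).trans_left h))
      obtain ⟨u, v, ⟨hp, hlc⟩, h1, h2⟩ := hr2
      obtain ⟨u, du⟩ := u
      obtain ⟨v, dv⟩ := v
      rcases hp with ⟨q1, q2, a, q3⟩ | ⟨q1, q2, a, q3⟩
      · simp only at q1 q2 q3
        subst q1 q2
        rw [v1] at h1
        rw [v0] at h2
        exact ⟨a, u, v, q3, hlc, h1, h2⟩
      · simp only at q1 q2 q3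
        subst q1 q2
        rw [v0] at h1
        rw [v1] at h2
        obtain ⟨r1, r2, r3, r4, r5, r6⟩ := q3
        have := run_lt r1 (hl.symm v).1 r2 r4 r5
        have := Q.walk' (run_on r1 (hl.symm v).1).1 r2 this
        exact (h2 ((F_G_rtg this).trans h1)).elim
    · have aux : ∀ a u w u' w', nxt P Q a u w → nxt P Q a u' w' →
          ¬ ReflTransGen (Gst src dst) (src w) (dst (lst (e k))) →
          ReflTransGen (Gst src dst) (dst (lst u')) (dst (lst (e k))) →
          ¬ P.pos u < P.pos u' := by
        intro a u w u' w' n1 n2 h1 h2 hlt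
        obtain ⟨r1, r2, r3, r4, r5, r6⟩ := n1
        obtain ⟨s1, s2, s3, s4, s5, s6⟩ := n2
        have hle : P.pos w ≤ P.pos u' := by
          by_contra hc
          exact r6 u' s1 s3 hlt (by omega)
        have := run_on s1 (hl u').1
        exact h1 ((F_G_rtg (P.walk_sd r2 this.1 (by omega)).to_reflTransGen).trans h2)
      rintro c c' a ⟨u, w, hx1, hx2, hx3, hx4⟩ ⟨u', w', hy1, hy2, hy3, hy4⟩
      have k1 := aux _ _ _ _ _ hx1 hy1 hx4 hy3
      have k2 := aux _ _ _ _ _ hy1 hx1 hy4 hx3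
      obtain rfl := P.inj _ _ _ hx1.1 hy1.1 (by omega)
      exact hx2.symm.trans hy2

end PS

end AbstractPS

section GraphToPS

open Relation

/-- walks as edge lists -/
def W {V E : Type} (src dst : E → V) : V → V → List E → Prop
  | u, v, [] => u = v
  | u, v, e :: p => src e = u ∧ W src dst (dst e) v p

variable {V E : Type} {src dst : E → V}

theorem W_append {u v : V} {p q : List E} :
    W src dst u v (p ++ q) ↔ ∃ w, W src dst u w p ∧ W src dst w v q := by
  induction p generalizing u with
  | nil => simp [W]
  | cons e p ih =>
    simp only [List.cons_append, W, ih]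
    constructor
    · rintro ⟨h, w, h1, h2⟩; exact ⟨w, ⟨h, h1⟩, h2⟩
    · rintro ⟨w, ⟨h, h1⟩, h2⟩; exact ⟨h, w, h1, h2⟩

theorem W_tg {u v : V} {p : List E} (h : W src dst u v p) (hp : p ≠ []) :
    TransGen (Gst src dst) u v := by
  induction p generalizing u with
  | nil => exact (hp rfl).elim
  | cons e p ih =>
    obtain ⟨h1, h2⟩ := h
    rcases p with _ | ⟨f, p⟩
    · exact .single ⟨e, h1, h2⟩
    · exact .head ⟨e, h1, rfl⟩ (ih h2 (by simp))

theorem rtg_W {T : E → Prop} {u v : V}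
    (h : ReflTransGen (fun x y => ∃ e, T e ∧ src e = x ∧ dst e = y) u v) :
    ∃ p, W src dst u v p ∧ ∀ e ∈ p, T e := by
  induction h using ReflTransGen.head_induction_on with
  | refl => exact ⟨[], rfl, by simp⟩
  | head h1 _ ih =>
    obtain ⟨e, h1, h2, rfl⟩ := h1
    obtain ⟨p, hp, hp2⟩ := ih
    exact ⟨e :: p, ⟨h2, hp⟩, by simpa using ⟨h1, hp2⟩⟩

theorem tg_W {u v : V} (h : TransGen (Gst src dst) u v) : ∃ p, p ≠ [] ∧ W src dst u v p := by
  induction h using TransGen.head_induction_on with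
  | single h =>
    obtain ⟨e, h1, h2⟩ := h
    exact ⟨[e], by simp, h1, h2⟩
  | head h1 _ ih =>
    obtain ⟨e, h1, rfl⟩ := h1
    obtain ⟨p, hp, hp2⟩ := ih
    exact ⟨e :: p, by simp, h1, hp2⟩

theorem isPath_iff {G : MultiDigraph} {u v : G.V} {p : List G.E} :
    G.IsPathFrom u v p ↔ p ≠ [] ∧ W G.src G.dst u v p := by
  change (p ≠ [] ∧ List.IsChain (fun e f => G.dst e = G.src f) p ∧
    (∀ e ∈ p.head?, G.src e = u) ∧ ∀ e ∈ p.getLast?, G.dst e = v) ↔ _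
  refine and_congr_right fun hp => ?_
  induction p generalizing u with
  | nil => exact (hp rfl).elim
  | cons e p ih =>
    rcases p with _ | ⟨f, p⟩
    · simp [W]
    · have := ih (u := G.dst e) (by simp)
      simp only [W] at this ⊢
      rw [← this]
      simp only [List.head?_cons, Option.mem_some_iff, List.getLast?_cons_cons]
      constructor
      · rintro ⟨h1, h2, h3⟩
        rw [List.isChain_cons_cons] at h1
        exact ⟨h2 e rfl, h1.2, by rintro _ rfl; exact h1.1.symm, h3⟩
      · rintro ⟨h1, h2, h3, h4⟩
        refine ⟨?_, by rintro _ rfl; exact h1, h4⟩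
        rw [List.isChain_cons_cons]
        exact ⟨(h3 f rfl).symm, h2⟩

theorem acyc_G {G : MultiDigraph} (h : G.Acyclic) : ∀ x, ¬ TransGen (Gst G.src G.dst) x x := by
  intro x hx
  obtain ⟨p, h1, h2⟩ := tg_W hx
  exact h x p (isPath_iff.2 ⟨h1, h2⟩)

theorem W_nodup (hG : ∀ x, ¬ TransGen (Gst src dst) x x) {u v : V} {p : List E}
    (h : W src dst u v p) : p.Nodup := by
  induction p generalizing u with
  | nil => simp
  | cons e p ih =>
    rw [List.nodup_cons]
    refine ⟨fun he => ?_, ih h.2⟩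
    obtain ⟨s, t, rfl⟩ := List.append_of_mem he
    obtain ⟨h1, h2⟩ := h
    obtain ⟨w, h3, h4⟩ := W_append.1 h2
    obtain ⟨h4, _⟩ := h4
    exact hG (src e) (W_tg (p := e :: s) ⟨rfl, h4 ▸ h3⟩ (by simp))

theorem W_link {u v : V} {p : List E} (h : W src dst u v p) {i : ℕ} {e e' : E}
    (h1 : p[i]? = some e) (h2 : p[i + 1]? = some e') : dst e = src e' := by
  induction p generalizing u i with
  | nil => simp at h1
  | cons f p ih =>
    rcases i with _ | i
    · rcases p with _ | ⟨g, p⟩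
      · simp at h2
      · simp at h1 h2
        subst h1 h2
        exact h.2.1.symm
    · simp at h1 h2
      exact ih h.2 h1 h2

theorem W_first {u v : V} {p : List E} (h : W src dst u v p) {e : E}
    (h1 : p[0]? = some e) : src e = u := by
  rcases p with _ | ⟨f, p⟩
  · simp at h1
  · simp at h1
    subst h1
    exact h.1

open Classical in
/-- divergence contribution -/
noncomputable def del (src dst : E → V) (y : V) (e : E) : ℤ :=
  (if src e = y then 1 else 0) - (if dst e = y then 1 else 0)

open Classical in
theorem W_sum {u v : V} {p : List E} (h : W src dst u v p) (y : V) :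
    (p.map (del src dst y)).sum = (if u = y then 1 else 0) - (if v = y then 1 else 0) := by
  induction p generalizing u with
  | nil =>
    obtain rfl : u = v := h
    simp
  | cons e p ih =>
    obtain ⟨rfl, h2⟩ := h
    simp only [List.map_cons, List.sum_cons, ih h2, del]
    ring

open Classical in
theorem W_fsum {u v : V} {p : List E} (h : W src dst u v p) (hn : p.Nodup) (y : V) :
    ∑ e ∈ p.toFinset, del src dst y e = (if u = y then 1 else 0) - (if v = y then 1 else 0) := by
  rw [← W_sum h y, List.sum_toFinset _ hn]

open Classical in
theorem flow_path [Fintype V] {u v : V} {c : ℕ} (F : Finset E)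
    (hF : ∀ y, ∑ e ∈ F, del src dst y e =
      ((c + 1 : ℕ) : ℤ) * ((if u = y then 1 else 0) - (if v = y then 1 else 0))) :
    ∃ p, W src dst u v p ∧ ∀ e ∈ p, e ∈ F := by
  apply rtg_W (T := fun e => e ∈ F)
  by_contra hv
  let T : Finset V := Finset.univ.filter
    fun y => ReflTransGen (fun x y => ∃ e, e ∈ F ∧ src e = x ∧ dst e = y) u y
  have hu : u ∈ T := by simp [T, ReflTransGen.refl]
  have hv' : v ∉ T := by simpa [T] using hv
  have h1 : ∑ y ∈ T, ∑ e ∈ F, del src dst y e = ((c + 1 : ℕ) : ℤ) := by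
    rw [Finset.sum_congr rfl (fun y _ => hF y), ← Finset.mul_sum, Finset.sum_sub_distrib]
    simp [hu, hv']
  rw [Finset.sum_comm] at h1
  have h2 : ∑ e ∈ F, ∑ y ∈ T, del src dst y e ≤ 0 := by
    apply Finset.sum_nonpos
    intro e he
    simp only [del, Finset.sum_sub_distrib, Finset.sum_ite_eq]
    have : src e ∈ T → dst e ∈ T := by
      intro h
      simp only [T, Finset.mem_filter, Finset.mem_univ, true_and] at h ⊢
      exact h.tail ⟨e, he, rfl, rfl⟩
    by_cases h : src e ∈ T
    · simp [h, this h]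
    · simp only [h, if_false]
      split_ifs <;> simp
  rw [h1] at h2
  push_cast at h2
  omega

open Classical in
theorem flow_decomp [Fintype V] (hG : ∀ x, ¬ TransGen (Gst src dst) x x) {u v : V} (huv : u ≠ v)
    (c : ℕ) : ∀ (F : Finset E)
    (_ : ∀ y, ∑ e ∈ F, del src dst y e =
      (c : ℤ) * ((if u = y then 1 else 0) - (if v = y then 1 else 0))),
    ∃ β : Fin c → List E, (∀ i, β i ≠ [] ∧ W src dst u v (β i)) ∧
      (∀ i j, i ≠ j → ∀ e, e ∈ β i → e ∉ β j) ∧ ∀ i, ∀ e ∈ β i, e ∈ F := by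
  induction c with
  | zero => exact fun F _ => ⟨Fin.elim0, fun i => i.elim0, fun i => i.elim0, fun i => i.elim0⟩
  | succ c ih =>
    intro F hF
    obtain ⟨p, hp, hpF⟩ := flow_path F hF
    have hnd := W_nodup hG hp
    have hsub : p.toFinset ⊆ F := fun e he => hpF e (by simpa using he)
    obtain ⟨β, h1, h2, h3⟩ := ih (F \ p.toFinset) (by
      intro y
      have := Finset.sum_sdiff (f := del src dst y) hsub
      rw [hF y, W_fsum hp hnd] at this
      push_cast at this
      linarith)
    have hne : p ≠ [] := by
      rintro rfl
      exact huv hp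
    have h3' : ∀ i, ∀ e ∈ β i, e ∈ F ∧ e ∉ p := fun i e he => by
      simpa using h3 i e he
    refine ⟨Fin.cons p β, ?_, ?_, ?_⟩
    · intro i
      refine Fin.cases ?_ (fun i => ?_) i
      · simpa using ⟨hne, hp⟩
      · simpa using h1 i
    · intro i j
      refine Fin.cases ?_ (fun i => ?_) i <;> refine Fin.cases ?_ (fun j => ?_) j
      · simp
      · intro _ e he he'
        simp only [Fin.cons_zero, Fin.cons_succ] at he he'
        exact (h3' _ _ he').2 he
      · intro _ e he he'
        simp only [Fin.cons_zero, Fin.cons_succ] at he he'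
        exact (h3' _ _ he).2 he'
      · intro hij e he he'
        simp only [Fin.cons_succ] at he he'
        exact h2 i j (fun h => hij (by rw [h])) e he he'
    · intro i
      refine Fin.cases ?_ (fun i => ?_) i
      · simpa using hpF
      · intro e he
        simp only [Fin.cons_succ] at he
        exact (h3' _ _ he).1

/-- shortest closed walk has no repeated edges -/
theorem closed_nodup {x : V} (h : TransGen (Gst src dst) x x) :
    ∃ (y : V) (p : List E), p ≠ [] ∧ W src dst y y p ∧ p.Nodup := by
  classical
  have hex : ∃ k, ∃ (y : V) (p : List E), p ≠ [] ∧ W src dst y y p ∧ p.length = k := by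
    obtain ⟨p, h1, h2⟩ := tg_W h
    exact ⟨_, x, p, h1, h2, rfl⟩
  obtain ⟨y, p, h1, h2, h3⟩ := Nat.find_spec hex
  have hmin : ∀ z q, q ≠ [] → W src dst z z q → p.length ≤ q.length := by
    intro z q hq1 hq2
    rw [h3]
    exact Nat.find_min' hex ⟨z, q, hq1, hq2, rfl⟩
  refine ⟨y, p, h1, h2, ?_⟩
  by_contra hnd
  have : ∃ (s t r : List E) (e : E), p = s ++ e :: (t ++ e :: r) := by
    clear h1 h2 h3 hmin
    induction p with
    | nil => simp at hnd
    | cons e p ih =>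
      rw [List.nodup_cons, not_and_or, not_not] at hnd
      by_cases he : e ∈ p
      · obtain ⟨t, r, rfl⟩ := List.append_of_mem he
        exact ⟨[], t, r, e, rfl⟩
      · obtain ⟨s, t, r, f, rfl⟩ := ih (hnd.resolve_left he)
        exact ⟨e :: s, t, r, f, rfl⟩
  obtain ⟨s, t, r, e, rfl⟩ := this
  obtain ⟨w, _, h4, h5⟩ := W_append.1 h2
  obtain ⟨z, h6, h7, _⟩ := W_append.1 h5
  have := hmin (src e) (e :: t) (by simp) ⟨rfl, h7 ▸ h6⟩
  simp at this
  omega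

open Classical in
/-- position of an edge on its path -/
noncomputable def ppos {c : ℕ} (α : Fin c → List E) (e : E) : ℕ :=
  if h : ∃ k, e ∈ α k then (α h.choose).idxOf e else 0

theorem ppos_eq {c : ℕ} {α : Fin c → List E} (hd : ∀ i j, i ≠ j → ∀ e, e ∈ α i → e ∉ α j)
    {e : E} {k : Fin c} (h : e ∈ α k) (inst : DecidableEq E) : ppos α e = (α k).idxOf e := by
  have hex : ∃ k, e ∈ α k := ⟨k, h⟩
  have : hex.choose = k := by
    by_contra hne
    exact hd _ _ hne e hex.choose_spec h
  rw [ppos, dif_pos hex, this]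
  congr!

theorem ppos_iff {c : ℕ} {α : Fin c → List E} (hd : ∀ i j, i ≠ j → ∀ e, e ∈ α i → e ∉ α j)
    (hn : ∀ k, (α k).Nodup) {e : E} {k : Fin c} {i : ℕ} :
    (α k)[i]? = some e ↔ e ∈ α k ∧ ppos α e = i := by
  classical
  constructor
  · intro h
    have hm : e ∈ α k := List.mem_of_getElem? h
    refine ⟨hm, ?_⟩
    rw [ppos_eq hd hm inferInstance]
    obtain ⟨hlt, rfl⟩ := List.getElem?_eq_some_iff.1 h
    exact (hn k).idxOf_getElem _ _
  · rintro ⟨h, rfl⟩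
    rw [ppos_eq hd h inferInstance]
    exact List.getElem?_idxOf h

theorem menger_inU {G : MultiDigraph} (hac : G.Acyclic) {u v : G.V} {c : ℕ}
    {α : Fin c → List G.E} (hM : G.MengerSystem u v c α) (hN : G.NonReroutable u v c α)
    {e1 e2 : G.E} {k1 k : Fin c} {p q : List G.E} (h1 : e1 ∈ α k1) (h2 : α k = p ++ e2 :: q)
    (hq : q ≠ []) (hd : G.dst e1 = G.dst e2) : e1 = e2 := by
  classical
  by_contra hne
  have hG := acyc_G hac
  have hW : ∀ k, W G.src G.dst u v (α k) := fun k => (isPath_iff.1 (hM.1 k)).2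
  obtain ⟨p', q', h1'⟩ := List.append_of_mem h1
  have w2 := hW k
  rw [h2] at w2
  obtain ⟨x, w21, w22, w23⟩ := W_append.1 w2
  by_cases hk : k1 = k
  · subst hk
    rw [h2] at h1
    rcases List.mem_append.1 h1 with h | h
    · obtain ⟨s, t, rfl⟩ := List.append_of_mem h
      obtain ⟨y, _, w4, w5⟩ := W_append.1 w21
      have : W G.src G.dst (G.dst e1) (G.dst e2) (t ++ [e2]) :=
        W_append.2 ⟨x, w5, w22, rfl⟩
      rw [hd] at this
      exact hG _ (W_tg this (by simp))
    · rcases List.mem_cons.1 h with h | h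
      · exact hne h
      · obtain ⟨s, t, rfl⟩ := List.append_of_mem h
        obtain ⟨y, w3, w4, w5⟩ := W_append.1 w23
        have : W G.src G.dst (G.dst e2) (G.dst e1) (s ++ [e1]) :=
          W_append.2 ⟨y, w3, w4, rfl⟩
        rw [hd] at this
        exact hG _ (W_tg this (by simp))
  · have w1 := hW k1
    rw [h1'] at w1
    obtain ⟨y, w11, w12, w13⟩ := W_append.1 w1
    let β : Fin c → List G.E := fun j =>
      if j = k then p ++ e2 :: q' else if j = k1 then p' ++ e1 :: q else α j
    have bk : β k = p ++ e2 :: q' := by simp [β]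
    have bk1 : β k1 = p' ++ e1 :: q := by simp [β, hk]
    have bo : ∀ j, j ≠ k → j ≠ k1 → β j = α j := fun j h h' => by simp [β, h, h']
    have n2 := W_nodup hG (hW k)
    have n1 := W_nodup hG (hW k1)
    have dj := hM.2 k1 k hk
    rw [h1'] at n1 dj
    rw [h2] at n2 dj
    have mk : ∀ e, e ∈ α k ↔ e ∈ p ++ e2 :: q := fun e => by rw [h2]
    have mk1 : ∀ e, e ∈ α k1 ↔ e ∈ p' ++ e1 :: q' := fun e => by rw [h1']
    have hβ : G.MengerSystem u v c β := by
      constructor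
      · intro j
        rw [isPath_iff]
        by_cases hj : j = k
        · subst hj
          rw [bk]
          exact ⟨by simp, W_append.2 ⟨x, w21, w22, hd ▸ w13⟩⟩
        · by_cases hj1 : j = k1
          · subst hj1
            rw [bk1]
            exact ⟨by simp, W_append.2 ⟨y, w11, w12, hd.symm ▸ w23⟩⟩
          · rw [bo j hj hj1]
            exact isPath_iff.1 (hM.1 j)
      · have base : ∀ e, e ∈ β k → e ∉ β k1 := by
          intro e
          rw [bk, bk1]
          rw [List.nodup_append] at n1 n2
          have d1 := dj e
          simp only [List.mem_append, List.mem_cons, List.nodup_cons] at *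
          intro ha hb
          rcases ha with ha | ha | ha <;> rcases hb with hb | hb | hb
          · exact d1 (by simp [hb]) (by simp [ha])
          · exact d1 (by simp [hb]) (by simp [ha])
          · exact n2.2.2 e ha e (by simp [hb]) rfl
          · exact d1 (by simp [hb]) (by simp [ha])
          · exact d1 (by simp [hb]) (by simp [ha])
          · exact n2.2.1.1 (ha ▸ hb)
          · exact n1.2.2 e hb e (by simp [ha]) rfl
          · exact n1.2.1.1 (hb ▸ ha)
          · exact d1 (by simp [ha]) (by simp [hb])
        have oth : ∀ j, j ≠ k → j ≠ k1 → ∀ e, e ∈ α j → e ∉ β k ∧ e ∉ β k1 := by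
          intro j hj hj1 e he
          have a1 := hM.2 j k hj e he
          have a2 := hM.2 j k1 hj1 e he
          rw [mk] at a1
          rw [mk1] at a2
          rw [bk, bk1]
          simp only [List.mem_append, List.mem_cons, not_or] at *
          tauto
        intro i j hij e he he'
        by_cases hi : i = k
        · subst hi
          by_cases hj : j = k1
          · subst hj
            exact base e he he'
          · rw [bo j (Ne.symm hij) hj] at he'
            exact (oth j (Ne.symm hij) hj e he').1 he
        · by_cases hi1 : i = k1
          · subst hi1
            by_cases hj : j = k
            · subst hj
              exact base e he' he
            · rw [bo j hj (Ne.symm hij)] at he'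
              exact (oth j hj (Ne.symm hij) e he').2 he
          · rw [bo i hi hi1] at he
            by_cases hj : j = k
            · subst hj
              exact (oth i hi hi1 e he).1 he'
            · by_cases hj1 : j = k1
              · subst hj1
                exact (oth i hi hi1 e he).2 he'
              · rw [bo j hj hj1] at he'
                exact hM.2 i j hij e he he'
    have hr := hN β hβ
    have : β k ∈ Set.range α := hr ▸ ⟨k, rfl⟩
    obtain ⟨j, hj⟩ := this
    have hjk : j = k := by
      by_contra hne'
      exact hM.2 j k hne' e2 (by rw [hj, bk]; simp) (by rw [h2]; simp)
    subst hjk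
    rw [bk, h2] at hj
    have hqq : q = q' := by simpa using hj
    subst hqq
    obtain ⟨f, hf⟩ := List.exists_mem_of_ne_nil q hq
    exact dj f (by simp [hf]) (by simp [hf])

theorem menger_acyc {G : MultiDigraph} (hac : G.Acyclic) {u v : G.V} {c : ℕ}
    {α : Fin c → List G.E} (hM : G.MengerSystem u v c α) (hN : G.NonReroutable u v c α)
    (x : G.V) (hx : TransGen (Hrel G.src G.dst (fun e k => e ∈ α k)) x x) : False := by
  classical
  let _ := G.fintV
  have hG := acyc_G hac
  have hW : ∀ k, W G.src G.dst u v (α k) := fun k => (isPath_iff.1 (hM.1 k)).2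
  let s' : G.E → G.V := fun e => if ∃ k, e ∈ α k then G.src e else G.dst e
  let d' : G.E → G.V := fun e => if ∃ k, e ∈ α k then G.dst e else G.src e
  have hx' : TransGen (Gst s' d') x x := by
    refine tg_m ?_ hx
    rintro a b ⟨e, ⟨h1, h2, h3⟩ | ⟨h1, h2, h3⟩⟩
    · exact ⟨e, by simp only [s']; rw [if_pos h1, h2], by simp only [d']; rw [if_pos h1, h3]⟩
    · exact ⟨e, by simp only [s']; rw [if_neg h1, h2], by simp only [d']; rw [if_neg h1, h3]⟩
  obtain ⟨y, C, hC1, hC2, hC3⟩ := closed_nodup hx'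
  have hon : ∃ e ∈ C, ∃ k, e ∈ α k := by
    by_contra hcon
    have key : ∀ (C : List G.E) (a b : G.V), C ≠ [] → (∀ e ∈ C, ¬ ∃ k, e ∈ α k) →
        W s' d' a b C → TransGen (Gst G.src G.dst) b a := by
      intro C
      induction C with
      | nil => simp
      | cons e C ih =>
        intro a b _ h1 h2
        have he := h1 e (by simp)
        obtain ⟨h3, h4⟩ := h2
        have hs : s' e = G.dst e := by simp only [s']; rw [if_neg he]
        have hd : d' e = G.src e := by simp only [d']; rw [if_neg he]
        have st : Gst G.src G.dst (d' e) a := ⟨e, hd.symm, by rw [← hs, h3]⟩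
        rcases C with _ | ⟨f, C⟩
        · obtain rfl : d' e = b := h4
          exact .single st
        · exact (ih (d' e) b (by simp) (fun e he => h1 e (by simp [he])) h4).tail st
    refine hG _ (key C y y hC1 (fun e he h => hcon ⟨e, he, h⟩) hC2)
  obtain ⟨e0, he0, k0, hk0⟩ := hon
  have huv : u ≠ v := by
    rintro rfl
    exact hac _ _ (hM.1 k0)
  let F : Finset G.E := Finset.univ.biUnion fun k => (α k).toFinset
  have hFm : ∀ e, e ∈ F ↔ ∃ k, e ∈ α k := fun e => by simp [F]
  have hFb : ∀ z, ∑ e ∈ F, del G.src G.dst z e =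
      (c : ℤ) * ((if u = z then 1 else 0) - (if v = z then 1 else 0)) := by
    intro z
    rw [Finset.sum_biUnion]
    · rw [Finset.sum_congr rfl (fun k _ => W_fsum (hW k) (W_nodup hG (hW k)) z)]
      simp [mul_sub]
    · intro i _ j _ hij
      rw [Function.onFun, Finset.disjoint_left]
      intro e he he'
      exact hM.2 i j hij e (by simpa using he) (by simpa using he')
  let F' : Finset G.E := (F \ C.toFinset) ∪ (C.toFinset \ F)
  have hF'b : ∀ z, ∑ e ∈ F', del G.src G.dst z e =
      (c : ℤ) * ((if u = z then 1 else 0) - (if v = z then 1 else 0)) := by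
    intro z
    rw [← hFb z, Finset.sum_union (by
      rw [Finset.disjoint_left]
      intro e he he'
      simp at he he'
      exact he'.2 he.1)]
    have h1 := W_fsum hC2 hC3 z
    rw [sub_self] at h1
    have h2 := Finset.sum_inter_add_sum_sdiff C.toFinset F (del s' d' z)
    have h3 := Finset.sum_inter_add_sum_sdiff F C.toFinset (del G.src G.dst z)
    have h4 : ∑ e ∈ C.toFinset ∩ F, del s' d' z e = ∑ e ∈ F ∩ C.toFinset, del G.src G.dst z e := by
      rw [Finset.inter_comm]
      apply Finset.sum_congr rfl
      intro e he
      have := (hFm e).1 (Finset.mem_inter.1 he).1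
      simp only [del, s', d', if_pos this]
    have h5 : ∑ e ∈ C.toFinset \ F, del s' d' z e = - ∑ e ∈ C.toFinset \ F, del G.src G.dst z e := by
      rw [← Finset.sum_neg_distrib]
      apply Finset.sum_congr rfl
      intro e he
      have : ¬ ∃ k, e ∈ α k := fun h => (Finset.mem_sdiff.1 he).2 ((hFm e).2 h)
      simp only [del, s', d', if_neg this]
      ring
    linarith
  obtain ⟨β, h1, h2, h3⟩ := flow_decomp hG huv c F' hF'b
  have hr := hN β ⟨fun i => isPath_iff.2 (h1 i), h2⟩
  have : α k0 ∈ Set.range β := hr ▸ ⟨k0, rfl⟩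
  obtain ⟨j, hj⟩ := this
  have := h3 j e0 (hj ▸ hk0)
  simp [F', he0, hFm] at this
  exact this k0 hk0

/-- the abstract path system of a unique Menger system -/
noncomputable def mkPS {G : MultiDigraph} (hac : G.Acyclic) {u v : G.V} {c : ℕ}
    {α : Fin c → List G.E} (hM : G.MengerSystem u v c α) (hN : G.NonReroutable u v c α) :
    PS G.src G.dst c :=
  have hW : ∀ k, W G.src G.dst u v (α k) := fun k => (isPath_iff.1 (hM.1 k)).2
  have hnd : ∀ k, (α k).Nodup := fun k => W_nodup (acyc_G hac) (hW k)
  { on := fun e k => e ∈ α k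
    pos := ppos α
    S := u
    uniq := fun e k k' h h' => by
      by_contra hne
      exact hM.2 k k' hne e h h'
    inj := fun e e' k h h' hp => by
      have h1 := (ppos_iff hM.2 hnd).2 ⟨h, rfl⟩
      have h2 := (ppos_iff hM.2 hnd).2 ⟨h', rfl⟩
      rw [hp, h2] at h1
      exact (Option.some.inj h1).symm
    dn := fun e k i h hi => by
      have h1 := (ppos_iff hM.2 hnd).2 ⟨h, rfl⟩
      obtain ⟨hlt, _⟩ := List.getElem?_eq_some_iff.1 h1
      exact ⟨(α k)[i]'(by omega), (ppos_iff hM.2 hnd).1 (List.getElem?_eq_getElem _)⟩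
    link := fun e e' k h h' hp =>
      W_link (hW k) ((ppos_iff hM.2 hnd).2 ⟨h, rfl⟩) ((ppos_iff hM.2 hnd).2 ⟨h', hp⟩)
    first := fun e k h hp => W_first (hW k) ((ppos_iff hM.2 hnd).2 ⟨h, hp⟩)
    inU := fun e1 e2 e3 k1 k h1 h2 h3 hp hd => by
      have i2 := (ppos_iff hM.2 hnd).2 ⟨h2, rfl⟩
      have i3 := (ppos_iff hM.2 hnd).2 ⟨h3, hp⟩
      obtain ⟨l3, _⟩ := List.getElem?_eq_some_iff.1 i3
      obtain ⟨l2, j2⟩ := List.getElem?_eq_some_iff.1 i2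
      refine menger_inU hac hM hN (k := k) (p := (α k).take (ppos α e2))
        (q := (α k).drop (ppos α e2 + 1)) h1 ?_ ?_ hd
      · conv_lhs => rw [← List.take_append_drop (ppos α e2) (α k)]
        rw [List.drop_eq_getElem_cons l2, j2]
      · intro h
        rw [List.drop_eq_nil_iff] at h
        omega
    acyc := menger_acyc hac hM hN }

end GraphToPS

section Visits

open Relation PS

variable {V E : Type} {src dst : E → V} {m n : ℕ}

/-- the list family represents the path system -/
def PSRep (P : PS src dst m) (φ : Fin m → List E) : Prop :=
  ∀ k i e, (φ k)[i]? = some e ↔ P.on e k ∧ P.pos e = i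

theorem split_pos {P : PS src dst m} {φ : Fin m → List E} (hR : PSRep P φ) {a : Fin m}
    {x s y : List E} {u l : E} (h : φ a = x ++ s ++ y) (hu : s.head? = some u)
    (hl : s.getLast? = some l) :
    P.on u a ∧ P.pos u = x.length ∧ P.on l a ∧ P.pos l + 1 = x.length + s.length := by
  have hs : s ≠ [] := by
    rintro rfl
    simp at hu
  have hpos := List.length_pos_iff.2 hs
  have h1 := (hR a x.length u).1 (by
    rw [h, List.append_assoc, List.getElem?_append_right le_rfl,
      List.getElem?_append_left (by simpa using hpos)]
    simpa [List.head?_eq_getElem?] using hu)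
  have h2 := (hR a (x.length + (s.length - 1)) l).1 (by
    rw [h, List.append_assoc, List.getElem?_append_right (by omega),
      List.getElem?_append_left (by omega)]
    rw [List.getLast?_eq_getElem?] at hl
    rw [← hl]
    congr 1
    omega)
  exact ⟨h1.1, h1.2, h2.1, by omega⟩

theorem pre_of_infix {P : PS src dst m} {φ : Fin m → List E} (hR : PSRep P φ) {a : Fin m}
    {e f : E} (h : [e, f] <:+: φ a) : P.pre e f := by
  obtain ⟨x, y, h⟩ := h
  have h1 := split_pos hR h.symm rfl rfl
  have h2 : φ a = x ++ [e] ++ (f :: y) := by rw [← h]; simp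
  have h3 := split_pos hR h2 rfl rfl
  simp at h1 h3
  exact ⟨a, h1.1, h1.2.2.1, by omega⟩

theorem ext_right {P : PS src dst m} {φ : Fin m → List E} (hR : PSRep P φ) {a : Fin m}
    {x s y : List E} {l e : E} (h : φ a = x ++ s ++ y) (hl : s.getLast? = some l)
    (hp : P.pre l e) : ∃ y', y = e :: y' := by
  obtain ⟨u, hu⟩ : ∃ u, s.head? = some u := by
    rcases s with _ | ⟨u, s⟩
    · simp at hl
    · exact ⟨u, rfl⟩
  obtain ⟨_, _, h3, h4⟩ := split_pos hR h hu hl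
  obtain ⟨h5, h6⟩ := P.on_pre hp h3
  have := (hR a (x.length + s.length) e).2 ⟨h5, by omega⟩
  rw [h, List.getElem?_append_right (by simp)] at this
  simp at this
  rcases y with _ | ⟨z, y⟩
  · simp at this
  · simp at this
    exact ⟨y, by rw [this]⟩

theorem ext_left {P : PS src dst m} {φ : Fin m → List E} (hR : PSRep P φ) {a : Fin m}
    {x s y : List E} {u e : E} (h : φ a = x ++ s ++ y) (hu : s.head? = some u)
    (hp : P.pre e u) : ∃ x', x = x' ++ [e] := by
  obtain ⟨l, hl⟩ : ∃ l, s.getLast? = some l := by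
    rcases s with _ | ⟨v, s⟩
    · simp at hu
    · exact ⟨_, List.getLast?_eq_getLast_of_ne_nil (by simp)⟩
  obtain ⟨h3, h4, _, _⟩ := split_pos hR h hu hl
  obtain ⟨h5, h6⟩ := P.pre_on hp h3
  rcases List.eq_nil_or_concat x with rfl | ⟨x', z, rfl⟩
  · simp at h4
    omega
  · have := (hR a x'.length e).2 ⟨h5, by simp at h4; omega⟩
    rw [h] at this
    simp at this
    exact ⟨x', by simp [this]⟩

theorem infix_run {P : PS src dst m} {Q : PS src dst n} {φ : Fin m → List E} {ψ : Fin n → List E}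
    (hR : PSRep P φ) (hS : PSRep Q ψ) {a : Fin m} {b : Fin n} {s : List E} {u l : E}
    (hu : s.head? = some u) (hl : s.getLast? = some l) (h1 : s <:+: φ a) (h2 : s <:+: ψ b) :
    ReflTransGen (ns P Q) u l := by
  induction s generalizing u with
  | nil => simp at hu
  | cons e s ih =>
    simp at hu
    subst hu
    rcases s with _ | ⟨f, s⟩
    · simp at hl
      subst hl
      rfl
    · have i1 : [e, f] <:+: e :: f :: s := ⟨[], s, by simp⟩
      have i2 : f :: s <:+: e :: f :: s := ⟨[e], [], by simp⟩
      have := ih (u := f) rfl (by simpa [List.getLast?_cons_cons] using hl) (i2.trans h1)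
        (i2.trans h2)
      exact ReflTransGen.head ⟨pre_of_infix hR (i1.trans h1), pre_of_infix hS (i1.trans h2)⟩ this

/-- a list carrying a block -/
structure VB (P : PS src dst m) (Q : PS src dst n) (φ : Fin m → List E) (ψ : Fin n → List E)
    (a : Fin m) (b : Fin n) (s : List E) (u l : E) : Prop where
  blk : Blk P Q a b u l
  hu : s.head? = some u
  hl : s.getLast? = some l
  i1 : s <:+: φ a
  i2 : s <:+: ψ b

theorem VB.symm {P : PS src dst m} {Q : PS src dst n} {φ : Fin m → List E} {ψ : Fin n → List E}
    {a : Fin m} {b : Fin n} {s : List E} {u l : E} (h : VB P Q φ ψ a b s u l) :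
    VB Q P ψ φ b a s u l := ⟨h.blk.symm, h.hu, h.hl, h.i2, h.i1⟩

theorem ends {s : List E} (h : s ≠ []) : ∃ u l, s.head? = some u ∧ s.getLast? = some l :=
  ⟨_, _, List.head?_eq_some_head h, List.getLast?_eq_getLast_of_ne_nil h⟩

theorem MergedSub.vb {P : PS src dst m} {Q : PS src dst n} {φ : Fin m → List E}
    {ψ : Fin n → List E} (hR : PSRep P φ) (hS : PSRep Q ψ) {a : Fin m} {b : Fin n} {s : List E}
    (h : MergedSub (φ a) (ψ b) s) : ∃ u l, VB P Q φ ψ a b s u l ∧ Head P Q u := by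
  obtain ⟨h0, h1, h2, ⟨f, g, hfg, h3, h4⟩, h5⟩ := h
  obtain ⟨u, l, hu, hl⟩ := ends h0
  have hH : Head P Q u := by
    rcases s with _ | ⟨v, s⟩
    · simp at hu
    · simp at hu
      subst hu
      have i1 : ∀ f : E, [f, v] <:+: f :: v :: s := fun f => ⟨[], s, by simp⟩
      exact ⟨f, g, pre_of_infix hR ((i1 f).trans h3), pre_of_infix hS ((i1 g).trans h4), hfg⟩
  obtain ⟨x, y, hxy⟩ := id h1
  obtain ⟨x', y', hxy'⟩ := id h2
  refine ⟨u, l, ⟨⟨(split_pos hR hxy.symm hu hl).1, (split_pos hS hxy'.symm hu hl).1,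
    infix_run hR hS hu hl h1 h2, ?_, Or.inl hH⟩, hu, hl, h1, h2⟩, hH⟩
  intro e he
  obtain ⟨z, rfl⟩ := ext_right hR hxy.symm hl he.1
  obtain ⟨z', rfl⟩ := ext_right hS hxy'.symm hl he.2
  exact h5 e ⟨⟨x, z, by rw [← hxy]; simp⟩, ⟨x', z', by rw [← hxy']; simp⟩⟩

theorem StartSub.vb {P : PS src dst m} {Q : PS src dst n} {φ : Fin m → List E}
    {ψ : Fin n → List E} (hR : PSRep P φ) (hS : PSRep Q ψ) {a : Fin m} {b : Fin n} {s : List E}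
    (h : StartSub (φ a) (ψ b) s) : ∃ u l, VB P Q φ ψ a b s u l := by
  obtain ⟨h0, h1, h2, h5⟩ := h
  obtain ⟨u, l, hu, hl⟩ := ends h0
  obtain ⟨y, hxy⟩ := id h1
  obtain ⟨y', hxy'⟩ := id h2
  have e1 : φ a = [] ++ s ++ y := by simp [hxy]
  have e2 : ψ b = [] ++ s ++ y' := by simp [hxy']
  have p1 := split_pos hR e1 hu hl
  have p2 := split_pos hS e2 hu hl
  refine ⟨u, l, ⟨⟨p1.1, p2.1,
    infix_run hR hS hu hl h1.isInfix h2.isInfix, ?_, Or.inr ⟨p1.2.1, p2.2.1⟩⟩, hu, hl,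
    h1.isInfix, h2.isInfix⟩⟩
  intro e he
  obtain ⟨z, rfl⟩ := ext_right hR e1 hl he.1
  obtain ⟨z', rfl⟩ := ext_right hS e2 hl he.2
  exact h5 e ⟨⟨z, by rw [← hxy]; simp⟩, ⟨z', by rw [← hxy']; simp⟩⟩

theorem single_infix {P : PS src dst m} {φ : Fin m → List E} (hR : PSRep P φ) {a : Fin m} {e : E}
    (h : P.on e a) : [e] <:+: φ a := by
  obtain ⟨s, t, h⟩ := List.append_of_mem (List.mem_of_getElem? ((hR a (P.pos e) e).2 ⟨h, rfl⟩))
  exact ⟨s, t, by rw [h]; simp⟩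

theorem run_list {P : PS src dst m} {Q : PS src dst n} {φ : Fin m → List E} {ψ : Fin n → List E}
    (hR : PSRep P φ) (hS : PSRep Q ψ) {a : Fin m} {b : Fin n} {u l : E} (ha : P.on u a)
    (hb : Q.on u b) (h : ReflTransGen (ns P Q) u l) :
    ∃ s : List E, s.head? = some u ∧ s.getLast? = some l ∧ s <:+: φ a ∧ s <:+: ψ b := by
  induction h with
  | refl => exact ⟨[u], rfl, rfl, single_infix hR ha, single_infix hS hb⟩
  | @tail l e _ h2 ih =>
    obtain ⟨s, h3, h4, ⟨x, y, h5⟩, ⟨x', y', h6⟩⟩ := ih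
    obtain ⟨z, rfl⟩ := ext_right hR h5.symm h4 h2.1
    obtain ⟨z', rfl⟩ := ext_right hS h6.symm h4 h2.2
    refine ⟨s ++ [e], ?_, by simp, ⟨x, z, by rw [← h5]; simp⟩, ⟨x', z', by rw [← h6]; simp⟩⟩
    rcases s with _ | ⟨v, s⟩
    · simp at h3
    · simpa using h3

theorem head_merged [Finite E] {P : PS src dst m} {Q : PS src dst n} {φ : Fin m → List E}
    {ψ : Fin n → List E} (hR : PSRep P φ) (hS : PSRep Q ψ) {a : Fin m} {b : Fin n} {u : E}
    (ha : P.on u a) (hb : Q.on u b) (hH : Head P Q u) :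
    ∃ s l, MergedSub (φ a) (ψ b) s ∧ VB P Q φ ψ a b s u l := by
  obtain ⟨l, h1, h2⟩ := exists_term P Q u
  obtain ⟨s, h3, h4, h5, h6⟩ := run_list hR hS ha hb h1
  refine ⟨s, l, ⟨?_, h5, h6, ?_, ?_⟩, ⟨⟨ha, hb, h1, h2, Or.inl hH⟩, h3, h4, h5, h6⟩⟩
  · rintro rfl
    simp at h3
  · obtain ⟨f, g, i1, i2, i3⟩ := hH
    obtain ⟨x, y, h5⟩ := h5
    obtain ⟨x', y', h6⟩ := h6
    obtain ⟨z, rfl⟩ := ext_left hR h5.symm h3 i1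
    obtain ⟨z', rfl⟩ := ext_left hS h6.symm h3 i2
    exact ⟨f, g, i3, ⟨z, y, by rw [← h5]; simp⟩, ⟨z', y', by rw [← h6]; simp⟩⟩
  · rintro e ⟨j1, j2⟩
    have : [l, e] <:+: s ++ [e] := by
      rcases List.eq_nil_or_concat s with rfl | ⟨s', z, rfl⟩
      · simp at h4
      · simp at h4
        subst h4
        exact ⟨s', [], by simp⟩
    exact h2 e ⟨pre_of_infix hR (this.trans j1), pre_of_infix hS (this.trans j2)⟩

theorem ordered_pos {P : PS src dst m} {φ : Fin m → List E} (hR : PSRep P φ) {a : Fin m}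
    {s t : List E} {u l u' l' : E} (hu : s.head? = some u) (hl : s.getLast? = some l)
    (hu' : t.head? = some u') (hl' : t.getLast? = some l') (h : OrderedOn (φ a) s t) :
    P.pos l < P.pos u' := by
  obtain ⟨x, y, z, h⟩ := h
  have h1 : φ a = x ++ s ++ (y ++ t ++ z) := by rw [h]; simp
  have h2 : φ a = (x ++ s ++ y) ++ t ++ z := by rw [h]
  have p1 := split_pos hR h1 hu hl
  have p2 := split_pos hR h2 hu' hl'
  simp at p1 p2
  omega

theorem pos_ordered {P : PS src dst m} {φ : Fin m → List E} (hR : PSRep P φ) {a : Fin m}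
    {s t : List E} {u l u' l' : E} (hu : s.head? = some u) (hl : s.getLast? = some l)
    (hu' : t.head? = some u') (hl' : t.getLast? = some l') (hs : s <:+: φ a) (ht : t <:+: φ a)
    (h : P.pos l < P.pos u') : OrderedOn (φ a) s t := by
  obtain ⟨x, y, h1⟩ := hs
  obtain ⟨x', y', h2⟩ := ht
  have p1 := split_pos hR h1.symm hu hl
  have p2 := split_pos hR h2.symm hu' hl'
  have q1 : x ++ s <+: φ a := ⟨y, h1⟩
  have q2 : x' <+: φ a := ⟨t ++ y', by rw [← h2]; simp⟩
  obtain ⟨v, hv⟩ := List.prefix_of_prefix_length_le q1 q2 (by simp; omega)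
  exact ⟨x, v, y', by rw [← h2, ← hv]⟩

theorem gap_list [Finite E] {P : PS src dst m} {Q : PS src dst n} {φ : Fin m → List E}
    {ψ : Fin n → List E} (hG : ∀ x, ¬ TransGen (Gst src dst) x x) (hR : PSRep P φ) (hS : PSRep Q ψ)
    {a : Fin m} {b b' : Fin n} {s t : List E} {u l u' l' : E} (h : VB P Q φ ψ a b s u l)
    (h' : VB P Q φ ψ a b' t u' l') (ho : OrderedOn (φ a) s t)
    (hno : ∀ c r, MergedSub (φ a) (ψ c) r → ¬ (OrderedOn (φ a) s r ∧ OrderedOn (φ a) r t)) :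
    TransGen (A P Q) (dst l) (src u') := by
  have hlt := ordered_pos hR h.hu h.hl h'.hu h'.hl ho
  have hH : Head P Q u' := by
    rcases h'.blk.start with h | h
    · exact h
    · omega
  refine gap hG h.blk.lP h.blk.lQ h.blk.term h'.blk.onP hH hlt ?_
  intro x hx hxH h1 h2
  obtain ⟨c, hc⟩ := hxH.onQ
  obtain ⟨r, z, hr, hv⟩ := head_merged hR hS hx hc hxH
  refine hno c r hr ⟨pos_ordered hR h.hu h.hl hv.hu hv.hl h.i1 hv.i1 h1,
    pos_ordered hR hv.hu hv.hl h'.hu h'.hl hv.i1 h'.i1 ?_⟩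
  exact run_lt hx hv.blk.run h'.blk.onP hH h2

theorem MergedSub.symm {p q s : List E} (h : MergedSub p q s) : MergedSub q p s := by
  obtain ⟨h0, h1, h2, ⟨f, g, hfg, h3, h4⟩, h5⟩ := h
  exact ⟨h0, h2, h1, ⟨g, f, hfg.symm, h4, h3⟩, fun e he => h5 e he.symm⟩

theorem count_merge [Finite E] {P : PS src dst m} {Q : PS src dst n} {φ : Fin m → List E}
    {ψ : Fin n → List E} (hG : ∀ x, ¬ TransGen (Gst src dst) x x) (hR : PSRep P φ) (hS : PSRep Q ψ)
    (i : Fin m) : Set.ncard {s : List E | ∃ b, MergedSub (φ i) (ψ b) s} ≤ m * n := by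
  refine le_trans ?_ (count_heads (P := P) (Q := Q) hG i)
  rw [← Set.ncard_image_of_injective _ (Option.some_injective E)]
  refine Set.ncard_le_ncard_of_injOn List.head? ?_ ?_ (Set.toFinite _)
  · rintro s ⟨b, h⟩
    obtain ⟨u, l, h1, h2⟩ := h.vb hR hS
    exact ⟨u, ⟨h1.blk.onP, h2⟩, h1.hu.symm⟩
  · rintro s ⟨b, h⟩ s' ⟨b', h'⟩ hh
    obtain ⟨u, l, h1, h2⟩ := h.vb hR hS
    obtain ⟨u', l', h1', h2'⟩ := h'.vb hR hS
    have : u = u' := by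
      rw [h1.hu, h1'.hu] at hh
      exact Option.some.inj hh
    subst this
    obtain rfl := Term.uniq h1.blk.run h1'.blk.run h1.blk.term h1'.blk.term
    obtain ⟨x, y, hxy⟩ := h1.i1
    obtain ⟨x', y', hxy'⟩ := h1'.i1
    have p1 := split_pos hR hxy.symm h1.hu h1.hl
    have p2 := split_pos hR hxy'.symm h1'.hu h1'.hl
    have e := hxy.trans hxy'.symm
    rw [List.append_assoc, List.append_assoc] at e
    have e2 := List.append_inj_right e (by omega)
    exact List.append_inj_left e2 (by omega)

theorem chain_reach {G : MultiDigraph} [Finite G.E] {P : PS G.src G.dst m} {Q : PS G.src G.dst n}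
    {φ : Fin m → List G.E} {ψ : Fin n → List G.E}
    (hG : ∀ x, ¬ TransGen (Gst G.src G.dst) x x) (hR : PSRep P φ) (hS : PSRep Q ψ)
    {Pd : Visit G m n → Prop} (hPd : ∀ v, Pd v → ∃ u l, VB P Q φ ψ v.1 v.2.1 v.2.2 u l)
    (hMS : ∀ v, MS φ ψ v → Pd v) {dir : Bool} {v : Visit G m n} {L : List (Visit G m n)}
    (h : AAChain φ ψ Pd dir v L) : ∀ u l, VB P Q φ ψ v.1 v.2.1 v.2.2 u l →
      ∀ w ∈ L, ∃ u' l' y, VB P Q φ ψ w.1 w.2.1 w.2.2 u' l' ∧ (y = G.src u' ∨ y = G.dst l') ∧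
        TransGen (A P Q) (if dir then G.src u else G.dst l) y := by
  induction h with
  | stopAgainst v h => simp
  | stopAlong v h => simp
  | consAgainst v w rest hst hch ih =>
    intro u l hv
    obtain ⟨s1, s2, s3, s4⟩ := hst
    obtain ⟨u', l', hw⟩ := hPd w s2
    have hw' := hw.symm
    rw [s1] at hw'
    have hstep := A_tg_symm (gap_list hG hS hR hw' hv.symm s3 (fun c r hr =>
      s4 (c, v.2.1, r) (hMS _ hr.symm) rfl))
    intro z hz
    rcases List.mem_cons.1 hz with rfl | hz
    · exact ⟨u', l', _, hw, Or.inr rfl, by simpa using hstep⟩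
    · obtain ⟨u2, l2, y, h1, h2, h3⟩ := ih u' l' hw z hz
      exact ⟨u2, l2, y, h1, h2, by simpa using hstep.trans (by simpa using h3)⟩
  | consAlong v w rest hst hch ih =>
    intro u l hv
    obtain ⟨s1, s2, s3, s4⟩ := hst
    obtain ⟨u', l', hw⟩ := hPd w s2
    have hw' := hw
    rw [s1] at hw'
    have hstep := gap_list hG hR hS hv hw' s3 (fun c r hr =>
      s4 (v.1, c, r) (hMS _ hr) rfl)
    intro z hz
    rcases List.mem_cons.1 hz with rfl | hz
    · exact ⟨u', l', _, hw, Or.inl rfl, by simpa using hstep⟩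
    · obtain ⟨u2, l2, y, h1, h2, h3⟩ := ih u' l' hw z hz
      exact ⟨u2, l2, y, h1, h2, by simpa using hstep.trans (by simpa using h3)⟩

theorem chain_nodup {G : MultiDigraph} [Finite G.E] {P : PS G.src G.dst m} {Q : PS G.src G.dst n}
    {φ : Fin m → List G.E} {ψ : Fin n → List G.E}
    (hG : ∀ x, ¬ TransGen (Gst G.src G.dst) x x) (hR : PSRep P φ) (hS : PSRep Q ψ)
    {Pd : Visit G m n → Prop} (hPd : ∀ v, Pd v → ∃ u l, VB P Q φ ψ v.1 v.2.1 v.2.2 u l)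
    (hMS : ∀ v, MS φ ψ v → Pd v) {dir : Bool} {v : Visit G m n} {L : List (Visit G m n)}
    (h : AAChain φ ψ Pd dir v L) (hv : Pd v) :
    ((v :: L).map (fun w => (w.1, w.2.1))).Nodup := by
  have aux : ∀ (dir : Bool) (v : Visit G m n) L, AAChain φ ψ Pd dir v L → Pd v →
      (v.1, v.2.1) ∉ L.map (fun w => (w.1, w.2.1)) := by
    intro dir v L h hv hm
    obtain ⟨u, l, hvb⟩ := hPd v hv
    rw [List.mem_map] at hm
    obtain ⟨w, hw, hwv⟩ := hm
    obtain ⟨u', l', y, h1, h2, h3⟩ := chain_reach hG hR hS hPd hMS h u l hvb w hw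
    simp only [Prod.mk.injEq] at hwv
    have hb := h1.blk
    rw [hwv.1, hwv.2] at hb
    refine pairDistinct hG hvb.blk hb ?_ h2 h3
    cases dir <;> simp
  induction h with
  | stopAgainst v h => simp
  | stopAlong v h => simp
  | consAgainst v w rest hst hch ih =>
    rw [List.map_cons, List.nodup_cons]
    exact ⟨aux _ _ _ (.consAgainst v w rest hst hch) hv, ih hst.2.1⟩
  | consAlong v w rest hst hch ih =>
    rw [List.map_cons, List.nodup_cons]
    exact ⟨aux _ _ _ (.consAlong v w rest hst hch) hv, ih hst.2.1⟩

theorem chain_bound {G : MultiDigraph} [Finite G.E] {P : PS G.src G.dst m} {Q : PS G.src G.dst n}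
    {φ : Fin m → List G.E} {ψ : Fin n → List G.E}
    (hG : ∀ x, ¬ TransGen (Gst G.src G.dst) x x) (hR : PSRep P φ) (hS : PSRep Q ψ)
    {Pd : Visit G m n → Prop} (hPd : ∀ v, Pd v → ∃ u l, VB P Q φ ψ v.1 v.2.1 v.2.2 u l)
    (hMS : ∀ v, MS φ ψ v → Pd v) {dir : Bool} {v : Visit G m n} {L : List (Visit G m n)}
    (h : AAChain φ ψ Pd dir v L) (hv : Pd v) : (v :: L).length ≤ m * n := by
  have := (chain_nodup hG hR hS hPd hMS h hv).length_le_card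
  simpa using this

theorem mkPS_rep {G : MultiDigraph} (hac : G.Acyclic) {u v : G.V} {c : ℕ}
    {α : Fin c → List G.E} (hM : G.MengerSystem u v c α) (hN : G.NonReroutable u v c α) :
    PSRep (mkPS hac hM hN) α := fun _ _ _ =>
  ppos_iff hM.2 (fun k => W_nodup (acyc_G hac) (isPath_iff.1 (hM.1 k)).2)

end Visits

/-- In a non-reroutable `(m, n)`-graph with distinct sources, every
AA-sequence has length at most `mn`, and every φ-path and every ψ-path merges (i.e.
carries merged subpaths) at most `mn` times.  In a non-reroutable `(m, m)`-graph with
identical sources (with the `m` paired starting subpaths), every ψ-AA-sequence has length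
at most `m²`, and every φ-path and every ψ-path merges at most `m²` times. -/
theorem AA_sequence_length_bounds :
    (∀ (G : MultiDigraph) (S1 S2 R1 R2 : G.V) (m n : ℕ)
        (φ : Fin m → List G.E) (ψ : Fin n → List G.E),
        MNGraph G S1 S2 R1 R2 m n φ ψ → S1 ≠ S2 →
        (∀ (i : Fin m) (L : List (Visit G m n)),
            IsPhiAA φ ψ (MS φ ψ) i L → L.length ≤ m * n) ∧
          (∀ (j : Fin n) (L : List (Visit G m n)),
            IsPsiAA φ ψ (MS φ ψ) j L → L.length ≤ m * n) ∧
          (∀ i : Fin m, Set.ncard {s : List G.E | ∃ b, MS φ ψ (i, b, s)} ≤ m * n) ∧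
          ∀ j : Fin n, Set.ncard {s : List G.E | ∃ a, MS φ ψ (a, j, s)} ≤ m * n) ∧
      ∀ (G : MultiDigraph) (S R1 R2 : G.V) (m : ℕ) (φ ψ : Fin m → List G.E),
        MNGraph G S S R1 R2 m m φ ψ →
        (∀ i : Fin m, ∃ s, StartSub (φ i) (ψ i) s) →
        (∀ (j : Fin m) (L : List (Visit G m m)),
            IsPsiAA φ ψ (MSI φ ψ) j L → L.length ≤ m ^ 2) ∧
          (∀ i : Fin m, Set.ncard {s : List G.E | ∃ b, MS φ ψ (i, b, s)} ≤ m ^ 2) ∧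
          ∀ j : Fin m, Set.ncard {s : List G.E | ∃ a, MS φ ψ (a, j, s)} ≤ m ^ 2 := by
  refine ⟨?_, ?_⟩
  · rintro G S1 S2 R1 R2 m n φ ψ ⟨hac, _, _, _, hM, hM', _, hN, hN'⟩ _
    have hfin : Finite G.E := @Finite.of_fintype _ G.fintE
    have hG := acyc_G hac
    have hR := mkPS_rep hac hM hN
    have hS := mkPS_rep hac hM' hN'
    have hPd : ∀ v, MS φ ψ v →
        ∃ u l, VB (mkPS hac hM hN) (mkPS hac hM' hN') φ ψ v.1 v.2.1 v.2.2 u l := by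
      intro v hv
      obtain ⟨u, l, h, _⟩ := MergedSub.vb hR hS hv
      exact ⟨u, l, h⟩
    refine ⟨?_, ?_, ?_, ?_⟩
    · rintro i L (⟨rfl, _⟩ | ⟨v, rest, rfl, _, hv, _, hc⟩)
      · simp
      · exact chain_bound hG hR hS hPd (fun _ h => h) hc hv
    · rintro i L (⟨rfl, _⟩ | ⟨v, rest, rfl, _, hv, _, hc⟩)
      · simp
      · exact chain_bound hG hR hS hPd (fun _ h => h) hc hv
    · intro i
      exact count_merge hG hR hS i
    · intro j
      have h := count_merge hG hS hR j
      rw [mul_comm]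
      have e : {s : List G.E | ∃ a, MS φ ψ (a, j, s)} =
          {s : List G.E | ∃ a, MergedSub (ψ j) (φ a) s} := by
        ext s
        exact ⟨fun ⟨a, h⟩ => ⟨a, MergedSub.symm h⟩, fun ⟨a, h⟩ => ⟨a, MergedSub.symm h⟩⟩
      rw [e]
      exact h
  · rintro G S R1 R2 m φ ψ ⟨hac, _, _, _, hM, hM', _, hN, hN'⟩ _
    have hfin : Finite G.E := @Finite.of_fintype _ G.fintE
    have hG := acyc_G hac
    have hR := mkPS_rep hac hM hN
    have hS := mkPS_rep hac hM' hN'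
    have hPd : ∀ v, MSI φ ψ v →
        ∃ u l, VB (mkPS hac hM hN) (mkPS hac hM' hN') φ ψ v.1 v.2.1 v.2.2 u l := by
      rintro v (hv | ⟨h1, h2⟩)
      · obtain ⟨u, l, h, _⟩ := MergedSub.vb hR hS hv
        exact ⟨u, l, h⟩
      · obtain ⟨u, l, h⟩ := StartSub.vb hR hS h2
        exact ⟨u, l, h1 ▸ h⟩
    rw [sq]
    refine ⟨?_, ?_, ?_⟩
    · rintro i L (⟨rfl, _⟩ | ⟨v, rest, rfl, _, hv, _, hc⟩)
      · simp
      · exact chain_bound hG hR hS hPd (fun _ h => Or.inl h) hc hv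
    · intro i
      exact count_merge hG hR hS i
    · intro j
      have e : {s : List G.E | ∃ a, MS φ ψ (a, j, s)} =
          {s : List G.E | ∃ a, MergedSub (ψ j) (φ a) s} := by
        ext s
        exact ⟨fun ⟨a, h⟩ => ⟨a, MergedSub.symm h⟩, fun ⟨a, h⟩ => ⟨a, MergedSub.symm h⟩⟩
      rw [e]
      exact count_merge hG hS hR j
end

section
/- Let G be a non-reroutable (m,n)-graph. If G has distinct sources, then the number of mergings in G equals one half of the sum of the lengths of all its AA-sequences (m φ-AA-sequences and n ψ-AA-sequences). If G is a non-reroutable (n,n)-graph with identical sources and n starting subpaths, then the number of mergings in G equals one half of (the sum of the lengths of all n ψ-AA-sequences minus n). -/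
open MultiDigraph

/-- The number of mergings of `G`, `|G|_M`: the number of edges at which some φ-path and
some ψ-path merge (counted without multiplicity, one per edge). -/
noncomputable def mergCount2 (G : MultiDigraph) {m n : ℕ}
    (φ : Fin m → List G.E) (ψ : Fin n → List G.E) : ℕ :=
  Set.ncard {e : G.E | ∃ (a : Fin m) (b : Fin n) (f g : G.E),
    f ≠ g ∧ [f, e] <:+: φ a ∧ [g, e] <:+: ψ b}


namespace AAProof

/-- Edges of the family occur at a unique place. -/
def Fam {E : Type} {c : ℕ} (p : Fin c → List E) : Prop :=
  ∀ (i j : Fin c) (k k' : ℕ) (e : E), (p i)[k]? = some e → (p j)[k']? = some e → i = j ∧ k = k'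

/-- Consecutive edges of the family. -/
def Nb {E : Type} {c : ℕ} (p : Fin c → List E) (f e : E) : Prop :=
  ∃ j k, (p j)[k]? = some f ∧ (p j)[k + 1]? = some e

theorem Nb.right {E : Type} {c : ℕ} {p : Fin c → List E} (h : Fam p) {f e e' : E}
    (h1 : Nb p f e) (h2 : Nb p f e') : e = e' := by
  obtain ⟨j, k, a1, a2⟩ := h1
  obtain ⟨j', k', b1, b2⟩ := h2
  obtain ⟨rfl, rfl⟩ := h _ _ _ _ _ a1 b1
  rw [a2] at b2
  exact Option.some.inj b2

theorem Nb.left {E : Type} {c : ℕ} {p : Fin c → List E} (h : Fam p) {f f' e : E}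
    (h1 : Nb p f e) (h2 : Nb p f' e) : f = f' := by
  obtain ⟨j, k, a1, a2⟩ := h1
  obtain ⟨j', k', b1, b2⟩ := h2
  obtain ⟨rfl, hk⟩ := h _ _ _ _ _ a2 b2
  obtain rfl : k = k' := by omega
  rw [a1] at b1
  exact Option.some.inj b1

theorem path_of_trans {G : MultiDigraph} {e e' : G.E}
    (h : Relation.TransGen (fun f e => G.dst f = G.src e) e e') :
    ∃ p, G.IsPathFrom (G.src e) (G.src e') p := by
  induction h with
  | single h =>
    exact ⟨[e], by simp, by simp [List.Chain'], by simp, by simpa using h⟩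
  | tail h1 h2 ih =>
    rename_i b c
    obtain ⟨p, h1, h3, h4, h5⟩ := ih
    refine ⟨p ++ [b], by simp, ?_, ?_, by simpa using h2⟩
    · simp only [List.Chain'] at *
      rw [List.isChain_append]
      refine ⟨h3, by simp, ?_⟩
      intro x hx y hy
      simp at hy
      subst hy
      exact h5 x hx
    · intro x hx
      apply h4
      rw [List.head?_append_of_ne_nil _ h1] at hx
      exact hx

theorem adj_irrefl {G : MultiDigraph} (hac : G.Acyclic) (e : G.E) :
    ¬ Relation.TransGen (fun f e => G.dst f = G.src e) e e := by
  intro h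
  obtain ⟨p, hp⟩ := path_of_trans h
  exact hac _ _ hp

theorem wf_of_irrefl {α : Type} [Finite α] (r : α → α → Prop)
    (h : ∀ x, ¬ Relation.TransGen r x x) : WellFounded r := by
  have : Std.Irrefl (Relation.TransGen r) := ⟨h⟩
  have := Finite.wellFounded_of_trans_of_irrefl (Relation.TransGen r)
  exact Subrelation.wf (fun h => Relation.TransGen.single h) this

theorem adj_wf {G : MultiDigraph} (hac : G.Acyclic) :
    WellFounded (fun f e : G.E => G.dst f = G.src e) := by
  have := G.fintE
  exact wf_of_irrefl _ (adj_irrefl hac)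

theorem chain_trans {α : Type} {r : α → α → Prop} {p : List α} (h : List.IsChain r p)
    (i d : ℕ) (x y : α) (hx : p[i]? = some x) (hy : p[i + d + 1]? = some y) :
    Relation.TransGen r x y := by
  rw [List.isChain_iff_getElem] at h
  induction d generalizing y with
  | zero =>
    obtain ⟨h1, rfl⟩ := List.getElem?_eq_some_iff.1 hx
    obtain ⟨h2, rfl⟩ := List.getElem?_eq_some_iff.1 hy
    exact .single (h i h2)
  | succ d ih =>
    obtain ⟨h2, rfl⟩ := List.getElem?_eq_some_iff.1 hy
    have := ih p[i+d+1] (List.getElem?_eq_getElem (by omega))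
    exact this.tail (h (i+d+1) h2)

theorem fam_of_menger {G : MultiDigraph} (hac : G.Acyclic) {u v : G.V} {c : ℕ}
    {p : Fin c → List G.E} (h : G.MengerSystem u v c p) : Fam p := by
  intro i j k k' e h1 h2
  have hij : i = j := by
    by_contra hne
    exact h.2 i j hne e (List.mem_of_getElem? h1) (List.mem_of_getElem? h2)
  subst hij
  refine ⟨rfl, ?_⟩
  have hc : List.IsChain _ (p i) := (h.1 i).2.1
  rcases Nat.lt_trichotomy k k' with hlt | rfl | hlt
  · obtain ⟨d, rfl⟩ : ∃ d, k' = k + d + 1 := ⟨k' - k - 1, by omega⟩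
    exact absurd (chain_trans hc _ _ _ _ h1 h2) (adj_irrefl hac _)
  · rfl
  · obtain ⟨d, rfl⟩ : ∃ d, k = k' + d + 1 := ⟨k - k' - 1, by omega⟩
    exact absurd (chain_trans hc _ _ _ _ h2 h1) (adj_irrefl hac _)

theorem chain_to_last {α : Type} {r : α → α → Prop} {p : List α} (h : List.IsChain r p)
    {x l : α} (hx : x ∈ p) (hl : p.getLast? = some l) : Relation.ReflTransGen r x l := by
  obtain ⟨i, hi, rfl⟩ := List.getElem_of_mem hx
  rw [List.getLast?_eq_getElem?] at hl
  rcases Nat.lt_or_ge i (p.length - 1) with hlt | hge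
  · have : p[i + (p.length - 1 - i - 1) + 1]? = some l := by
      rw [← hl]; congr 1; omega
    exact (chain_trans h i _ _ _ (List.getElem?_eq_getElem hi) this).to_reflTransGen
  · have : i = p.length - 1 := by omega
    subst this
    rw [List.getElem?_eq_getElem hi] at hl
    rw [Option.some.inj hl]

theorem Nb.adj {G : MultiDigraph} {u v : G.V} {c : ℕ}
    {p : Fin c → List G.E} (h : G.MengerSystem u v c p) {f e : G.E} (hN : Nb p f e) :
    G.dst f = G.src e := by
  obtain ⟨j, k, h1, h2⟩ := hN
  have hc : List.IsChain _ (p j) := (h.1 j).2.1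
  rw [List.isChain_iff_getElem] at hc
  obtain ⟨h2, rfl⟩ := List.getElem?_eq_some_iff.1 h2
  obtain ⟨h1, rfl⟩ := List.getElem?_eq_some_iff.1 h1
  exact hc _ _

theorem reroute_edge {G : MultiDigraph} (hac : G.Acyclic) {S R : G.V} {n : ℕ}
    {ψ : Fin n → List G.E} (hM : G.MengerSystem S R n ψ) (hNR : G.NonReroutable S R n ψ)
    (H : G.E → G.E → Prop) (X Y : Set G.E)
    (hadj : ∀ f e, H f e → G.dst f = G.src e)
    (hr : ∀ f e e', H f e → H f e' → e = e')
    (hl : ∀ f f' e, H f e → H f' e → f = f')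
    (ha : ∀ e ∈ X, ∃ f, H f e ∧ (f ∈ X ∨ ((∃ j, f ∈ ψ j) ∧ f ∉ Y)))
    (hb : ∀ f e, Nb ψ f e → f ∈ Y → e ∈ Y ∨ e ∈ X)
    (hc : ∀ f e e', e ∈ X → e' ∉ X → e' ∉ Y → H f e → Nb ψ f e' → False)
    (hd : ∀ j l, (ψ j).getLast? = some l → l ∉ Y ∧ ∀ e ∈ X, ¬ H l e)
    (he : ∃ e ∈ X, ∃ f g, f ≠ g ∧ H f e ∧ Nb ψ g e) : False := by
  have hF := fam_of_menger hac hM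
  let T : G.E → G.E → Prop := fun f e => (e ∈ X ∧ H f e) ∨ (e ∉ X ∧ e ∉ Y ∧ Nb ψ f e)
  have hTadj : ∀ f e, T f e → G.dst f = G.src e := by
    rintro f e (⟨_, h⟩ | ⟨_, _, h⟩)
    · exact hadj _ _ h
    · exact h.adj hM
  have hTr : Relator.RightUnique T := by
    rintro f e e' (⟨h0, h⟩ | ⟨h0, h1, h⟩) (⟨k0, k⟩ | ⟨k0, k1, k⟩)
    · exact hr _ _ _ h k
    · exact (hc _ _ _ h0 k0 k1 h k).elim
    · exact (hc _ _ _ k0 h0 h1 k h).elim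
    · exact h.right hF k
  have key : ∀ e, (e ∈ X ∨ ((∃ j, e ∈ ψ j) ∧ e ∉ Y)) → ∃ p : List G.E, p.getLast? = some e ∧
      List.IsChain T p ∧ ∀ x ∈ p.head?, G.src x = S := by
    intro e
    induction e using (adj_wf hac).induction with
    | _ e ih =>
    intro hmem
    have step : (∃ f, T f e ∧ (f ∈ X ∨ ((∃ j, f ∈ ψ j) ∧ f ∉ Y))) ∨ G.src e = S := by
      by_cases hX : e ∈ X
      · obtain ⟨f, h1, h2⟩ := ha e hX
        exact .inl ⟨f, .inl ⟨hX, h1⟩, h2⟩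
      · obtain ⟨⟨j, hj⟩, hY⟩ := hmem.resolve_left hX
        obtain ⟨i, hi, rfl⟩ := List.getElem_of_mem hj
        rcases i with _ | i
        · right
          apply (hM.1 j).2.2.1
          simp [List.head?_eq_getElem?, List.getElem?_eq_getElem hi]
        · left
          have hN : Nb ψ (ψ j)[i] (ψ j)[i+1] :=
            ⟨j, i, List.getElem?_eq_getElem (by omega), List.getElem?_eq_getElem hi⟩
          refine ⟨(ψ j)[i], .inr ⟨hX, hY, hN⟩, .inr ⟨⟨j, List.getElem_mem _⟩, ?_⟩⟩
          intro hfY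
          rcases hb _ _ hN hfY with h | h
          · exact hY h
          · exact hX h
    rcases step with ⟨f, hT, hf⟩ | hS
    · obtain ⟨p, h1, h2, h3⟩ := ih f (hTadj _ _ hT) hf
      refine ⟨p ++ [e], by simp, ?_, ?_⟩
      · rw [List.isChain_append]
        refine ⟨h2, by simp, ?_⟩
        intro x hx y hy
        rw [h1] at hx
        simp at hx hy
        subst hx hy
        exact hT
      · have : p ≠ [] := by rintro rfl; simp at h1
        rw [List.head?_append_of_ne_nil _ this]
        exact h3
    · exact ⟨[e], by simp, by simp, by simpa using hS⟩
  have hlast : ∀ j, ∃ l, (ψ j).getLast? = some l := by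
    intro j
    exact ⟨_, List.getLast?_eq_getLast_of_ne_nil (hM.1 j).1⟩
  choose l hl' using hlast
  have hlinj : ∀ i j, l i = l j → i = j := by
    intro i j h
    by_contra hne
    exact hM.2 i j hne (l i) (List.mem_of_getLast? (hl' i))
      (h ▸ List.mem_of_getLast? (hl' j))
  have hlterm : ∀ j e, ¬ T (l j) e := by
    rintro j e (⟨h0, h⟩ | ⟨h0, h1, h⟩)
    · exact (hd j _ (hl' j)).2 e h0 h
    · obtain ⟨j', k, h1, h2⟩ := h
      have h3 := hl' j
      rw [List.getLast?_eq_getElem?] at h3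
      obtain ⟨rfl, rfl⟩ := hF _ _ _ _ _ h1 h3
      have := (List.getElem?_eq_some_iff.1 h2).1
      omega
  have hβ : ∀ j, ∃ p : List G.E, p.getLast? = some (l j) ∧
      List.IsChain T p ∧ ∀ x ∈ p.head?, G.src x = S := fun j =>
    key _ (.inr ⟨⟨j, List.mem_of_getLast? (hl' j)⟩, (hd j _ (hl' j)).1⟩)
  choose β hβ1 hβ2 hβ3 using hβ
  have hMβ : G.MengerSystem S R n β := by
    refine ⟨fun j => ⟨?_, ?_, hβ3 j, ?_⟩, ?_⟩
    · intro h
      have := hβ1 j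
      rw [h] at this
      simp at this
    · exact (hβ2 j).imp hTadj
    · intro e he
      apply (hM.1 j).2.2.2
      rw [hβ1 j] at he
      rw [hl' j]
      exact he
    · intro i j hne e hi hj
      apply hne
      apply hlinj
      have h1 := chain_to_last (hβ2 i) hi (hβ1 i)
      have h2 := chain_to_last (hβ2 j) hj (hβ1 j)
      rcases Relation.ReflTransGen.total_of_right_unique hTr h1 h2 with h | h
      · rcases h.cases_head with h | ⟨c, h, _⟩
        · exact h
        · exact (hlterm _ _ h).elim
      · rcases h.cases_head with h | ⟨c, h, _⟩
        · exact h.symm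
        · exact (hlterm _ _ h).elim
  have hrange := hNR β hMβ
  obtain ⟨e, heX, f, g, hfg, hHf, hNg⟩ := he
  obtain ⟨b, k, hk1, hk2⟩ := hNg
  obtain ⟨b', hb'⟩ : β b ∈ Set.range ψ := hrange ▸ ⟨b, rfl⟩
  have hbb : b' = b := by
    apply hlinj
    have h1 := hl' b'
    rw [hb', hβ1 b] at h1
    exact (Option.some.inj h1).symm
  subst hbb
  have hch := hβ2 b'
  rw [← hb', List.isChain_iff_getElem] at hch
  obtain ⟨h2, rfl⟩ := List.getElem?_eq_some_iff.1 hk2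
  obtain ⟨h1, rfl⟩ := List.getElem?_eq_some_iff.1 hk1
  rcases hch k h2 with ⟨_, h⟩ | ⟨h, _⟩
  · exact hfg (hl _ _ _ hHf h)
  · exact h heX

structure Sys {E : Type} {m n : ℕ} (φ : Fin m → List E) (ψ : Fin n → List E) {W : Type}
    (a : W → Fin m) (b : W → Fin n) (x y l : W → ℕ) : Prop where
  F1 : Fam φ
  F2 : Fam ψ
  pos : ∀ w, 0 < l w
  sh : ∀ w i, i < l w → ∃ e, (φ (a w))[x w + i]? = some e ∧ (ψ (b w))[y w + i]? = some e
  ext : ∀ w e, (φ (a w))[x w + l w]? = some e → (ψ (b w))[y w + l w]? = some e → False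
  bk : ∀ w i j f, x w = i + 1 → y w = j + 1 → (φ (a w))[i]? = some f →
    (ψ (b w))[j]? = some f → False
  ex : ∀ (a' : Fin m) (b' : Fin n) (i j : ℕ) (e f g : E), (φ a')[i]? = some f →
    (φ a')[i + 1]? = some e →
    (ψ b')[j]? = some g → (ψ b')[j + 1]? = some e → f ≠ g →
    ∃ w, a w = a' ∧ x w = i + 1 ∧ b w = b' ∧ y w = j + 1
  uniq : ∀ w w', a w = a w' → x w = x w' → b w = b w' → y w = y w' → l w = l w' → w = w'

def Nx {W : Type} {c : ℕ} (a : W → Fin c) (x l : W → ℕ) (u w : W) : Prop :=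
  a w = a u ∧ x u + l u ≤ x w ∧ ∀ z, a z = a u → ¬ (x u + l u ≤ x z ∧ x z + l z ≤ x w)

section
variable {E : Type} {m n : ℕ} {φ : Fin m → List E} {ψ : Fin n → List E} {W : Type}
    {a : W → Fin m} {b : W → Fin n} {x y l : W → ℕ}

theorem Sys.swap (h : Sys φ ψ a b x y l) : Sys ψ φ b a y x l where
  F1 := h.F2
  F2 := h.F1
  pos := h.pos
  sh w i hi := by
    obtain ⟨e, h1, h2⟩ := h.sh w i hi
    exact ⟨e, h2, h1⟩
  ext w e h1 h2 := h.ext w e h2 h1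
  bk w i j f h1 h2 h3 h4 := h.bk w j i f h2 h1 h4 h3
  ex a' b' i j e f g h1 h2 h3 h4 h5 := by
    obtain ⟨w, k1, k2, k3, k4⟩ := h.ex b' a' j i e g f h3 h4 h1 h2 h5.symm
    exact ⟨w, k3, k4, k1, k2⟩
  uniq w w' h1 h2 h3 h4 h5 := h.uniq w w' h3 h4 h1 h2 h5

theorem Sys.lt_aux (h : Sys φ ψ a b x y l) {u w : W} (hx : x u = x w) (ha : a u = a w)
    (hb : b u = b w) (hy : y u = y w) (hl : l u < l w) : False := by
  obtain ⟨e, h1, h2⟩ := h.sh w (l u) hl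
  exact h.ext u e (by rw [ha, hx]; exact h1) (by rw [hb, hy]; exact h2)

theorem Sys.disj_aux (h : Sys φ ψ a b x y l) {u w : W} (ha : a u = a w) (h1 : x u ≤ x w)
    (h2 : x w < x u + l u) : u = w := by
  obtain ⟨i, hi⟩ := Nat.exists_eq_add_of_le h1
  obtain ⟨e, h3, h4⟩ := h.sh u i (by omega)
  obtain ⟨e', h5, h6⟩ := h.sh w 0 (h.pos w)
  rw [← ha, Nat.add_zero, hi, h3] at h5
  obtain rfl := Option.some.inj h5
  obtain ⟨hb, hy⟩ := h.F2 _ _ _ _ _ h4 h6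
  rcases i with _ | i
  · rcases Nat.lt_trichotomy (l u) (l w) with hl | hl | hl
    · exact (h.lt_aux (by omega) ha hb (by omega) hl).elim
    · exact h.uniq _ _ ha (by omega) hb (by omega) hl
    · exact (h.lt_aux (by omega) ha.symm hb.symm (by omega) hl).elim
  · obtain ⟨e, h7, h8⟩ := h.sh u i (by omega)
    exact (h.bk w (x u + i) (y u + i) e (by omega) (by omega) (ha ▸ h7) (hb ▸ h8)).elim

theorem Sys.disj (h : Sys φ ψ a b x y l) (u w : W) (ha : a u = a w) :
    u = w ∨ x u + l u ≤ x w ∨ x w + l w ≤ x u := by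
  by_contra! hc
  rcases Nat.le_total (x u) (x w) with h1 | h1
  · exact hc.1 (h.disj_aux ha h1 (by omega))
  · exact hc.1 (h.disj_aux ha.symm h1 (by omega)).symm

theorem Sys.nx_gap (h : Sys φ ψ a b x y l) {u v w : W} (hn : Nx a x l u v) (hw : a w = a u)
    {i : ℕ} (h1 : x u + l u ≤ i) (h2 : i < x v) (h3 : x w ≤ i) (h4 : i < x w + l w) : False := by
  obtain ⟨n1, n2, n3⟩ := hn
  have pu := h.pos u
  have pv := h.pos v
  have pw := h.pos w
  refine n3 w hw ⟨?_, ?_⟩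
  · rcases h.disj u w hw.symm with rfl | h' | h' <;> omega
  · rcases h.disj v w (n1.trans hw.symm) with rfl | h' | h' <;> omega

theorem Sys.gap_notin (h : Sys φ ψ a b x y l)
    (K : ∀ f e, Nb φ f e → (∃ j, e ∈ ψ j) → ∃ g, Nb ψ g e)
    {u v : W} (hn : Nx a x l u v) (i : ℕ) (h1 : x u + l u ≤ i) (h2 : i < x v) (e : E)
    (he : (φ (a u))[i]? = some e) (j : Fin n) : e ∉ ψ j := by
  have pu := h.pos u
  induction i using Nat.strong_induction_on generalizing e j with
  | _ i ih =>
  intro hj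
  obtain ⟨i, rfl⟩ : ∃ k, i = k + 1 := ⟨i - 1, by omega⟩
  have hlt : i + 1 < (φ (a u)).length := (List.getElem?_eq_some_iff.1 he).1
  have hf : (φ (a u))[i]? = some (φ (a u))[i] := List.getElem?_eq_getElem (by omega)
  obtain ⟨g, b', k, g1, g2⟩ := K _ e ⟨a u, i, hf, he⟩ ⟨j, hj⟩
  by_cases hfg : (φ (a u))[i] = g
  · subst hfg
    by_cases hi : x u + l u ≤ i
    · exact ih i (by omega) hi (by omega) _ hf b' (List.mem_of_getElem? g1)
    · obtain ⟨e', h3, h4⟩ := h.sh u (l u - 1) (by omega)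
      have : x u + (l u - 1) = i := by omega
      rw [this, hf] at h3
      rw [← Option.some.inj h3] at h4
      obtain ⟨rfl, hk⟩ := h.F2 _ _ _ _ _ h4 g1
      refine h.ext u e ?_ ?_
      · rw [← he]; congr 1; omega
      · rw [← g2]; congr 1; omega
  · obtain ⟨w, w1, w2, w3, w4⟩ := h.ex _ _ _ _ _ _ _ hf he g1 g2 hfg
    have pw := h.pos w
    exact h.nx_gap hn w1 h1 h2 (by omega) (by omega)

theorem Sys.nx_left (h : Sys φ ψ a b x y l) {u u' w : W} (h1 : Nx a x l u w)
    (h2 : Nx a x l u' w) : u = u' := by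
  have haa : a u = a u' := h1.1.symm.trans h2.1
  rcases h.disj u u' haa with h3 | h3 | h3
  · exact h3
  · exact (h1.2.2 u' haa.symm ⟨h3, h2.2.1⟩).elim
  · exact (h2.2.2 u haa ⟨h3, h1.2.1⟩).elim

theorem Sys.nx_right (h : Sys φ ψ a b x y l) {u w w' : W} (h1 : Nx a x l u w)
    (h2 : Nx a x l u w') : w = w' := by
  have haa : a w = a w' := h1.1.trans h2.1.symm
  rcases h.disj w w' haa with h3 | h3 | h3
  · exact h3
  · exact (h2.2.2 w h1.1 ⟨h1.2.1, h3⟩).elim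
  · exact (h1.2.2 w' h2.1 ⟨h2.2.1, h3⟩).elim

theorem Sys.nx_exists [Finite W] (h : Sys φ ψ a b x y l) {u w : W} (h1 : a u = a w)
    (h2 : x u + l u ≤ x w) : ∃ u', Nx a x l u' w := by
  obtain ⟨v, hv, hmax⟩ := Set.exists_max_image {z | a z = a w ∧ x z + l z ≤ x w} x
    (Set.toFinite _) ⟨u, h1, h2⟩
  refine ⟨v, hv.1.symm, hv.2, ?_⟩
  rintro z hz ⟨z1, z2⟩
  have := hmax z ⟨hz.trans hv.1, z2⟩
  have := h.pos v
  omega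

end

theorem no_cycle {G : MultiDigraph} (hac : G.Acyclic) {S R S' R' : G.V} {m n : ℕ}
    {φ : Fin m → List G.E} {ψ : Fin n → List G.E}
    (hMφ : G.MengerSystem S' R' m φ)
    (hM : G.MengerSystem S R n ψ) (hNR : G.NonReroutable S R n ψ)
    {W : Type} {a : W → Fin m} {b : W → Fin n} {x y l : W → ℕ}
    (h : Sys φ ψ a b x y l)
    (K : ∀ f e, Nb φ f e → (∃ j, e ∈ ψ j) → ∃ g, Nb ψ g e)
    (Cu Cv : Set W)
    (h1 : ∀ u ∈ Cu, ∃ v ∈ Cv, Nx a x l u v) (h2 : ∀ v ∈ Cv, ∃ u ∈ Cu, Nx a x l u v)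
    (h3 : ∀ u ∈ Cu, ∃ v ∈ Cv, Nx b y l u v) (h4 : ∀ v ∈ Cv, ∃ u ∈ Cu, Nx b y l u v)
    (hne : Cv.Nonempty) : False := by
  let X : Set G.E := {e | ∃ u ∈ Cu, ∃ v ∈ Cv, Nx a x l u v ∧ ∃ i, x u + l u ≤ i ∧ i ≤ x v ∧
    (φ (a u))[i]? = some e}
  let Y : Set G.E := {e | ∃ u ∈ Cu, ∃ v ∈ Cv, Nx b y l u v ∧ ∃ i, y u + l u ≤ i ∧ i < y v ∧
    (ψ (b u))[i]? = some e}
  -- heads of `Cv` are in `X`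
  have hhead : ∀ v ∈ Cv, ∀ e, (ψ (b v))[y v]? = some e → e ∈ X := by
    intro v hv e he
    obtain ⟨u, hu, hn⟩ := h2 v hv
    refine ⟨u, hu, v, hv, hn, x v, hn.2.1, le_rfl, ?_⟩
    obtain ⟨e', k1, k2⟩ := h.sh v 0 (h.pos v)
    rw [Nat.add_zero] at k1 k2
    rw [he] at k2
    rw [← hn.1, k1, k2]
  -- predecessors of X
  have hpred : ∀ e ∈ X, ∃ f, Nb φ f e ∧ ((f ∈ X ∧ ∀ j, f ∉ ψ j) ∨
      ∃ u ∈ Cu, (ψ (b u))[y u + (l u - 1)]? = some f) := by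
    rintro e ⟨u, hu, v, hv, hn, i, i1, i2, he⟩
    have pu := h.pos u
    obtain ⟨i, rfl⟩ : ∃ k, i = k + 1 := ⟨i - 1, by omega⟩
    have hlt : i + 1 < (φ (a u)).length := (List.getElem?_eq_some_iff.1 he).1
    have hf : (φ (a u))[i]? = some (φ (a u))[i] := List.getElem?_eq_getElem (by omega)
    refine ⟨(φ (a u))[i], ⟨a u, i, hf, he⟩, ?_⟩
    by_cases hi : x u + l u ≤ i
    · exact .inl ⟨⟨u, hu, v, hv, hn, i, hi, by omega, hf⟩,
        h.gap_notin K hn i hi (by omega) _ hf⟩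
    · right
      refine ⟨u, hu, ?_⟩
      obtain ⟨e', k1, k2⟩ := h.sh u (l u - 1) (by omega)
      have : x u + (l u - 1) = i := by omega
      rw [this, hf] at k1
      rw [k2, k1]
  have hpred' : ∀ e ∈ X, ∀ f j, Nb φ f e → f ∈ ψ j →
      ∃ u ∈ Cu, (ψ (b u))[y u + (l u - 1)]? = some f := by
    intro e he f j hN hj
    obtain ⟨f', k1, k2⟩ := hpred e he
    obtain rfl := k1.left h.F1 hN
    rcases k2 with k2 | k2
    · exact (k2.2 _ hj).elim
    · exact k2
  refine reroute_edge hac hM hNR (Nb φ) X Y (fun f e hN => hN.adj hMφ)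
    (fun f e e' k1 k2 => k1.right h.F1 k2) (fun f e e' k1 k2 => k1.left h.F1 k2) ?_ ?_ ?_ ?_ ?_
  · intro e he
    obtain ⟨f, k1, k2⟩ := hpred e he
    refine ⟨f, k1, ?_⟩
    rcases k2 with k2 | ⟨u, hu, k2⟩
    · exact .inl k2.1
    · refine .inr ⟨⟨_, List.mem_of_getElem? k2⟩, ?_⟩
      rintro ⟨u', hu', v', hv', hn, i, i1, i2, k3⟩
      obtain ⟨hb, hi⟩ := h.F2 _ _ _ _ _ k2 k3
      have pu := h.pos u
      exact h.swap.nx_gap hn hb i1 i2 (by omega) (by omega)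
  · rintro f e ⟨j, k, k1, k2⟩ ⟨u', hu', v', hv', hn, i, i1, i2, k3⟩
    obtain ⟨rfl, rfl⟩ := h.F2 _ _ _ _ _ k1 k3
    rcases Nat.lt_or_ge (k + 1) (y v') with hlt | hge
    · exact .inl ⟨u', hu', v', hv', hn, k + 1, by omega, hlt, k2⟩
    · right
      refine hhead v' hv' e ?_
      rw [hn.1, ← k2]; congr 1; omega
  · intro f e e' he hX hY hN hN'
    obtain ⟨j, k, k1, k2⟩ := hN'
    obtain ⟨u, hu, k3⟩ := hpred' e he f j hN (List.mem_of_getElem? k1)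
    obtain ⟨rfl, rfl⟩ := h.F2 _ _ _ _ _ k1 k3
    obtain ⟨v, hv, hn⟩ := h3 u hu
    have pu := h.pos u
    have n2 := hn.2.1
    rcases Nat.lt_or_ge (y u + l u) (y v) with hlt | hge
    · refine hY ⟨u, hu, v, hv, hn, y u + (l u - 1) + 1, by omega, by omega, k2⟩
    · refine hX (hhead v hv e' ?_)
      rw [hn.1, ← k2]; congr 1; omega
  · intro j r hr
    rw [List.getLast?_eq_getElem?] at hr
    have key : ∀ u v, Nx b y l u v → b u = j → y v < (ψ j).length := by
      intro u v hn hbu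
      obtain ⟨e', k1, k2⟩ := h.sh v 0 (h.pos v)
      rw [Nat.add_zero] at k2
      rw [← hbu, ← hn.1]
      exact (List.getElem?_eq_some_iff.1 k2).1
    constructor
    · rintro ⟨u', hu', v', hv', hn, i, i1, i2, k3⟩
      obtain ⟨hb, hi⟩ := h.F2 _ _ _ _ _ k3 hr
      have := key _ _ hn hb
      omega
    · intro e he hN
      obtain ⟨u, hu, k3⟩ := hpred' e he r j hN (List.mem_of_getElem? hr)
      obtain ⟨v, hv, hn⟩ := h3 u hu
      obtain ⟨hb, hi⟩ := h.F2 _ _ _ _ _ k3 hr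
      have := key _ _ hn hb
      have := hn.2.1
      have pu := h.pos u
      omega
  · obtain ⟨v, hv⟩ := hne
    obtain ⟨e, k1, k2⟩ := h.sh v 0 (h.pos v)
    rw [Nat.add_zero] at k1 k2
    refine ⟨e, hhead v hv e k2, ?_⟩
    obtain ⟨u, hu, hn⟩ := h2 v hv
    obtain ⟨u', hu', hn'⟩ := h4 v hv
    have q1 := h.pos u
    have q2 := h.pos u'
    have q3 := hn.2.1
    have q4 := hn'.2.1
    obtain ⟨i, hi⟩ : ∃ i, x v = i + 1 := ⟨x v - 1, by omega⟩
    obtain ⟨j, hj⟩ : ∃ i, y v = i + 1 := ⟨y v - 1, by omega⟩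
    rw [hi] at k1
    rw [hj] at k2
    have r1 := (List.getElem?_eq_some_iff.1 k1).1
    have r2 := (List.getElem?_eq_some_iff.1 k2).1
    have s1 : (φ (a v))[i]? = some (φ (a v))[i] := List.getElem?_eq_getElem (by omega)
    have s2 : (ψ (b v))[j]? = some (ψ (b v))[j] := List.getElem?_eq_getElem (by omega)
    refine ⟨(φ (a v))[i], (ψ (b v))[j], ?_, ⟨_, _, s1, k1⟩, ⟨_, _, s2, k2⟩⟩
    intro heq
    rw [← heq] at s2
    exact h.bk v i j _ hi hj s1 s2

/-- counting lemma -/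
theorem count_chains {σ ι : Type} [Fintype σ] [Fintype ι] (r : σ → σ → Prop)
    (hl : ∀ x y z, r x z → r y z → x = y) (hr : ∀ x y z, r x y → r x z → y = z)
    (hwf : WellFounded r) (L : ι → List σ)
    (hch : ∀ i, List.IsChain r (L i))
    (hhd : ∀ i, ∀ s ∈ (L i).head?, ∀ t, ¬ r t s)
    (hinj : ∀ i j, ∀ s ∈ (L i).head?, s ∈ (L j).head? → i = j)
    (hlast : ∀ i, ∀ s ∈ (L i).getLast?, ∀ t, ¬ r s t)
    (hcov : ∀ s, (∀ t, ¬ r t s) → ∃ i, s ∈ (L i).head?) :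
    ∑ i, (L i).length = Fintype.card σ := by
  let f : (Σ i, Fin (L i).length) → σ := fun q => (L q.1)[q.2]
  have hf : Function.Bijective f := by
    constructor
    · have aux : ∀ k k' i j, k ≤ k' → ∀ (h1 : k < (L i).length) (h2 : k' < (L j).length),
          (L i)[k] = (L j)[k'] → i = j ∧ k = k' := by
        intro k
        induction k with
        | zero =>
          intro k' i j _ h1 h2 he
          rcases k' with _ | k'
          · refine ⟨hinj i j (L i)[0] ?_ ?_, rfl⟩
            · simp [List.head?_eq_getElem?, List.getElem?_eq_getElem h1]
            · simp [List.head?_eq_getElem?, List.getElem?_eq_getElem h2, he]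
          · have := (List.isChain_iff_getElem.1 (hch j)) k' h2
            rw [← he] at this
            refine (hhd i _ ?_ _ this).elim
            simp [List.head?_eq_getElem?, List.getElem?_eq_getElem h1]
        | succ k ih =>
          intro k' i j hle h1 h2 he
          obtain ⟨k', rfl⟩ : ∃ q, k' = q + 1 := ⟨k' - 1, by omega⟩
          have t1 := (List.isChain_iff_getElem.1 (hch i)) k h1
          have t2 := (List.isChain_iff_getElem.1 (hch j)) k' h2
          rw [← he] at t2
          have := ih k' i j (by omega) (by omega) (by omega) (hl _ _ _ t1 t2)
          exact ⟨this.1, by omega⟩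
      rintro ⟨i, k, hk⟩ ⟨j, k', hk'⟩ he
      simp only [f, Fin.getElem_fin] at he
      rcases Nat.le_total k k' with hle | hle
      · obtain ⟨rfl, rfl⟩ := aux k k' i j hle hk hk' he
        rfl
      · obtain ⟨rfl, rfl⟩ := aux k' k j i hle hk' hk he.symm
        rfl
    · intro s
      induction s using hwf.induction with
      | _ s ih =>
      by_cases hs : ∀ t, ¬ r t s
      · obtain ⟨i, hi⟩ := hcov s hs
        rw [List.head?_eq_getElem?] at hi
        obtain ⟨h1, h2⟩ := List.getElem?_eq_some_iff.1 hi
        exact ⟨⟨i, 0, h1⟩, h2⟩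
      · push Not at hs
        obtain ⟨t, ht⟩ := hs
        obtain ⟨⟨i, k, hk⟩, he⟩ := ih t ht
        simp only [f, Fin.getElem_fin] at he
        by_cases hk1 : k + 1 < (L i).length
        · have := (List.isChain_iff_getElem.1 (hch i)) k hk1
          rw [he] at this
          exact ⟨⟨i, k + 1, hk1⟩, hr _ _ _ this ht⟩
        · refine (hlast i t ?_ s ht).elim
          have : (L i).length - 1 = k := by omega
          rw [List.getLast?_eq_getElem?, this, List.getElem?_eq_getElem hk, he]
          rfl
  rw [← Fintype.card_of_bijective hf]
  simp

def St {W : Type} {m n : ℕ} (a : W → Fin m) (b : W → Fin n) (x y l : W → ℕ)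
    (s t : Bool × W) : Prop :=
  (s.1 = false ∧ t.1 = true ∧ Nx a x l s.2 t.2) ∨ (s.1 = true ∧ t.1 = false ∧ Nx b y l t.2 s.2)

theorem head_of_mem {G : MultiDigraph} {S R : G.V} {m : ℕ}
    {φ : Fin m → List G.E} (hM : G.MengerSystem S R m φ) {i : Fin m} {f : G.E} (hf : f ∈ φ i) :
    ∃ h, G.src h = S ∧ Relation.ReflTransGen (fun f e => G.dst f = G.src e) h f := by
  obtain ⟨k, hk, rfl⟩ := List.getElem_of_mem hf
  have h0 : (φ i)[0]? = some (φ i)[0] := List.getElem?_eq_getElem (by omega)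
  refine ⟨(φ i)[0], ?_, ?_⟩
  · apply (hM.1 i).2.2.1
    rw [List.head?_eq_getElem?, h0]
    rfl
  · rcases k with _ | k
    · exact .refl
    · have hc : List.IsChain _ (φ i) := (hM.1 i).2.1
      refine (chain_trans hc 0 k _ _ h0 ?_).to_reflTransGen
      rw [Nat.zero_add]
      exact List.getElem?_eq_getElem hk

theorem src_of_nopred {G : MultiDigraph} {S R : G.V} {m : ℕ}
    {φ : Fin m → List G.E} (hM : G.MengerSystem S R m φ) {e : G.E} (he : ∃ i, e ∈ φ i)
    (hn : ¬ ∃ g, Nb φ g e) : G.src e = S := by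
  obtain ⟨i, hi⟩ := he
  obtain ⟨k, hk, rfl⟩ := List.getElem_of_mem hi
  rcases k with _ | k
  · apply (hM.1 i).2.2.1
    rw [List.head?_eq_getElem?, List.getElem?_eq_getElem hk]
    rfl
  · exact (hn ⟨(φ i)[k], i, k, List.getElem?_eq_getElem (by omega),
      List.getElem?_eq_getElem hk⟩).elim

theorem K_or {G : MultiDigraph} (hac : G.Acyclic) {S1 R1 S2 R2 : G.V} {m n : ℕ}
    {φ : Fin m → List G.E} {ψ : Fin n → List G.E}
    (h1 : G.MengerSystem S1 R1 m φ) (h2 : G.MengerSystem S2 R2 n ψ) :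
    (∀ f e, Nb φ f e → (∃ j, e ∈ ψ j) → ∃ g, Nb ψ g e) ∨
    (∀ f e, Nb ψ f e → (∃ j, e ∈ φ j) → ∃ g, Nb φ g e) := by
  by_contra hc
  rw [not_or] at hc
  obtain ⟨c1, c2⟩ := hc
  push Not at c1 c2
  obtain ⟨f, e, n1, m1, k1⟩ := c1
  obtain ⟨f', e', n2, m2, k2⟩ := c2
  have s1 := src_of_nopred h2 m1 (by push Not; exact k1)
  have s2 := src_of_nopred h1 m2 (by push Not; exact k2)
  have d1 := n1.adj h1
  have d2 := n2.adj h2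
  obtain ⟨i, k, i1, -⟩ := n1
  obtain ⟨i', k', i2, -⟩ := n2
  obtain ⟨h, t1, t2⟩ := head_of_mem h1 (List.mem_of_getElem? i1)
  obtain ⟨h', t3, t4⟩ := head_of_mem h2 (List.mem_of_getElem? i2)
  have u1 : Relation.TransGen (fun f e => G.dst f = G.src e) f' f :=
    Relation.TransGen.head' (by rw [d2, s2, t1]) t2
  have u2 : Relation.TransGen (fun f e => G.dst f = G.src e) f f' :=
    Relation.TransGen.head' (by rw [d1, s1, t3]) t4
  exact adj_irrefl hac _ (u1.trans u2)

theorem st_wf {G : MultiDigraph} (hac : G.Acyclic) {S1 R1 S2 R2 : G.V} {m n : ℕ}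
    {φ : Fin m → List G.E} {ψ : Fin n → List G.E}
    (h1 : G.MengerSystem S1 R1 m φ) (h2 : G.MengerSystem S2 R2 n ψ)
    (hN1 : G.NonReroutable S1 R1 m φ) (hN2 : G.NonReroutable S2 R2 n ψ)
    {W : Type} [Finite W] {a : W → Fin m} {b : W → Fin n} {x y l : W → ℕ}
    (h : Sys φ ψ a b x y l) : WellFounded (St a b x y l) := by
  apply wf_of_irrefl
  intro s0 hs0
  let r := St a b x y l
  let C : Set (Bool × W) := {t | Relation.TransGen r t t}
  have hsucc : ∀ t ∈ C, ∃ t' ∈ C, r t t' := by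
    intro t ht
    obtain ⟨t', k1, k2⟩ := Relation.TransGen.head'_iff.1 (show Relation.TransGen r t t from ht)
    exact ⟨t', Relation.TransGen.tail' k2 k1, k1⟩
  have hpred : ∀ t ∈ C, ∃ t' ∈ C, r t' t := by
    intro t ht
    obtain ⟨t', k1, k2⟩ := Relation.TransGen.tail'_iff.1 (show Relation.TransGen r t t from ht)
    exact ⟨t', Relation.TransGen.head' k2 k1, k2⟩
  let Cu : Set W := {u | (false, u) ∈ C}
  let Cv : Set W := {u | (true, u) ∈ C}
  have q1 : ∀ u ∈ Cu, ∃ v ∈ Cv, Nx a x l u v := by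
    intro u hu
    obtain ⟨⟨d, v⟩, hv, hr⟩ := hsucc _ hu
    rcases hr with ⟨_, e1, hr⟩ | ⟨e1, _⟩
    · simp only at e1
      subst e1
      exact ⟨v, hv, hr⟩
    · simp at e1
  have q4 : ∀ u ∈ Cv, ∃ v ∈ Cu, Nx b y l v u := by
    intro u hu
    obtain ⟨⟨d, v⟩, hv, hr⟩ := hsucc _ hu
    rcases hr with ⟨e1, _⟩ | ⟨_, e1, hr⟩
    · simp at e1
    · simp only at e1
      subst e1
      exact ⟨v, hv, hr⟩
  have q2 : ∀ u ∈ Cv, ∃ v ∈ Cu, Nx a x l v u := by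
    intro u hu
    obtain ⟨⟨d, v⟩, hv, hr⟩ := hpred _ hu
    rcases hr with ⟨e1, _, hr⟩ | ⟨_, e1, _⟩
    · simp only at e1
      subst e1
      exact ⟨v, hv, hr⟩
    · simp at e1
  have q3 : ∀ u ∈ Cu, ∃ v ∈ Cv, Nx b y l u v := by
    intro u hu
    obtain ⟨⟨d, v⟩, hv, hr⟩ := hpred _ hu
    rcases hr with ⟨_, e1, _⟩ | ⟨e1, _, hr⟩
    · simp at e1
    · simp only at e1
      subst e1
      exact ⟨v, hv, hr⟩
  have hne : Cv.Nonempty := by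
    rcases s0 with ⟨d, w⟩
    cases d
    · obtain ⟨v, hv, _⟩ := q1 w hs0
      exact ⟨v, hv⟩
    · exact ⟨w, hs0⟩
  rcases K_or hac h1 h2 with K | K
  · exact no_cycle hac h1 h2 hN2 h K Cu Cv q1 q2 q3 q4 hne
  · exact no_cycle hac h2 h1 hN1 h.swap K Cu Cv q3 q4 q1 q2 hne

section
variable {G : MultiDigraph} {m n : ℕ} {φ : Fin m → List G.E} {ψ : Fin n → List G.E}
  {P : Visit G m n → Prop} {x y : {v // P v} → ℕ}

theorem chain_states
    (hO1 : ∀ u w : {v // P v}, w.1.1 = u.1.1 →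
      (OrderedOn (φ u.1.1) u.1.2.2 w.1.2.2 ↔ x u + u.1.2.2.length ≤ x w))
    (hO2 : ∀ u w : {v // P v}, w.1.2.1 = u.1.2.1 →
      (OrderedOn (ψ u.1.2.1) u.1.2.2 w.1.2.2 ↔ y u + u.1.2.2.length ≤ y w))
    {d : Bool} {v : Visit G m n} {L : List (Visit G m n)} (hc : AAChain φ ψ P d v L)
    (hv : P v) : ∃ Ls : List (Bool × {v // P v}), Ls.length = L.length + 1 ∧
      Ls.head? = some (d, ⟨v, hv⟩) ∧
      List.IsChain (St (fun w : {v // P v} => w.1.1) (fun w => w.1.2.1) x y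
        (fun w => w.1.2.2.length)) Ls ∧
      ∀ s ∈ Ls.getLast?, ∀ t, ¬ St (fun w : {v // P v} => w.1.1) (fun w => w.1.2.1) x y
        (fun w => w.1.2.2.length) s t := by
  induction hc with
  | stopAgainst v hs =>
    refine ⟨[(true, ⟨v, hv⟩)], rfl, rfl, by simp, ?_⟩
    rintro s hs' ⟨d, u⟩ hst
    simp at hs'
    subst hs'
    rcases hst with ⟨e1, _⟩ | ⟨_, e1, hn⟩
    · simp at e1
    · refine hs u.1 u.2 hn.1.symm ?_
      have := (hO2 u ⟨v, hv⟩ hn.1).2 hn.2.1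
      have e : u.1.2.1 = v.2.1 := hn.1.symm
      rw [← e]
      exact this
  | stopAlong v hs =>
    refine ⟨[(false, ⟨v, hv⟩)], rfl, rfl, by simp, ?_⟩
    rintro s hs' ⟨d, u⟩ hst
    simp at hs'
    subst hs'
    rcases hst with ⟨_, e1, hn⟩ | ⟨e1, _⟩
    · refine hs u.1 u.2 hn.1 ?_
      exact (hO1 ⟨v, hv⟩ u hn.1).2 hn.2.1
    · simp at e1
  | consAgainst v w rest hs _ ih =>
    obtain ⟨s1, s2, s3, s4⟩ := hs
    obtain ⟨Ls, k1, k2, k3, k4⟩ := ih s2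
    refine ⟨(true, ⟨v, hv⟩) :: Ls, by simp [k1], rfl, ?_, ?_⟩
    · rw [List.isChain_cons]
      refine ⟨?_, k3⟩
      intro t ht
      rw [k2] at ht
      simp at ht
      subst ht
      right
      refine ⟨rfl, rfl, s1.symm, ?_, ?_⟩
      · rw [← s1] at s3
        exact (hO2 ⟨w, s2⟩ ⟨v, hv⟩ s1.symm).1 s3
      · rintro z hz ⟨z1, z2⟩
        have hz : z.1.2.1 = w.2.1 := hz
        have hz' : z.1.2.1 = v.2.1 := hz.trans s1
        refine s4 z.1 z.2 hz' ⟨?_, ?_⟩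
        · rw [← s1]
          exact (hO2 ⟨w, s2⟩ z hz).2 z1
        · rw [← hz']
          exact (hO2 z ⟨v, hv⟩ hz'.symm).2 z2
    · have : Ls ≠ [] := by rintro rfl; simp at k1
      rw [List.getLast?_cons_of_ne_nil this]
      exact k4
  | consAlong v w rest hs _ ih =>
    obtain ⟨s1, s2, s3, s4⟩ := hs
    obtain ⟨Ls, k1, k2, k3, k4⟩ := ih s2
    refine ⟨(false, ⟨v, hv⟩) :: Ls, by simp [k1], rfl, ?_, ?_⟩
    · rw [List.isChain_cons]
      refine ⟨?_, k3⟩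
      intro t ht
      rw [k2] at ht
      simp at ht
      subst ht
      left
      refine ⟨rfl, rfl, s1, ?_, ?_⟩
      · exact (hO1 ⟨v, hv⟩ ⟨w, s2⟩ s1).1 s3
      · rintro z hz ⟨z1, z2⟩
        have hz : z.1.1 = v.1 := hz
        refine s4 z.1 z.2 hz ⟨?_, ?_⟩
        · exact (hO1 ⟨v, hv⟩ z hz).2 z1
        · rw [← hz]
          exact (hO1 z ⟨w, s2⟩ (s1.trans hz.symm)).2 z2
    · have : Ls ≠ [] := by rintro rfl; simp at k1
      rw [List.getLast?_cons_of_ne_nil this]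
      exact k4

theorem Sys.finite {E : Type} {m n : ℕ} {φ : Fin m → List E} {ψ : Fin n → List E} {W : Type}
    {a : W → Fin m} {b : W → Fin n} {x y l : W → ℕ} (h : Sys φ ψ a b x y l) : Finite W := by
  have hx : ∀ w, x w < (φ (a w)).length := by
    intro w
    obtain ⟨e, k1, k2⟩ := h.sh w 0 (h.pos w)
    exact (List.getElem?_eq_some_iff.1 k1).1
  refine Finite.of_injective
    (fun w => (⟨a w, ⟨x w, hx w⟩⟩ : Σ i, Fin (φ i).length)) ?_
  intro u w he
  have h1 : a u = a w := congrArg (fun q => q.1) he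
  have h2 : x u = x w := congrArg (fun q => q.2.1) he
  have := h.pos u
  exact h.disj_aux h1 h2.le (by omega)

theorem gen
    (hsys : Sys φ ψ (fun w : {v // P v} => w.1.1) (fun w => w.1.2.1) x y
        (fun w => w.1.2.2.length))
    (hO1 : ∀ u w : {v // P v}, w.1.1 = u.1.1 →
      (OrderedOn (φ u.1.1) u.1.2.2 w.1.2.2 ↔ x u + u.1.2.2.length ≤ x w))
    (hO2 : ∀ u w : {v // P v}, w.1.2.1 = u.1.2.1 →
      (OrderedOn (ψ u.1.2.1) u.1.2.2 w.1.2.2 ↔ y u + u.1.2.2.length ≤ y w))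
    (hwf : WellFounded (St (fun w : {v // P v} => w.1.1) (fun w => w.1.2.1) x y
        (fun w => w.1.2.2.length)))
    (A : Fin m → List (Visit G m n)) (B : Fin n → List (Visit G m n))
    (hA : ∀ i, IsPhiAA φ ψ P i (A i)) (hB : ∀ j, IsPsiAA φ ψ P j (B j)) :
    (∑ i, (A i).length) + ∑ j, (B j).length = 2 * Nat.card {v // P v} := by
  have := hsys.finite
  have := Fintype.ofFinite {v // P v}
  let r := St (fun w : {v // P v} => w.1.1) (fun w => w.1.2.1) x y (fun w => w.1.2.2.length)
  have hA' : ∀ i, ∃ Ls : List (Bool × {v // P v}), Ls.length = (A i).length ∧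
      ((Ls = [] ∧ ∀ w : {v // P v}, w.1.1 ≠ i) ∨ ∃ w : {v // P v}, Ls.head? = some (true, w) ∧
        w.1.1 = i ∧ ∀ u : {v // P v}, u.1.1 = i → ¬ (x u + u.1.2.2.length ≤ x w)) ∧
      List.IsChain r Ls ∧ ∀ s ∈ Ls.getLast?, ∀ t, ¬ r s t := by
    intro i
    rcases hA i with ⟨h1, h2⟩ | ⟨v, rest, h1, h2, h3, h4, h5⟩
    · exact ⟨[], by simp [h1], .inl ⟨rfl, fun w => h2 w.1 w.2⟩, by simp, by simp⟩
    · obtain ⟨Ls, k1, k2, k3, k4⟩ := chain_states hO1 hO2 h5 h3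
      refine ⟨Ls, by simp [k1, h1], .inr ⟨⟨v, h3⟩, k2, h2, ?_⟩, k3, k4⟩
      intro u hu hle
      refine h4 u.1 u.2 hu ?_
      rw [← hu]
      exact (hO1 u ⟨v, h3⟩ (h2.trans hu.symm)).2 hle
  have hB' : ∀ i, ∃ Ls : List (Bool × {v // P v}), Ls.length = (B i).length ∧
      ((Ls = [] ∧ ∀ w : {v // P v}, w.1.2.1 ≠ i) ∨ ∃ w : {v // P v}, Ls.head? = some (false, w) ∧
        w.1.2.1 = i ∧ ∀ u : {v // P v}, u.1.2.1 = i → ¬ (y w + w.1.2.2.length ≤ y u)) ∧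
      List.IsChain r Ls ∧ ∀ s ∈ Ls.getLast?, ∀ t, ¬ r s t := by
    intro i
    rcases hB i with ⟨h1, h2⟩ | ⟨v, rest, h1, h2, h3, h4, h5⟩
    · exact ⟨[], by simp [h1], .inl ⟨rfl, fun w => h2 w.1 w.2⟩, by simp, by simp⟩
    · obtain ⟨Ls, k1, k2, k3, k4⟩ := chain_states hO1 hO2 h5 h3
      refine ⟨Ls, by simp [k1, h1], .inr ⟨⟨v, h3⟩, k2, h2, ?_⟩, k3, k4⟩
      intro u hu hle
      refine h4 u.1 u.2 hu ?_
      rw [← h2]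
      exact (hO2 ⟨v, h3⟩ u (hu.trans h2.symm)).2 hle
  choose LA a1 a2 a3 a4 using hA'
  choose LB b1 b2 b3 b4 using hB'
  have hcount := count_chains (σ := Bool × {v // P v}) (ι := Fin m ⊕ Fin n) r ?_ ?_ hwf
    (Sum.elim LA LB) ?_ ?_ ?_ ?_ ?_
  · rw [Fintype.sum_sum_type] at hcount
    simp only [Sum.elim_inl, Sum.elim_inr, a1, b1, Fintype.card_prod, Fintype.card_bool] at hcount
    rw [hcount, Nat.card_eq_fintype_card]
  · rintro ⟨d1, s1⟩ ⟨d2, s2⟩ ⟨d3, s3⟩ (⟨e1, e2, e3⟩ | ⟨e1, e2, e3⟩) (⟨f1, f2, f3⟩ | ⟨f1, f2, f3⟩)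
      <;> simp only at e1 e2 e3 f1 f2 f3 <;> subst e1 e2 f1
    · rw [hsys.nx_left e3 f3]
    · simp at f2
    · simp at f2
    · rw [hsys.swap.nx_right e3 f3]
  · rintro ⟨d1, s1⟩ ⟨d2, s2⟩ ⟨d3, s3⟩ (⟨e1, e2, e3⟩ | ⟨e1, e2, e3⟩) (⟨f1, f2, f3⟩ | ⟨f1, f2, f3⟩)
      <;> simp only at e1 e2 e3 f1 f2 f3 <;> subst e1 e2 f2
    · rw [hsys.nx_right e3 f3]
    · simp at f1
    · simp at f1
    · rw [hsys.swap.nx_left e3 f3]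
  · rintro (i | i)
    · exact a3 i
    · exact b3 i
  · rintro (i | i) s hs t hr
    · simp only [Sum.elim_inl] at hs
      rcases a2 i with ⟨h1, _⟩ | ⟨w, h1, h2, h3⟩
      · simp [h1] at hs
      · rw [h1] at hs
        simp at hs
        subst hs
        rcases hr with ⟨e1, e2, e3⟩ | ⟨e1, e2, e3⟩
        · exact h3 t.2 (e3.1.symm.trans h2) e3.2.1
        · simp at e2
    · simp only [Sum.elim_inr] at hs
      rcases b2 i with ⟨h1, _⟩ | ⟨w, h1, h2, h3⟩
      · simp [h1] at hs
      · rw [h1] at hs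
        simp at hs
        subst hs
        rcases hr with ⟨e1, e2, e3⟩ | ⟨e1, e2, e3⟩
        · simp at e2
        · exact h3 t.2 (e3.1.trans h2) e3.2.1
  · have A2 : ∀ i s, s ∈ (LA i).head? → s.1 = true ∧ s.2.1.1 = i := by
      intro i s hs
      rcases a2 i with ⟨h1, _⟩ | ⟨w, h1, h2, h3⟩
      · simp [h1] at hs
      · rw [h1] at hs
        simp at hs
        subst hs
        exact ⟨rfl, h2⟩
    have B2 : ∀ i s, s ∈ (LB i).head? → s.1 = false ∧ s.2.1.2.1 = i := by
      intro i s hs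
      rcases b2 i with ⟨h1, _⟩ | ⟨w, h1, h2, h3⟩
      · simp [h1] at hs
      · rw [h1] at hs
        simp at hs
        subst hs
        exact ⟨rfl, h2⟩
    rintro (i | i) (j | j) s hs ht
    · rw [← (A2 i s hs).2, ← (A2 j s ht).2]
    · have h1 := (A2 i s hs).1
      have h2 := (B2 j s ht).1
      simp [h1] at h2
    · have h1 := (B2 i s hs).1
      have h2 := (A2 j s ht).1
      simp [h1] at h2
    · rw [← (B2 i s hs).2, ← (B2 j s ht).2]
  · rintro (i | i)
    · exact a4 i
    · exact b4 i
  · rintro ⟨d, v⟩ hs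
    cases d
    · refine ⟨.inr v.1.2.1, ?_⟩
      rcases b2 v.1.2.1 with ⟨_, h1⟩ | ⟨w, h1, h2, h3⟩
      · exact (h1 v rfl).elim
      · simp only [Sum.elim_inr, h1]
        rcases hsys.swap.disj w v h2 with rfl | h4 | h4
        · rfl
        · exact (h3 v rfl h4).elim
        · exfalso
          -- `v` before `w`; so `v` has a successor
          obtain ⟨z, hz, hmin⟩ := Set.exists_min_image
            {z : {v // P v} | z.1.2.1 = v.1.2.1 ∧ y v + v.1.2.2.length ≤ y z} y
            (Set.toFinite _) ⟨w, h2, h4⟩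
          refine hs (true, z) (.inr ⟨rfl, rfl, hz.1, hz.2, ?_⟩)
          rintro q hq ⟨q1, q2⟩
          have := hmin q ⟨hq, q1⟩
          have q2 : y q + q.1.2.2.length ≤ y z := q2
          have q3 : 0 < q.1.2.2.length := hsys.pos q
          omega
    · refine ⟨.inl v.1.1, ?_⟩
      rcases a2 v.1.1 with ⟨_, h1⟩ | ⟨w, h1, h2, h3⟩
      · exact (h1 v rfl).elim
      · simp only [Sum.elim_inl, h1]
        rcases hsys.disj w v h2 with rfl | h4 | h4
        · rfl
        · obtain ⟨u, hu⟩ := hsys.nx_exists h2 h4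
          exact (hs (false, u) (.inl ⟨rfl, rfl, hu⟩)).elim
        · exact (h3 v rfl h4).elim

end

/-- `s` occurs in `p` at position `k`. -/
def Occ {E : Type} (p s : List E) (k : ℕ) : Prop :=
  ∀ (i : ℕ) (h : i < s.length), p[k + i]? = some s[i]

def LInj {E : Type} (p : List E) : Prop :=
  ∀ (k k' : ℕ) (e : E), p[k]? = some e → p[k']? = some e → k = k'

theorem Fam.linj {E : Type} {c : ℕ} {p : Fin c → List E} (h : Fam p) (i : Fin c) : LInj (p i) :=
  fun k k' e h1 h2 => (h i i k k' e h1 h2).2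

theorem occ_of_infix {E : Type} {p s : List E} (h : s <:+: p) : ∃ k, Occ p s k := by
  obtain ⟨k, _, hk⟩ := List.infix_iff_getElem?.1 h
  exact ⟨k, fun i hi => by rw [Nat.add_comm]; exact hk i hi⟩

theorem Occ.infix {E : Type} {p s : List E} {k : ℕ} (h : Occ p s k) (hs : s ≠ []) : s <:+: p := by
  have hl := List.length_pos_iff.2 hs
  refine List.infix_iff_getElem?.2 ⟨k, ?_, fun i hi => by rw [Nat.add_comm]; exact h i hi⟩
  have := (List.getElem?_eq_some_iff.1 (h (s.length - 1) (by omega))).1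
  omega

theorem Occ.uniq {E : Type} {p s : List E} {k k' : ℕ} (hp : LInj p) (hs : s ≠ [])
    (h : Occ p s k) (h' : Occ p s k') : k = k' := by
  have hl := List.length_pos_iff.2 hs
  exact hp _ _ _ (h 0 hl) (h' 0 hl)

theorem Occ.snoc {E : Type} {p s : List E} {k : ℕ} (h : Occ p s k) {e : E}
    (he : p[k + s.length]? = some e) : (s ++ [e]) <:+: p := by
  apply Occ.infix (k := k) _ (by simp)
  intro i hi
  rw [List.getElem_append]
  split
  · exact h i _
  · simp at hi
    have : i = s.length := by omega
    subst this
    simpa using he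

theorem Occ.cons {E : Type} {p s : List E} {k : ℕ} (h : Occ p s (k + 1)) {f : E}
    (hf : p[k]? = some f) : (f :: s) <:+: p := by
  apply Occ.infix (k := k) _ (by simp)
  intro i hi
  rcases i with _ | i
  · simpa using hf
  · simp at hi
    have := h i hi
    rw [show k + (i + 1) = k + 1 + i by omega, this]
    rfl

theorem occ_append {E : Type} (u s w : List E) : Occ (u ++ s ++ w) s u.length := by
  intro i hi
  rw [List.append_assoc, List.getElem?_append_right (by omega), List.getElem?_append_left (by omega)]
  simp

theorem Occ.split {E : Type} {p s : List E} {k : ℕ} (h : Occ p s k) (hk : k ≤ p.length) :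
    p = p.take k ++ s ++ p.drop (k + s.length) := by
  have : p.drop k = s ++ p.drop (k + s.length) := by
    apply List.ext_getElem?
    intro i
    rw [List.getElem?_drop]
    by_cases hi : i < s.length
    · rw [List.getElem?_append_left hi, h i hi, List.getElem?_eq_getElem hi]
    · rw [List.getElem?_append_right (by omega), List.getElem?_drop]
      congr 1; omega
  rw [List.append_assoc, ← this, List.take_append_drop]

theorem ordered_iff {E : Type} {p s t : List E} {k k' : ℕ} (hp : LInj p) (hs : s ≠ [])
    (ht : t ≠ []) (h : Occ p s k) (h' : Occ p t k') :
    OrderedOn p s t ↔ k + s.length ≤ k' := by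
  have hls := List.length_pos_iff.2 hs
  have hlt := List.length_pos_iff.2 ht
  constructor
  · rintro ⟨u, v, w, rfl⟩
    have h1 : Occ (u ++ s ++ v ++ t ++ w) s u.length := by
      have := occ_append u s (v ++ t ++ w)
      simpa using this
    have h2 : Occ (u ++ s ++ v ++ t ++ w) t (u ++ s ++ v).length := occ_append (u ++ s ++ v) t w
    have e1 := h.uniq hp hs h1
    have e2 := h'.uniq hp ht h2
    simp at e2
    omega
  · intro hle
    have l1 := (List.getElem?_eq_some_iff.1 (h 0 hls)).1
    have l2 := (List.getElem?_eq_some_iff.1 (h' 0 hlt)).1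
    have hO : Occ (p.drop (k + s.length)) t (k' - (k + s.length)) := by
      intro i hi
      rw [List.getElem?_drop, ← h' i hi]
      congr 1; omega
    have e1 := h.split (by omega)
    have e2 := hO.split (by simp; omega)
    refine ⟨p.take k, (p.drop (k + s.length)).take (k' - (k + s.length)),
      (p.drop (k + s.length)).drop (k' - (k + s.length) + t.length), ?_⟩
    calc p = p.take k ++ s ++ p.drop (k + s.length) := e1
      _ = p.take k ++ s ++ (_ ++ t ++ _) := congrArg _ e2
      _ = _ := by simp only [List.append_assoc]

theorem infix_pair {E : Type} {p : List E} {f e : E} :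
    [f, e] <:+: p ↔ ∃ k, p[k]? = some f ∧ p[k + 1]? = some e := by
  constructor
  · intro h
    obtain ⟨k, hk⟩ := occ_of_infix h
    exact ⟨k, hk 0 (by simp), hk 1 (by simp)⟩
  · rintro ⟨k, h1, h2⟩
    apply Occ.infix (k := k) _ (by simp)
    intro i hi
    rcases i with _ | _ | i
    · exact h1
    · exact h2
    · simp at hi

theorem sys_of {E : Type} {m n : ℕ} {φ : Fin m → List E} {ψ : Fin n → List E}
    {P : Fin m × Fin n × List E → Prop} (F1 : Fam φ) (F2 : Fam ψ)
    (Q1 : ∀ v, P v → v.2.2 ≠ [] ∧ v.2.2 <:+: φ v.1 ∧ v.2.2 <:+: ψ v.2.1)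
    (Q2 : ∀ v, P v → ∀ e, ¬ ((v.2.2 ++ [e]) <:+: φ v.1 ∧ (v.2.2 ++ [e]) <:+: ψ v.2.1))
    (Q3 : ∀ v, P v → ∀ f, ¬ ((f :: v.2.2) <:+: φ v.1 ∧ (f :: v.2.2) <:+: ψ v.2.1))
    (Q4 : ∀ a b f g e, f ≠ g → [f, e] <:+: φ a → [g, e] <:+: ψ b →
      ∃ s, P (a, b, s) ∧ s.head? = some e) :
    ∃ x y : {v // P v} → ℕ,
      Sys φ ψ (fun w : {v // P v} => w.1.1) (fun w => w.1.2.1) x y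
        (fun w => w.1.2.2.length) ∧
      (∀ w : {v // P v}, Occ (φ w.1.1) w.1.2.2 (x w)) ∧
      (∀ w : {v // P v}, Occ (ψ w.1.2.1) w.1.2.2 (y w)) ∧
      (∀ u w : {v // P v}, w.1.1 = u.1.1 →
        (OrderedOn (φ u.1.1) u.1.2.2 w.1.2.2 ↔ x u + u.1.2.2.length ≤ x w)) ∧
      (∀ u w : {v // P v}, w.1.2.1 = u.1.2.1 →
        (OrderedOn (ψ u.1.2.1) u.1.2.2 w.1.2.2 ↔ y u + u.1.2.2.length ≤ y w)) := by
  have hx : ∀ w : {v // P v}, ∃ k, Occ (φ w.1.1) w.1.2.2 k :=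
    fun w => occ_of_infix (Q1 w.1 w.2).2.1
  have hy : ∀ w : {v // P v}, ∃ k, Occ (ψ w.1.2.1) w.1.2.2 k :=
    fun w => occ_of_infix (Q1 w.1 w.2).2.2
  choose x hx using hx
  choose y hy using hy
  refine ⟨x, y, ?_, hx, hy, ?_, ?_⟩
  · refine ⟨F1, F2, ?_, ?_, ?_, ?_, ?_, ?_⟩
    · intro w
      exact List.length_pos_iff.2 (Q1 w.1 w.2).1
    · intro w i hi
      exact ⟨_, hx w i hi, hy w i hi⟩
    · intro w e h1 h2
      exact Q2 w.1 w.2 e ⟨(hx w).snoc h1, (hy w).snoc h2⟩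
    · intro w i j f h1 h2 h3 h4
      refine Q3 w.1 w.2 f ⟨Occ.cons (k := i) ?_ h3, Occ.cons (k := j) ?_ h4⟩
      · rw [← h1]; exact hx w
      · rw [← h2]; exact hy w
    · intro a' b' i j e f g h1 h2 h3 h4 h5
      obtain ⟨s, k1, k2⟩ := Q4 a' b' f g e h5 (infix_pair.2 ⟨i, h1, h2⟩)
        (infix_pair.2 ⟨j, h3, h4⟩)
      refine ⟨⟨_, k1⟩, rfl, ?_, rfl, ?_⟩
      · have hl : 0 < s.length := List.length_pos_iff.2 (Q1 _ k1).1
        have := hx ⟨_, k1⟩ 0 hl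
        rw [List.head?_eq_getElem?, List.getElem?_eq_getElem hl] at k2
        simp only [Option.some.inj k2] at this
        exact F1.linj _ _ _ _ this h2
      · have hl : 0 < s.length := List.length_pos_iff.2 (Q1 _ k1).1
        have := hy ⟨_, k1⟩ 0 hl
        rw [List.head?_eq_getElem?, List.getElem?_eq_getElem hl] at k2
        simp only [Option.some.inj k2] at this
        exact F2.linj _ _ _ _ this h4
    · rintro w w' h1 h2 h3 h4 h5
      have h1 : w.1.1 = w'.1.1 := h1
      have h3 : w.1.2.1 = w'.1.2.1 := h3
      have h5 : w.1.2.2.length = w'.1.2.2.length := h5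
      have : w.1.2.2 = w'.1.2.2 := by
        apply List.ext_getElem h5
        intro i i1 i2
        have e1 := hx w i i1
        have e2 := hx w' i i2
        rw [← h1, ← h2, e1] at e2
        exact Option.some.inj e2
      exact Subtype.ext (Prod.ext h1 (Prod.ext h3 this))
  · intro u w h
    have := hx w
    rw [h] at this
    exact ordered_iff (F1.linj _) (Q1 u.1 u.2).1 (Q1 w.1 w.2).1 (hx u) this
  · intro u w h
    have := hy w
    rw [h] at this
    exact ordered_iff (F2.linj _) (Q1 u.1 u.2).1 (Q1 w.1 w.2).1 (hy u) this

theorem lcp {E : Type} (p q : List E) : ∃ s, s <+: p ∧ s <+: q ∧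
    ∀ e, ¬ ((s ++ [e]) <+: p ∧ (s ++ [e]) <+: q) := by
  induction p generalizing q with
  | nil => exact ⟨[], by simp, by simp, by simp⟩
  | cons a p ih =>
    rcases q with _ | ⟨b, q⟩
    · exact ⟨[], by simp, by simp, by simp⟩
    · by_cases hab : a = b
      · subst hab
        obtain ⟨s, h1, h2, h3⟩ := ih q
        refine ⟨a :: s, by simpa using h1, by simpa using h2, ?_⟩
        intro e
        simpa using h3 e
      · refine ⟨[], by simp, by simp, ?_⟩
        rintro e ⟨h1, h2⟩
        simp at h1 h2
        exact hab (h1.symm.trans h2)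

/-- if `s ++ t` is an infix of an injective list in which `s` occurs as a prefix of the rest,
then so does `s ++ t` -/
theorem prefix_of_infix {E : Type} {A r t : List E} (hp : LInj (A ++ r)) {e : E}
    (ht : t.head? = some e) (hr : r.head? = some e) (h : t <:+: A ++ r) : t <+: r := by
  obtain ⟨k, hk⟩ := occ_of_infix h
  rcases t with _ | ⟨e', t⟩
  · simp at ht
  simp at ht
  subst ht
  have h0 := hk 0 (by simp)
  have : (A ++ r)[A.length]? = some e' := by
    rw [List.getElem?_append_right le_rfl, Nat.sub_self, ← List.head?_eq_getElem?, hr]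
  have hkA : k = A.length := hp _ _ _ h0 this
  subst hkA
  rw [List.prefix_iff_getElem?]
  intro i hi
  rw [← hk i hi, List.getElem?_append_right (by omega)]
  congr 1; omega

theorem ms_exists {E : Type} {p q : List E} (hp : LInj p) (hq : LInj q) {f g e : E} (hfg : f ≠ g)
    (h1 : [f, e] <:+: p) (h2 : [g, e] <:+: q) : ∃ s, MergedSub p q s ∧ s.head? = some e := by
  obtain ⟨A, B, rfl⟩ := h1
  obtain ⟨A', B', rfl⟩ := h2
  obtain ⟨s, s1, s2, s3⟩ := lcp B B'
  obtain ⟨C, rfl⟩ := s1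
  obtain ⟨C', rfl⟩ := s2
  refine ⟨e :: s, ⟨by simp, ⟨A ++ [f], C, by simp⟩, ⟨A' ++ [g], C', by simp⟩,
    ⟨f, g, hfg, ⟨A, C, by simp⟩, ⟨A', C', by simp⟩⟩, ?_⟩, rfl⟩
  rintro e' ⟨k1, k2⟩
  have r1 : A ++ [f, e] ++ (s ++ C) = (A ++ [f]) ++ (e :: (s ++ C)) := by simp
  have r2 : A' ++ [g, e] ++ (s ++ C') = (A' ++ [g]) ++ (e :: (s ++ C')) := by simp
  rw [r1] at k1 hp
  rw [r2] at k2 hq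
  have j1 := prefix_of_infix hp (e := e) (by simp) (by simp) k1
  have j2 := prefix_of_infix hq (e := e) (by simp) (by simp) k2
  refine s3 e' ⟨?_, ?_⟩
  · simpa using j1
  · simpa using j2

theorem start_infix {E : Type} {p s : List E} (hp : LInj p) (hs : s ≠ []) (h : s <+: p) (e : E)
    (he : (s ++ [e]) <:+: p) : (s ++ [e]) <+: p := by
  obtain ⟨C, rfl⟩ := h
  rcases s with _ | ⟨a, s⟩
  · simp at hs
  have hp' : LInj ([] ++ (a :: s ++ C)) := hp
  exact prefix_of_infix hp' (e := a) (by simp) (by simp) he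

theorem start_nocons {E : Type} {p s : List E} (hp : LInj p) (hs : s ≠ []) (h : s <+: p) (f : E)
    (he : (f :: s) <:+: p) : False := by
  obtain ⟨k, hk⟩ := occ_of_infix he
  have hl := List.length_pos_iff.2 hs
  have h1 := List.prefix_iff_getElem?.1 h 0 hl
  have h2 := hk 1 (by simp; omega)
  have := hp _ _ _ h1 h2
  omega

theorem start_uniq {E : Type} {p q s s' : List E} (h : StartSub p q s) (h' : StartSub p q s') :
    s = s' := by
  have aux : ∀ s s', StartSub p q s → StartSub p q s' → s <+: s' → s = s' := by
    rintro s s' h h' ⟨t, rfl⟩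
    rcases t with _ | ⟨e, t⟩
    · simp
    · exfalso
      have : (s ++ [e]) <+: (s ++ e :: t) := ⟨t, by simp⟩
      exact h.2.2.2 e ⟨this.trans h'.2.1, this.trans h'.2.2.1⟩
  rcases List.prefix_or_prefix_of_prefix h.2.1 h'.2.1 with k | k
  · exact aux _ _ h h' k
  · exact (aux _ _ h' h k).symm

section
variable {G : MultiDigraph} {m n : ℕ} {φ : Fin m → List G.E} {ψ : Fin n → List G.E}

theorem merged_nocons {E : Type} {p q s : List E} (hp : LInj p) (hq : LInj q)
    (h : MergedSub p q s) (f : E) : ¬ ((f :: s) <:+: p ∧ (f :: s) <:+: q) := by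
  rintro ⟨k1, k2⟩
  obtain ⟨hs, _, _, ⟨f', g', hne, h1, h2⟩, _⟩ := h
  have hl := List.length_pos_iff.2 hs
  have aux : ∀ p : List E, LInj p → ∀ f f', (f :: s) <:+: p → (f' :: s) <:+: p → f = f' := by
    intro p hp f f' h1 h2
    obtain ⟨k, hk⟩ := occ_of_infix h1
    obtain ⟨k', hk'⟩ := occ_of_infix h2
    have a1 := hk 1 (by simp; omega)
    have a2 := hk' 1 (by simp; omega)
    have : k = k' := by
      have := hp _ _ _ a1 a2
      omega
    subst this
    have b1 := hk 0 (by simp)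
    have b2 := hk' 0 (by simp)
    rw [b1] at b2
    simpa using b2
  exact hne ((aux p hp _ _ h1 k1).trans (aux q hq _ _ k2 h2))

theorem card_ms (F1 : Fam φ) (F2 : Fam ψ) :
    {v : Visit G m n | MS φ ψ v}.ncard = mergCount2 G φ ψ := by
  unfold mergCount2
  refine Set.ncard_congr (fun v hv => v.2.2.head hv.1) ?_ ?_ ?_
  · rintro ⟨a, b, s⟩ ⟨hs, _, _, ⟨f, g, hne, h1, h2⟩, _⟩
    simp only at hs h1 h2
    rcases s with _ | ⟨e, s⟩
    · simp at hs
    refine ⟨a, b, f, g, hne, ?_, ?_⟩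
    · exact List.IsInfix.trans ⟨[], s, by simp⟩ h1
    · exact List.IsInfix.trans ⟨[], s, by simp⟩ h2
  · rintro v v' hv hv' he
    obtain ⟨x, y, hsys, hx, hy, -, -⟩ := sys_of (P := MS φ ψ) F1 F2
      (fun v hv => ⟨hv.1, hv.2.1, hv.2.2.1⟩) (fun v hv => hv.2.2.2.2)
      (fun v hv => merged_nocons (F1.linj _) (F2.linj _) hv)
      (fun a b f g e h1 h2 h3 => ms_exists (F1.linj _) (F2.linj _) h1 h2 h3)
    have hl := List.length_pos_iff.2 hv.1
    have hl' := List.length_pos_iff.2 hv'.1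
    have a1 := hx ⟨v, hv⟩ 0 hl
    have a2 := hx ⟨v', hv'⟩ 0 hl'
    rw [List.head_eq_getElem, List.head_eq_getElem] at he
    simp only [← he] at a2
    obtain ⟨e1, e2⟩ := F1 _ _ _ _ _ a1 a2
    have := hsys.disj_aux (u := ⟨v, hv⟩) (w := ⟨v', hv'⟩) e1 (by omega)
      (by have := hsys.pos ⟨v, hv⟩; omega)
    exact congrArg Subtype.val this
  · rintro e ⟨a, b, f, g, hne, h1, h2⟩
    obtain ⟨s, k1, k2⟩ := ms_exists (F1.linj _) (F2.linj _) hne h1 h2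
    refine ⟨(a, b, s), k1, ?_⟩
    rw [List.head?_eq_some_head k1.1] at k2
    exact Option.some.inj k2

end

end AAProof

open AAProof in
/-- For a non-reroutable `(m, n)`-graph with distinct sources,
`|G|_M = ½ Σ_π Length(π)`, the sum being over all `m + n` AA-sequences; for a
non-reroutable `(n, n)`-graph with identical sources and `n` starting subpaths,
`|G|_M = ½ (Σ_π Length(π) − n)`, the sum being over all `n` ψ-AA-sequences. -/
theorem merging_count_eq_half_sum_of_AA_lengths :
    (∀ (G : MultiDigraph) (S1 S2 R1 R2 : G.V) (m n : ℕ)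
        (φ : Fin m → List G.E) (ψ : Fin n → List G.E),
        MNGraph G S1 S2 R1 R2 m n φ ψ → S1 ≠ S2 →
        ∀ (P : Fin m → List (Visit G m n)) (Q : Fin n → List (Visit G m n)),
          (∀ i, IsPhiAA φ ψ (MS φ ψ) i (P i)) →
          (∀ j, IsPsiAA φ ψ (MS φ ψ) j (Q j)) →
          2 * mergCount2 G φ ψ = (∑ i, (P i).length) + ∑ j, (Q j).length) ∧
      ∀ (G : MultiDigraph) (S R1 R2 : G.V) (n : ℕ) (φ ψ : Fin n → List G.E),
        MNGraph G S S R1 R2 n n φ ψ →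
        (∀ i : Fin n, ∃ s, StartSub (φ i) (ψ i) s) →
        ∀ Q : Fin n → List (Visit G n n),
          (∀ j, IsPsiAA φ ψ (MSI φ ψ) j (Q j)) →
          2 * mergCount2 G φ ψ + n = ∑ j, (Q j).length := by
  constructor
  · intro G S1 S2 R1 R2 m n φ ψ hG _ A B hA hB
    obtain ⟨hac, _, _, _, h1, h2, _, hN1, hN2⟩ := hG
    have F1 := fam_of_menger hac h1
    have F2 := fam_of_menger hac h2
    obtain ⟨x, y, hsys, hx, hy, hO1, hO2⟩ := sys_of (P := MS φ ψ) F1 F2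
      (fun v hv => ⟨hv.1, hv.2.1, hv.2.2.1⟩) (fun v hv => hv.2.2.2.2)
      (fun v hv => merged_nocons (F1.linj _) (F2.linj _) hv)
      (fun a b f g e h1 h2 h3 => ms_exists (F1.linj _) (F2.linj _) h1 h2 h3)
    have := hsys.finite
    rw [gen hsys hO1 hO2 (st_wf hac h1 h2 hN1 hN2 hsys) A B hA hB, ← card_ms F1 F2]
    rfl
  · intro G S R1 R2 n φ ψ hG hst B hB
    obtain ⟨hac, _, _, _, h1, h2, _, hN1, hN2⟩ := hG
    have F1 := fam_of_menger hac h1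
    have F2 := fam_of_menger hac h2
    obtain ⟨x, y, hsys, hx, hy, hO1, hO2⟩ := sys_of (P := MSI φ ψ) F1 F2
      (by
        rintro ⟨a, b, s⟩ (hv | ⟨e, hv⟩)
        · exact ⟨hv.1, hv.2.1, hv.2.2.1⟩
        · simp only at e hv
          subst e
          exact ⟨hv.1, hv.2.1.isInfix, hv.2.2.1.isInfix⟩)
      (by
        rintro ⟨a, b, s⟩ (hv | ⟨e, hv⟩)
        · exact hv.2.2.2.2
        · simp only at e hv
          subst e
          rintro e ⟨k1, k2⟩
          exact hv.2.2.2 e ⟨start_infix (F1.linj _) hv.1 hv.2.1 e k1,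
            start_infix (F2.linj _) hv.1 hv.2.2.1 e k2⟩)
      (by
        rintro ⟨a, b, s⟩ (hv | ⟨e, hv⟩)
        · exact merged_nocons (F1.linj _) (F2.linj _) hv
        · rintro f ⟨k1, _⟩
          exact start_nocons (F1.linj _) hv.1 hv.2.1 f k1)
      (fun a b f g e h1 h2 h3 => by
        obtain ⟨s, k1, k2⟩ := ms_exists (F1.linj _) (F2.linj _) h1 h2 h3
        exact ⟨s, .inl k1, k2⟩)
    have hfin := hsys.finite
    choose ω hω using hst
    have hP : ∀ i, MSI φ ψ (i, i, ω i) := fun i => .inr ⟨rfl, hω i⟩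
    have hpre : ∀ {p s : List G.E}, s <+: p → Occ p s 0 := by
      intro p s h i hi
      rw [Nat.zero_add]
      exact List.prefix_iff_getElem?.1 h i hi
    have hx0 : ∀ i, x ⟨_, hP i⟩ = 0 := fun i =>
      (hx ⟨_, hP i⟩).uniq (F1.linj _) (hω i).1 (hpre (hω i).2.1)
    have hy0 : ∀ i, y ⟨_, hP i⟩ = 0 := fun i =>
      (hy ⟨_, hP i⟩).uniq (F2.linj _) (hω i).1 (hpre (hω i).2.2.1)
    have hA : ∀ i, IsPhiAA φ ψ (MSI φ ψ) i [(i, i, ω i)] := by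
      intro i
      refine .inr ⟨(i, i, ω i), [], rfl, rfl, hP i, ?_, .stopAgainst _ ?_⟩
      · intro u hu hi ho
        have hi' : i = u.1 := hi.symm
        subst hi'
        have := (hO1 ⟨u, hu⟩ ⟨_, hP u.1⟩ rfl).1 ho
        have := hsys.pos ⟨u, hu⟩
        have := hx0 u.1
        omega
      · intro u hu hi ho
        have hi' : i = u.2.1 := hi.symm
        subst hi'
        have := (hO2 ⟨u, hu⟩ ⟨_, hP u.2.1⟩ rfl).1 ho
        have := hsys.pos ⟨u, hu⟩
        have := hy0 u.2.1
        omega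
    have hgen := gen hsys hO1 hO2 (st_wf hac h1 h2 hN1 hN2 hsys) _ B hA hB
    have hcard : Nat.card {v // MSI φ ψ v} = mergCount2 G φ ψ + n := by
      rw [← card_ms F1 F2]
      have e1 : {v : Visit G n n | MSI φ ψ v} =
          {v | MS φ ψ v} ∪ Set.range (fun i => ((i, i, ω i) : Visit G n n)) := by
        ext ⟨a, b, s⟩
        constructor
        · rintro (hv | ⟨e, hv⟩)
          · exact .inl hv
          · simp only at e hv
            subst e
            right
            refine ⟨a, ?_⟩
            simp only [start_uniq (hω a) hv]
        · rintro (hv | ⟨i, hv⟩)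
          · exact .inl hv
          · rw [← hv]
            exact hP i
      have hf : {v : Visit G n n | MSI φ ψ v}.Finite := hfin
      have e2 : Nat.card {v // MSI φ ψ v} = {v : Visit G n n | MSI φ ψ v}.ncard := rfl
      rw [e2, e1, Set.ncard_union_eq ?_ ?_ (Set.finite_range _)]
      · congr 1
        rw [← Nat.card_coe_set_eq, Nat.card_range_of_injective]
        · simp
        · intro i j hij
          exact congrArg (fun q => q.1) hij
      · rw [Set.disjoint_left]
        rintro v hv ⟨i, rfl⟩
        obtain ⟨_, _, _, ⟨f, g, _, k1, k2⟩, _⟩ := hv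
        exact start_nocons (F1.linj _) (hω i).1 (hω i).2.1 f k1
      · exact hf.subset (fun v hv => .inl hv)
    rw [hcard] at hgen
    simp at hgen
    omega
end
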